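/- arXiv:1809.05308 — 2 statements merged into one kernel-verified Lean document; each statement's English description precedes it below -/
import Mathlib

section
/- There exists a mild solution P : [0,T] → 𝒮(H) of the Lyapunov equation satisfying, for some constant C > 0, ∑_{j=1}^∞ |⟨P_s Ĉ_j(s) x, Ĉ_j(s) x⟩| ≤ C (T−s)^{−2α} |x|² for all s ∈ [0,T) and x ∈ H; moreover, any two mild solutions each satisfying a bound of this form coincide. -/
open scoped RealInnerProductSpace
open Filter MeasureTheory

/-- `P` is a mild solution on `[0,T]` of the Lyapunov equation
`P' + A*P + PA + A₀*P + PA₀ + ∑ Ĉ_j* P Ĉ_j + f = 0`, `P_T = G`,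
tested against the semigroup `S t = e^{tA}`: it is a strongly continuous family of bounded
self-adjoint operators such that for all `t ∈ [0,T]` and `x, y ∈ H`,
`⟨P_t x, y⟩ = ⟨G e^{(T−t)A}x, e^{(T−t)A}y⟩ + ∫_t^T ⟨(f_s + A₀(s)*P_s + P_s A₀(s) +
∑_j Ĉ_j(s)* P_s Ĉ_j(s)) e^{(s−t)A}x, e^{(s−t)A}y⟩ ds`. -/
def IsLyapunovMildSolution
    {H : Type*} [NormedAddCommGroup H] [InnerProductSpace ℝ H] [CompleteSpace H]
    (T : ℝ) (S : ℝ → H →L[ℝ] H)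
    (A0 : ℝ → H →L[ℝ] H) (Chat : ℕ → ℝ → H →L[ℝ] H) (f : ℝ → H →L[ℝ] H)
    (G : H →L[ℝ] H) (P : ℝ → H →L[ℝ] H) : Prop :=
  (∀ t ∈ Set.Icc (0 : ℝ) T, IsSelfAdjoint (P t)) ∧
  (∀ x : H, ContinuousOn (fun t => P t x) (Set.Icc (0 : ℝ) T)) ∧
  (∀ t ∈ Set.Icc (0 : ℝ) T, ∀ x y : H,
    ⟪P t x, y⟫
      = ⟪G (S (T - t) x), S (T - t) y⟫
        + ∫ s in t..T,
            (⟪f s (S (s - t) x), S (s - t) y⟫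
              + ⟪P s (S (s - t) x), A0 s (S (s - t) y)⟫
              + ⟪P s (A0 s (S (s - t) x)), S (s - t) y⟫
              + ∑' j, ⟪P s (Chat j s (S (s - t) x)), Chat j s (S (s - t) y)⟫))

/-- The singular bound `∑_j |⟨P_s Ĉ_j(s) x, Ĉ_j(s) x⟩| ≤ C (T−s)^{−2α} ‖x‖²` on `[0,T)`. -/
def LyapunovSingularBound
    {H : Type*} [NormedAddCommGroup H] [InnerProductSpace ℝ H] [CompleteSpace H]
    (T α : ℝ) (Chat : ℕ → ℝ → H →L[ℝ] H) (P : ℝ → H →L[ℝ] H) : Prop :=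
  ∃ C > 0, ∀ s ∈ Set.Ico (0 : ℝ) T, ∀ x : H,
    (Summable fun j => |⟪P s (Chat j s x), Chat j s x⟫|) ∧
    (∑' j, |⟪P s (Chat j s x), Chat j s x⟫|) ≤ C * (T - s) ^ (-2 * α) * ‖x‖ ^ 2

open Set Topology

section FormsAndMeasurability

variable {H : Type*} [NormedAddCommGroup H] [InnerProductSpace ℝ H]

/-- A weakly measurable family of operators, evaluated on strongly measurable functions, gives a
measurable function. -/
theorem measurable_inner_apply {X : Type*} [MeasurableSpace X] {K : X → H →L[ℝ] H}
    (hK : ∀ x y : H, Measurable fun s => ⟪K s x, y⟫) {g h : X → H}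
    (hg : StronglyMeasurable g) (hh : StronglyMeasurable h) :
    Measurable fun s => ⟪K s (g s), h s⟫ := by
  refine measurable_of_tendsto_metrizable
    (f := fun n s => ⟪K s (hg.approx n s), hh.approx n s⟫) (fun n => ?_) ?_
  · exact SimpleFunc.measurable_bind (hg.approx n) (fun b s => ⟪K s b, hh.approx n s⟫) fun b =>
      SimpleFunc.measurable_bind (hh.approx n) (fun d s => ⟪K s b, d⟫) fun d => hK b d
  · rw [tendsto_pi_nhds]
    intro s
    exact (((K s).continuous.tendsto _).comp (hg.tendsto_approx s)).inner (hh.tendsto_approx s)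

theorem norm_le_of_abs_inner_le (B : H →L[ℝ] H) {C : ℝ} (hC : 0 ≤ C)
    (h : ∀ x y, |⟪B x, y⟫| ≤ C * ‖x‖ * ‖y‖) : ‖B‖ ≤ C := by
  refine ContinuousLinearMap.opNorm_le_bound _ hC fun x => ?_
  have h := h x (B x)
  rw [real_inner_self_eq_norm_sq, abs_of_nonneg (by positivity), sq] at h
  by_cases h0 : ‖B x‖ = 0
  · rw [h0]; positivity
  · exact le_of_mul_le_mul_right h (lt_of_le_of_ne (norm_nonneg _) (Ne.symm h0))

theorem exists_eq_inner_of_symmetric_form [CompleteSpace H] (b : H → H → ℝ) (C : ℝ)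
    (hC : 0 ≤ C)
    (hsymm : ∀ x y, b x y = b y x) (hadd : ∀ x x' y, b (x + x') y = b x y + b x' y)
    (hsmul : ∀ (a : ℝ) x y, b (a • x) y = a * b x y) (hb : ∀ x, |b x x| ≤ C * ‖x‖ ^ 2) :
    ∃ B : H →L[ℝ] H, IsSelfAdjoint B ∧ (∀ x y, ⟪B x, y⟫ = b x y) ∧ ‖B‖ ≤ C := by
  have hadd' : ∀ x y y', b x (y + y') = b x y + b x y' := fun x y y' => by
    rw [hsymm, hadd, hsymm y, hsymm y']
  have hsmul' : ∀ (a : ℝ) x y, b x (a • y) = a * b x y := fun a x y => by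
    rw [hsymm, hsmul, hsymm y]
  have hpol : ∀ x y, ‖x‖ = 1 → ‖y‖ = 1 → |b x y| ≤ C := by
    intro x y hx hy
    have h1 := hb (x + y)
    have h2 := hb (x - y)
    have hs : x - y = x + (-1 : ℝ) • y := by simp [sub_eq_add_neg]
    have hpar := parallelogram_law_with_norm ℝ x y
    rw [hx, hy] at hpar
    have e1 : b (x + y) (x + y) = b x x + 2 * b x y + b y y := by
      rw [hadd, hadd', hadd', hsymm y x]; ring
    have e2 : b (x - y) (x - y) = b x x - 2 * b x y + b y y := by
      rw [hs, hadd, hadd', hadd', hsmul, hsmul, hsmul', hsmul', hsymm y x]; ring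
    rw [e1, abs_le] at h1
    rw [e2, abs_le] at h2
    have : C * ‖x + y‖ ^ 2 + C * ‖x - y‖ ^ 2 = 4 * C := by
      rw [← mul_add]
      have : ‖x + y‖ ^ 2 + ‖x - y‖ ^ 2 = 4 := by nlinarith
      rw [this]; ring
    rw [abs_le]
    constructor <;> linarith [h1.1, h1.2, h2.1, h2.2]
  have hbd : ∀ x y, |b x y| ≤ C * ‖x‖ * ‖y‖ := by
    intro x y
    by_cases hx : x = 0
    · have : b x y = 0 := by simpa [hx] using hsmul 0 x y
      rw [this, hx]; simp
    by_cases hy : y = 0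
    · have : b x y = 0 := by simpa [hy] using hsmul' 0 x y
      rw [this, hy]; simp
    have hx' := norm_ne_zero_iff.2 hx
    have hy' := norm_ne_zero_iff.2 hy
    have h := hpol (‖x‖⁻¹ • x) (‖y‖⁻¹ • y) (by simp [norm_smul, hx']) (by simp [norm_smul, hy'])
    have e : b x y = ‖x‖ * ‖y‖ * b (‖x‖⁻¹ • x) (‖y‖⁻¹ • y) := by
      rw [hsmul, hsmul']; field_simp
    rw [e, abs_mul, abs_of_nonneg (by positivity)]
    calc _ ≤ ‖x‖ * ‖y‖ * C := by gcongr
      _ = _ := by ring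
  let B₀ : H →ₗ[ℝ] H →ₗ[ℝ] ℝ := LinearMap.mk₂ ℝ b hadd (by simpa using hsmul) hadd'
    (by simpa using hsmul')
  let B₁ : H →L[ℝ] H →L[ℝ] ℝ := LinearMap.mkContinuous₂ B₀ C hbd
  let B := InnerProductSpace.continuousLinearMapOfBilin (𝕜 := ℝ) B₁
  have hB : ∀ x y, ⟪B x, y⟫ = b x y := fun x y =>
    InnerProductSpace.continuousLinearMapOfBilin_apply (𝕜 := ℝ) B₁ x y
  refine ⟨B, ?_, hB, ?_⟩
  · rw [ContinuousLinearMap.isSelfAdjoint_iff_isSymmetric]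
    intro x y
    change ⟪B x, y⟫ = ⟪x, B y⟫
    rw [hB, real_inner_comm, hB, hsymm]
  · exact norm_le_of_abs_inner_le B hC fun x y => by rw [hB]; exact hbd x y

theorem norm_le_of_abs_inner_self_le [CompleteSpace H] {B : H →L[ℝ] H} (hB : IsSelfAdjoint B)
    {C : ℝ} (hC : 0 ≤ C) (h : ∀ x, |⟪B x, x⟫| ≤ C * ‖x‖ ^ 2) : ‖B‖ ≤ C := by
  obtain ⟨B', -, hB', hnorm⟩ := exists_eq_inner_of_symmetric_form (fun x y => ⟪B x, y⟫) C hC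
    (fun x y => by
      rw [real_inner_comm]
      exact ((ContinuousLinearMap.isSelfAdjoint_iff_isSymmetric.1 hB) y x).symm)
    (fun x x' y => by rw [map_add, inner_add_left])
    (fun a x y => by rw [map_smul, real_inner_smul_left]) h
  rwa [show B' = B from ContinuousLinearMap.ext fun x =>
    ext_inner_right ℝ fun y => hB' x y] at hnorm

theorem stronglyMeasurable_starProjection {X : Type*} [MeasurableSpace X] (U : Submodule ℝ H)
    [FiniteDimensional ℝ U] {w : X → H} (hw : ∀ y : H, Measurable fun s => ⟪w s, y⟫) :
    StronglyMeasurable fun s => U.starProjection (w s) := by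
  let e := stdOrthonormalBasis ℝ U
  have : (fun s => U.starProjection (w s)) = fun s => ∑ i, ⟪(e i : H), w s⟫ • (e i : H) := by
    funext s
    rw [Submodule.starProjection_apply, e.orthogonalProjectionOnto_apply_eq_sum]
    simp
  rw [this]
  refine Finset.stronglyMeasurable_fun_sum _ fun i _ => ?_
  refine StronglyMeasurable.smul_const (Measurable.stronglyMeasurable ?_) _
  simpa only [real_inner_comm] using hw (e i)

theorem ae_eq_zero_of_setIntegral_Iic_rat {g : ℝ → ℝ} (hg : Integrable g)
    (huniv : ∫ s, g s = 0) (hIic : ∀ q : ℚ, ∫ s in Iic (q : ℝ), g s = 0) : g =ᵐ[volume] 0 := by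
  refine hg.ae_eq_zero_of_forall_setIntegral_eq_zero fun E hE hfin => ?_
  clear hfin
  induction E, hE using MeasurableSpace.induction_on_inter
    (BorelSpace.measurable_eq.trans Real.borel_eq_generateFrom_Iic_rat) Real.isPiSystem_Iic_rat with
  | empty => simp
  | basic t ht =>
    obtain ⟨q, hq⟩ := mem_iUnion.1 ht
    rw [mem_singleton_iff.1 hq]
    exact hIic q
  | compl t ht ih =>
    have := integral_add_compl ht hg
    rw [huniv, ih] at this
    simpa using this
  | iUnion F hd hm ih =>
    rw [integral_iUnion hm hd hg.integrableOn]
    simp [ih]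

/-- An integrably bounded weakly measurable function with values in a Hilbert space, separable or
not, is weakly equivalent to a strongly measurable function. -/
theorem exists_stronglyMeasurable_weakly_ae_eq [CompleteSpace H] {w : ℝ → H} {φ : ℝ → ℝ}
    (hw : ∀ y : H, Measurable fun s => ⟪w s, y⟫) (hφ : Integrable φ) (hwφ : ∀ s, ‖w s‖ ≤ φ s) :
    ∃ w' : ℝ → H, StronglyMeasurable w' ∧ (∀ s, ‖w' s‖ ≤ ‖w s‖) ∧
      ∀ y : H, ∀ᵐ s, ⟪w s, y⟫ = ⟪w' s, y⟫ := by
  have hbd : ∀ y s, ‖⟪w s, y⟫‖ ≤ φ s * ‖y‖ := fun y s =>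
    (norm_inner_le_norm _ _).trans (by gcongr; exact hwφ s)
  have hintg : ∀ y, Integrable fun s => ⟪w s, y⟫ := fun y =>
    (hφ.mul_const ‖y‖).mono' (hw y).aestronglyMeasurable (.of_forall (hbd y))
  have hW : ∀ E : Set ℝ, ∃ v : H, ∀ y, ⟪v, y⟫ = ∫ s in E, ⟪w s, y⟫ := by
    intro E
    let l : H →ₗ[ℝ] ℝ :=
      { toFun := fun y => ∫ s in E, ⟪w s, y⟫
        map_add' := fun y z => by
          simp only [inner_add_right]
          exact integral_add (hintg y).integrableOn (hintg z).integrableOn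
        map_smul' := fun a y => by
          simp only [inner_smul_right]
          exact integral_const_mul _ _ }
    let L : H →L[ℝ] ℝ := l.mkContinuous (∫ s in E, φ s) fun y => by
      rw [← integral_mul_const]
      exact norm_integral_le_of_norm_le (hφ.mul_const _).integrableOn (.of_forall (hbd y))
    exact ⟨(InnerProductSpace.toDual ℝ H).symm L, fun y =>
      InnerProductSpace.toDual_symm_apply (𝕜 := ℝ)⟩
  choose W hW using hW
  obtain ⟨e, he⟩ := exists_surjective_nat (Option ℚ)
  let v : ℕ → H := fun n => (e n).elim (W univ) fun q => W (Iic (q : ℝ))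
  let U : ℕ → Submodule ℝ H := fun n => Submodule.span ℝ (v '' Iic n)
  have hUfin : ∀ n, FiniteDimensional ℝ (U n) := fun n =>
    FiniteDimensional.span_of_finite ℝ ((finite_Iic n).image v)
  have hUmono : Monotone U := fun m n hmn =>
    Submodule.span_mono (image_mono (Iic_subset_Iic.2 hmn))
  let R := (⨆ n, U n).topologicalClosure
  have : CompleteSpace R := (Submodule.isClosed_topologicalClosure _).completeSpace_coe
  have hvR : ∀ n, v n ∈ R := fun n => Submodule.le_topologicalClosure _
    (Submodule.mem_iSup_of_mem n (Submodule.subset_span ⟨n, mem_Iic.2 le_rfl, rfl⟩))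
  refine ⟨fun s => R.starProjection (w s), ?_, fun s => ?_, fun y => ?_⟩
  · refine stronglyMeasurable_of_tendsto atTop
      (fun n => stronglyMeasurable_starProjection (U n) hw) ?_
    rw [tendsto_pi_nhds]
    exact fun s => Submodule.starProjection_tendsto_closure_iSup U hUmono (w s)
  · exact R.norm_starProjection_apply_le (w s)
  · have hperp : ∀ n, ⟪v n, y - R.starProjection y⟫ = 0 := fun n =>
      R.inner_right_of_mem_orthogonal (hvR n) (R.sub_starProjection_mem_orthogonal y)
    have hzero := ae_eq_zero_of_setIntegral_Iic_rat (hintg (y - R.starProjection y))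
      (by
        obtain ⟨n, hn⟩ := he none
        have := hperp n
        simpa [v, hn, hW] using this)
      (fun q => by
        obtain ⟨n, hn⟩ := he (some q)
        have := hperp n
        simpa only [v, hn, hW, Option.elim_some] using this)
    filter_upwards [hzero] with s hs
    rw [R.inner_starProjection_left_eq_right]
    simpa [inner_sub_right, sub_eq_zero] using hs

end FormsAndMeasurability

section Semigroup

open ContinuousLinearMap (adjoint)

variable {H : Type*} [NormedAddCommGroup H] [InnerProductSpace ℝ H]

/-- A strongly continuous semigroup of bounded operators, indexed by `[0, ∞) ⊆ ℝ`. -/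
structure IsStronglyContinuousSemigroup (S : ℝ → H →L[ℝ] H) : Prop where
  zero : S 0 = ContinuousLinearMap.id ℝ H
  add : ∀ s t : ℝ, 0 ≤ s → 0 ≤ t → S (s + t) = (S s).comp (S t)
  continuousOn : ∀ x : H, ContinuousOn (fun t => S t x) (Ici (0 : ℝ))

namespace IsStronglyContinuousSemigroup

variable {S : ℝ → H →L[ℝ] H}

theorem continuous_max (hS : IsStronglyContinuousSemigroup S) (x : H) :
    Continuous fun t => S (max t 0) x :=
  (hS.continuousOn x).comp_continuous (by fun_prop) fun t => le_max_right t 0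

variable [CompleteSpace H]

theorem exists_norm_le (hS : IsStronglyContinuousSemigroup S) (T : ℝ) :
    ∃ M, 0 < M ∧ ∀ t ∈ Icc 0 T, ‖S t‖ ≤ M := by
  obtain ⟨C, hC⟩ := banach_steinhaus (g := fun t : Icc 0 T => S t) fun x => by
    obtain ⟨C, hC⟩ := isCompact_Icc.exists_bound_of_continuousOn
      ((hS.continuousOn x).mono (Icc_subset_Ici_self : Icc 0 T ⊆ _))
    exact ⟨C, fun t => hC t t.2⟩
  exact ⟨max C 1, by positivity, fun t ht => (hC ⟨t, ht⟩).trans (le_max_left _ _)⟩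

theorem tendsto_adjoint_integral (hS : IsStronglyContinuousSemigroup S) {h : ℝ} (hh : 0 ≤ h)
    (y : H) : ∃ v : H, (∀ z, ⟪v, z⟫ = ⟪y, ∫ s in 0..h, S (max s 0) z⟫) ∧
      Tendsto (fun t => adjoint (S t) v) (𝓝[≥] 0) (𝓝 v) := by
  obtain ⟨M, hM0, hM⟩ := hS.exists_norm_le (h + 1)
  have hintg : ∀ z a b, IntervalIntegrable (fun s => S (max s 0) z) volume a b := fun z a b =>
    (hS.continuous_max z).intervalIntegrable _ _
  have hbd : ∀ z a b, 0 ≤ a → a ≤ b → b ≤ h + 1 →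
      ‖∫ s in a..b, S (max s 0) z‖ ≤ M * ‖z‖ * (b - a) := by
    intro z a b ha hab hb
    refine (intervalIntegral.norm_integral_le_of_norm_le_const (C := M * ‖z‖) fun s hs => ?_).trans
      (by rw [abs_of_nonneg (by linarith)])
    rw [uIoc_of_le hab] at hs
    refine (S _).le_of_opNorm_le (hM _ ⟨le_max_right _ _, ?_⟩) z
    rw [max_eq_left (by linarith [hs.1])]
    linarith [hs.2]
  let B₀ : H →ₗ[ℝ] H :=
    { toFun := fun z => ∫ s in 0..h, S (max s 0) z
      map_add' := fun z z' => by
        simp only [map_add]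
        exact intervalIntegral.integral_add (hintg z _ _) (hintg z' _ _)
      map_smul' := fun a z => by
        simp only [map_smul]
        exact intervalIntegral.integral_smul _ _ }
  let B : H →L[ℝ] H := B₀.mkContinuous (M * h) fun z => by
    have := hbd z 0 h le_rfl hh (by linarith)
    rw [sub_zero] at this
    calc _ ≤ _ := this
      _ = _ := by ring
  have hB : ∀ z, B z = ∫ s in 0..h, S (max s 0) z := fun z => rfl
  refine ⟨adjoint B y, fun z => by rw [ContinuousLinearMap.adjoint_inner_left, hB], ?_⟩
  have key : ∀ t ∈ Icc (0 : ℝ) 1,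
      ‖adjoint (S t) (adjoint B y) - adjoint B y‖ ≤ ‖y‖ * (2 * M * t) := by
    intro t ht
    have hdiff : ∀ z, ‖B (S t z) - B z‖ ≤ 2 * M * t * ‖z‖ := by
      intro z
      have e1 : B (S t z) = ∫ s in t..(h + t), S (max s 0) z := by
        rw [hB]
        have := intervalIntegral.integral_comp_add_right (a := 0) (b := h)
          (fun s => S (max s 0) z) t
        rw [zero_add] at this
        rw [← this]
        refine intervalIntegral.integral_congr fun s hs => ?_
        rw [uIcc_of_le hh] at hs
        rw [max_eq_left hs.1, max_eq_left (add_nonneg hs.1 ht.1), hS.add s t hs.1 ht.1]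
        rfl
      have e2 : B (S t z) - B z =
          (∫ s in h..(h + t), S (max s 0) z) - ∫ s in 0..t, S (max s 0) z := by
        rw [e1, hB, ← intervalIntegral.integral_add_adjacent_intervals (hintg z 0 t) (hintg z t h),
          ← intervalIntegral.integral_add_adjacent_intervals (hintg z t h) (hintg z h (h + t))]
        abel
      rw [e2]
      refine (norm_sub_le _ _).trans ?_
      have h1 := hbd z h (h + t) hh (by linarith [ht.1]) (by linarith [ht.2])
      have h2 := hbd z 0 t le_rfl ht.1 (by linarith [ht.2])
      nlinarith
    have hv : ∀ z, ⟪adjoint (S t) (adjoint B y) - adjoint B y, z⟫ = ⟪y, B (S t z) - B z⟫ := by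
      intro z
      simp only [inner_sub_left, inner_sub_right, ContinuousLinearMap.adjoint_inner_left]
    set v := adjoint (S t) (adjoint B y) - adjoint B y with hvdef
    have h1 : ‖v‖ * ‖v‖ ≤ ‖y‖ * (2 * M * t) * ‖v‖ := by
      rw [← real_inner_self_eq_norm_mul_norm, hv]
      refine (real_inner_le_norm _ _).trans ?_
      rw [mul_assoc]
      gcongr
      exact hdiff v
    by_cases h0 : ‖v‖ = 0
    · rw [h0]
      have := ht.1
      positivity
    · exact le_of_mul_le_mul_right h1 (lt_of_le_of_ne (norm_nonneg _) (Ne.symm h0))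
  rw [tendsto_iff_norm_sub_tendsto_zero]
  refine squeeze_zero' (.of_forall fun _ => norm_nonneg _)
    (?_ : ∀ᶠ t in 𝓝[≥] (0 : ℝ), _ ≤ ‖y‖ * (2 * M * t)) ?_
  · filter_upwards [Icc_mem_nhdsGE (zero_lt_one' ℝ)] with t ht using key t ht
  · refine Tendsto.mono_left ?_ nhdsWithin_le_nhds
    have : Continuous fun t : ℝ => ‖y‖ * (2 * M * t) := by fun_prop
    simpa using this.tendsto 0

theorem tendsto_adjoint_zero (hS : IsStronglyContinuousSemigroup S) (x : H) :
    Tendsto (fun t => adjoint (S t) x) (𝓝[≥] 0) (𝓝 x) := by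
  let V : Submodule ℝ H :=
    { carrier := {x | Tendsto (fun t => adjoint (S t) x) (𝓝[≥] 0) (𝓝 x)}
      zero_mem' := by simp
      add_mem' := fun {a b} ha hb => by
        simpa only [mem_ofPred_eq, map_add] using ha.add hb
      smul_mem' := fun a x hx => by
        simpa only [mem_ofPred_eq, map_smul] using hx.const_smul a }
  have hV : Vᗮ = ⊥ := by
    rw [Submodule.eq_bot_iff]
    intro z hz
    have hzero : ∀ h, 0 ≤ h → ∫ s in 0..h, S (max s 0) z = 0 := by
      intro h hh
      obtain ⟨v, hv, hvV⟩ := hS.tendsto_adjoint_integral hh (∫ s in 0..h, S (max s 0) z)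
      have h0 : ⟪v, z⟫ = 0 := Submodule.inner_right_of_mem_orthogonal (K := V) hvV hz
      rwa [hv, inner_self_eq_zero] at h0
    have hd : HasDerivAt (fun h => ∫ s in 0..h, S (max s 0) z) (S (max 0 0) z) 0 :=
      intervalIntegral.integral_hasDerivAt_right ((hS.continuous_max z).intervalIntegrable _ _)
        ((hS.continuous_max z).stronglyMeasurableAtFilter _ _) (hS.continuous_max z).continuousAt
    have hd' : HasDerivWithinAt (fun h => ∫ s in 0..h, S (max s 0) z) 0 (Ici 0) 0 :=
      (hasDerivWithinAt_const _ _ 0).congr (fun h hh => hzero h hh) (hzero 0 le_rfl)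
    have := (uniqueDiffOn_Ici (0 : ℝ) 0 self_mem_Ici).eq_deriv _ hd.hasDerivWithinAt hd'
    simpa [hS.zero] using this
  have hdense : x ∈ closure (V : Set H) := by
    rw [← Submodule.topologicalClosure_coe, Submodule.topologicalClosure_eq_top_iff.2 hV]
    trivial
  obtain ⟨M, hM0, hM⟩ := hS.exists_norm_le 1
  rw [Metric.tendsto_nhds]
  intro ε hε
  obtain ⟨v, hvV, hv⟩ := Metric.mem_closure_iff.1 hdense (ε / (2 * (M + 1))) (by positivity)
  have hvV' : Tendsto (fun t => adjoint (S t) v) (𝓝[≥] 0) (𝓝 v) := hvV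
  filter_upwards [Metric.tendsto_nhds.1 hvV' (ε / 2) (half_pos hε),
    Icc_mem_nhdsGE (zero_lt_one' ℝ)] with t ht ht1
  have h1 : dist (adjoint (S t) x) (adjoint (S t) v) ≤ M * dist x v := by
    rw [dist_eq_norm, dist_eq_norm, ← map_sub]
    exact ContinuousLinearMap.le_of_opNorm_le _ (by
      rw [LinearIsometryEquiv.norm_map]; exact hM t ht1) _
  have h2 : (M + 1) * dist x v < ε / 2 := by
    rw [lt_div_iff₀ (by positivity)] at hv
    linarith
  have h3 := dist_triangle4 (adjoint (S t) x) (adjoint (S t) v) v x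
  rw [dist_comm v x] at h3
  linarith

theorem dist_adjoint_le (hS : IsStronglyContinuousSemigroup S) {T M : ℝ}
    (hM : ∀ t ∈ Icc 0 T, ‖S t‖ ≤ M) (v : H) {a b : ℝ} (ha : a ∈ Icc 0 T) (hb : b ∈ Icc 0 T) :
    dist (adjoint (S a) v) (adjoint (S b) v) ≤ M * dist (adjoint (S |a - b|) v) v := by
  wlog hab : b ≤ a generalizing a b
  · rw [dist_comm, abs_sub_comm]
    exact this hb ha (le_of_not_ge hab)
  have e : adjoint (S a) v = adjoint (S b) (adjoint (S (a - b)) v) := by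
    rw [← ContinuousLinearMap.comp_apply, ← ContinuousLinearMap.adjoint_comp,
      ← hS.add _ _ (sub_nonneg.2 hab) hb.1, sub_add_cancel]
  rw [abs_of_nonneg (sub_nonneg.2 hab), e, dist_eq_norm, dist_eq_norm, ← map_sub]
  exact ContinuousLinearMap.le_of_opNorm_le _ (by
    rw [LinearIsometryEquiv.norm_map]; exact hM b hb) _

/-- The adjoint semigroup on a Hilbert space is strongly continuous, jointly in time and space. -/
theorem continuous_adjoint_max (hS : IsStronglyContinuousSemigroup S) :
    Continuous fun p : ℝ × H => adjoint (S (max p.1 0)) p.2 := by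
  rw [continuous_iff_continuousAt]
  rintro ⟨t, v⟩
  obtain ⟨M, hM0, hM⟩ := hS.exists_norm_le (max t 0 + 1)
  have hlim : Tendsto (fun p : ℝ × H => M * ‖p.2 - v‖ +
      M * dist (adjoint (S |max p.1 0 - max t 0|) v) v) (𝓝 (t, v)) (𝓝 0) := by
    have h1 : Tendsto (fun p : ℝ × H => M * ‖p.2 - v‖) (𝓝 (t, v)) (𝓝 0) := by
      have : Continuous fun p : ℝ × H => M * ‖p.2 - v‖ := by fun_prop
      simpa using this.tendsto (t, v)
    have h2 : Tendsto (fun p : ℝ × H => |max p.1 0 - max t 0|) (𝓝 (t, v)) (𝓝[≥] 0) := by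
      refine tendsto_nhdsWithin_iff.2 ⟨?_, .of_forall fun p => mem_Ici.2 (abs_nonneg _)⟩
      have : Continuous fun p : ℝ × H => |max p.1 0 - max t 0| := by fun_prop
      simpa using this.tendsto (t, v)
    have h3 := ((hS.tendsto_adjoint_zero v).comp h2).dist (tendsto_const_nhds (x := v))
    simpa using h1.add (h3.const_mul M)
  rw [ContinuousAt, tendsto_iff_dist_tendsto_zero]
  refine squeeze_zero' (.of_forall fun _ => dist_nonneg) ?_ hlim
  have hnear : ∀ᶠ p : ℝ × H in 𝓝 (t, v), max p.1 0 < max t 0 + 1 := by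
    have : Continuous fun p : ℝ × H => max p.1 0 := by fun_prop
    exact (this.tendsto (t, v)).eventually (gt_mem_nhds (lt_add_one _))
  filter_upwards [hnear] with p hp
  have hmem : max p.1 0 ∈ Icc 0 (max t 0 + 1) := ⟨le_max_right _ _, hp.le⟩
  refine (dist_triangle _ (adjoint (S (max p.1 0)) v) _).trans (add_le_add ?_ ?_)
  · rw [dist_eq_norm, ← map_sub]
    exact ContinuousLinearMap.le_of_opNorm_le _ (by
      rw [LinearIsometryEquiv.norm_map]; exact hM _ hmem) _
  · exact hS.dist_adjoint_le hM v hmem ⟨le_max_right _ _, by linarith⟩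

end IsStronglyContinuousSemigroup

end Semigroup

section Weight

/-- A weight `ω` on `[0, T)` comparable to `(T - s) ^ p`, which the kernel
`(s - t) ^ p + (T - t) ^ p` maps below `θ * ω`. -/
structure IsSingularWeight (T p θ : ℝ) (ω : ℝ → ℝ) (L : ℝ) : Prop where
  integrable : Integrable ω
  nonneg : ∀ s, 0 ≤ ω s
  le_weight : ∀ s ∈ Ico 0 T, (T - s) ^ p ≤ ω s
  weight_le : ∀ s ∈ Ico 0 T, ω s ≤ L * (T - s) ^ p
  intervalIntegrable : ∀ t ∈ Ico 0 T,
    IntervalIntegrable (fun s => ((s - t) ^ p + (T - t) ^ p) * ω s) volume t T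
  integral_le : ∀ t ∈ Ico 0 T, ∫ s in t..T, ((s - t) ^ p + (T - t) ^ p) * ω s ≤ θ * ω t

theorem rpow_mul_rpow_mul_exp_le {p l u r : ℝ} (hp : -1 < p) (hp0 : p < 0) (hl : 0 < l)
    (hu : 0 < u) (hur : u < r) :
    u ^ p * (r - u) ^ p * Real.exp (-(l * u)) ≤
      2 * r ^ p * (u ^ p * Real.exp (-(l * u)) + (r - u) ^ p * Real.exp (-(l * (r - u)))) := by
  have hr : 0 < r := hu.trans hur
  have hru : 0 < r - u := sub_pos.2 hur
  have hhalf : ∀ v, r / 2 ≤ v → v ^ p ≤ 2 * r ^ p := by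
    intro v hv
    calc v ^ p ≤ (r / 2) ^ p := Real.rpow_le_rpow_of_nonpos (by positivity) hv hp0.le
      _ = 2 ^ (-p) * r ^ p := by
        rw [Real.div_rpow hr.le zero_le_two, Real.rpow_neg zero_le_two]; field_simp
      _ ≤ 2 * r ^ p := by
        gcongr
        calc (2 : ℝ) ^ (-p) ≤ 2 ^ (1 : ℝ) :=
              Real.rpow_le_rpow_of_exponent_le one_le_two (by linarith)
          _ = 2 := Real.rpow_one 2
  rcases le_total u (r - u) with h | h
  · have h1 := hhalf (r - u) (by linarith)
    calc u ^ p * (r - u) ^ p * Real.exp (-(l * u))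
        ≤ u ^ p * (2 * r ^ p) * Real.exp (-(l * u)) := by gcongr
      _ = 2 * r ^ p * (u ^ p * Real.exp (-(l * u)) + 0) := by ring
      _ ≤ _ := by gcongr; positivity
  · have h1 := hhalf u (by linarith)
    calc u ^ p * (r - u) ^ p * Real.exp (-(l * u))
        ≤ (2 * r ^ p) * (r - u) ^ p * Real.exp (-(l * (r - u))) := by gcongr
      _ = 2 * r ^ p * (0 + (r - u) ^ p * Real.exp (-(l * (r - u)))) := by ring
      _ ≤ _ := by gcongr; positivity

theorem integrableOn_rpow_mul_exp_neg {p l : ℝ} (hp : -1 < p) (hl : 0 < l) :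
    IntegrableOn (fun v : ℝ => v ^ p * Real.exp (-(l * v))) (Ioi 0) := by
  simpa using integrableOn_rpow_mul_exp_neg_mul_rpow hp one_pos hl

/-- There are weights for which the smoothing constant `θ` is arbitrarily small. -/
theorem exists_isSingularWeight {T p θ : ℝ} (hT : 0 < T) (hp : -1 < p) (hp0 : p < 0)
    (hθ : 0 < θ) : ∃ ω L, 0 < L ∧ IsSingularWeight T p θ ω L := by
  have hp1 : 0 < p + 1 := by linarith
  have hΓ : 0 < Real.Gamma (p + 1) := Real.Gamma_pos_of_pos hp1
  set κ : ℝ := (θ / (8 * Real.Gamma (p + 1))) ^ (1 / (p + 1)) with hκ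
  have hκ0 : 0 < κ := by positivity
  set l : ℝ := 1 / κ with hl
  have hl0 : 0 < l := by positivity
  set g : ℝ → ℝ := fun v => v ^ p * Real.exp (-(l * v)) with hg
  have hg_int : IntegrableOn g (Ioi 0) := integrableOn_rpow_mul_exp_neg hp hl0
  have hg_val : ∫ v in Ioi 0, g v = θ / 8 := by
    have := Real.integral_rpow_mul_exp_neg_mul_Ioi hp1 hl0
    rw [add_sub_cancel_right] at this
    rw [this, hl, one_div_one_div, hκ, ← Real.rpow_mul (by positivity), one_div_mul_cancel hp1.ne',
      Real.rpow_one]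
    field_simp
  have hg_nonneg : ∀ v, 0 ≤ v → 0 ≤ g v := fun v hv => by positivity
  set q : ℝ → ℝ := fun s => (T - s) ^ p * Real.exp (l * (T - s)) with hq
  set ω : ℝ → ℝ := (Ico 0 T).indicator q with hω
  have hωq : ∀ s ∈ Ico 0 T, ω s = q s := fun s hs => indicator_of_mem hs q
  have hω0 : ∀ s, 0 ≤ ω s := fun s => indicator_nonneg (fun s hs => by
    have : 0 ≤ T - s := sub_nonneg.2 hs.2.le
    positivity) s
  have hω_int : Integrable ω := by
    rw [hω, integrable_indicator_iff measurableSet_Ico, integrableOn_Ico_iff_integrableOn_Ioo,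
      ← integrableOn_Ioc_iff_integrableOn_Ioo, ← intervalIntegrable_iff_integrableOn_Ioc_of_le hT.le]
    refine IntervalIntegrable.mul_continuousOn ?_ (by fun_prop)
    have := (intervalIntegral.intervalIntegrable_rpow' (a := T) (b := 0) hp).comp_sub_left T
    simpa using this
  have hcomp : ∀ s ∈ Ico 0 T, (T - s) ^ p ≤ ω s ∧ ω s ≤ Real.exp (l * T) * (T - s) ^ p := by
    intro s hs
    have hs' : 0 < T - s := sub_pos.2 hs.2
    rw [hωq s hs]
    constructor
    · exact le_mul_of_one_le_right (by positivity) (Real.one_le_exp (by positivity))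
    · change (T - s) ^ p * Real.exp (l * (T - s)) ≤ Real.exp (l * T) * (T - s) ^ p
      rw [mul_comm]
      gcongr
      linarith [hs.1]
  have hconv : ∀ t ∈ Ico 0 T,
      IntervalIntegrable (fun s => ((s - t) ^ p + (T - t) ^ p) * ω s) volume t T ∧
      ∫ s in t..T, ((s - t) ^ p + (T - t) ^ p) * ω s ≤ θ * ω t := by
    intro t ht
    have hr : 0 < T - t := sub_pos.2 ht.2
    set E : ℝ → ℝ := fun s => 4 * ω t * (g (s - t) + g (T - s)) with hE
    have hg_int' : IntervalIntegrable g volume 0 (T - t) := by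
      rw [intervalIntegrable_iff_integrableOn_Ioc_of_le hr.le]
      exact hg_int.mono_set Ioc_subset_Ioi_self
    have hgl : IntervalIntegrable (fun s => g (s - t)) volume t T := by
      simpa using hg_int'.comp_sub_right t
    have hgr : IntervalIntegrable (fun s => g (T - s)) volume t T := by
      simpa using (hg_int'.comp_sub_left T).symm
    have hE_int : IntervalIntegrable E volume t T := (hgl.add hgr).const_mul _
    have hbound : ∀ s ∈ Ioc t T, ‖((s - t) ^ p + (T - t) ^ p) * ω s‖ ≤ E s := by
      intro s hs
      have hst : 0 < s - t := sub_pos.2 hs.1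
      rw [Real.norm_of_nonneg (mul_nonneg (by positivity) (hω0 s))]
      rcases eq_or_lt_of_le hs.2 with h | h
      · have : ω s = 0 := indicator_of_notMem (fun h' => h'.2.ne h) q
        rw [this, mul_zero]
        exact mul_nonneg (mul_nonneg zero_le_four (hω0 t))
          (add_nonneg (hg_nonneg _ hst.le) (hg_nonneg _ (sub_nonneg.2 hs.2)))
      · have hTs : 0 < T - s := sub_pos.2 h
        have h1 := rpow_mul_rpow_mul_exp_le hp hp0 hl0 hst (by linarith : s - t < T - t)
        rw [sub_sub_sub_cancel_right] at h1
        have h2 : (T - t) ^ p ≤ (s - t) ^ p :=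
          Real.rpow_le_rpow_of_nonpos hst (by linarith) hp0.le
        rw [hE, hωq s ⟨ht.1.trans hs.1.le, h⟩, hωq t ht]
        simp only [hq, hg]
        have he : Real.exp (l * (T - s)) = Real.exp (l * (T - t)) * Real.exp (-(l * (s - t))) := by
          rw [← Real.exp_add]; ring_nf
        calc ((s - t) ^ p + (T - t) ^ p) * ((T - s) ^ p * Real.exp (l * (T - s)))
            ≤ ((s - t) ^ p + (s - t) ^ p) * ((T - s) ^ p * Real.exp (l * (T - s))) := by gcongr
          _ = 2 * Real.exp (l * (T - t)) *
              ((s - t) ^ p * (T - s) ^ p * Real.exp (-(l * (s - t)))) := by rw [he]; ring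
          _ ≤ 2 * Real.exp (l * (T - t)) * (2 * (T - t) ^ p *
              ((s - t) ^ p * Real.exp (-(l * (s - t))) +
                (T - s) ^ p * Real.exp (-(l * (T - s))))) := by gcongr
          _ = _ := by ring
    have hG : ∫ v in 0..(T - t), g v ≤ θ / 8 := by
      rw [intervalIntegral.integral_of_le hr.le, ← hg_val]
      refine setIntegral_mono_set hg_int ?_ Ioc_subset_Ioi_self.eventuallyLE
      filter_upwards [ae_restrict_mem measurableSet_Ioi] with v hv using hg_nonneg v (le_of_lt hv)
    constructor
    · refine hE_int.mono_fun' ?_ ?_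
      · refine AEStronglyMeasurable.mul ?_ hω_int.aestronglyMeasurable.restrict
        exact Measurable.aestronglyMeasurable (by fun_prop)
      · rw [uIoc_of_le ht.2.le]
        filter_upwards [ae_restrict_mem measurableSet_Ioc] with s hs using hbound s hs
    · refine (le_abs_self _).trans ((intervalIntegral.norm_integral_le_of_norm_le ht.2.le
        (.of_forall hbound) hE_int).trans ?_)
      rw [hE, intervalIntegral.integral_const_mul, intervalIntegral.integral_add hgl hgr,
        intervalIntegral.integral_comp_sub_right g t, intervalIntegral.integral_comp_sub_left g T,
        sub_self, sub_self]
      have := hω0 t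
      nlinarith
  exact ⟨ω, Real.exp (l * T), Real.exp_pos _, hω_int, hω0, fun s hs => (hcomp s hs).1,
    fun s hs => (hcomp s hs).2, fun t ht => (hconv t ht).1, fun t ht => (hconv t ht).2⟩

end Weight

section Propagation

open ContinuousLinearMap (adjoint)

variable {H : Type*} [NormedAddCommGroup H] [InnerProductSpace ℝ H]

theorem abs_inner_apply_le (B : H →L[ℝ] H) (x y : H) : |⟪B x, y⟫| ≤ ‖B‖ * ‖x‖ * ‖y‖ :=
  (abs_real_inner_le_norm _ _).trans (by gcongr; exact B.le_opNorm x)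

variable [CompleteSpace H]

/-- Weakly measurable families of self-adjoint operators supported in `[0, T)` and bounded by
`D * ω`. -/
structure IsLyapunovSource (T : ℝ) (ω : ℝ → ℝ) (D : ℝ) (K : ℝ → H →L[ℝ] H) : Prop where
  isSelfAdjoint : ∀ s, IsSelfAdjoint (K s)
  measurable : ∀ x y : H, Measurable fun s => ⟪K s x, y⟫
  norm_le : ∀ s, ‖K s‖ ≤ D * ω s
  eq_zero : ∀ s ∉ Ico 0 T, K s = 0

/-- `P` solves the backward equation `P' + A*P + PA + K = 0`, `P_T = G` in the mild sense. -/
def IsPropagated (T : ℝ) (S : ℝ → H →L[ℝ] H) (G : H →L[ℝ] H) (K P : ℝ → H →L[ℝ] H) : Prop :=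
  ∀ t ∈ Icc 0 T, ∀ x y : H, ⟪P t x, y⟫ =
    ⟪G (S (T - t) x), S (T - t) y⟫ + ∫ s in t..T, ⟪K s (S (s - t) x), S (s - t) y⟫

theorem IsSelfAdjoint.inner_apply_comm {B : H →L[ℝ] H} (hB : IsSelfAdjoint B) (x y : H) :
    ⟪B x, y⟫ = ⟪B y, x⟫ := by
  rw [real_inner_comm]
  exact ((ContinuousLinearMap.isSelfAdjoint_iff_isSymmetric.1 hB) y x).symm

variable {T D M : ℝ} {ω : ℝ → ℝ} {S K : ℝ → H →L[ℝ] H}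

namespace IsLyapunovSource

theorem abs_inner_le (hK : IsLyapunovSource T ω D K) (hM0 : 0 < M)
    (hM : ∀ t ∈ Icc 0 T, ‖S t‖ ≤ M) {t s : ℝ} (ht : t ∈ Icc 0 T) (hs : s ∈ Ioc t T) (x y : H) :
    |⟪K s (S (s - t) x), S (s - t) y⟫| ≤ M ^ 2 * D * ‖x‖ * ‖y‖ * ω s := by
  have hst : ‖S (s - t)‖ ≤ M := hM _ ⟨by linarith [hs.1], by linarith [hs.2, ht.1]⟩
  have hnn : 0 ≤ D * ω s := (norm_nonneg _).trans (hK.norm_le s)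
  calc _ ≤ ‖K s‖ * ‖S (s - t) x‖ * ‖S (s - t) y‖ := abs_inner_apply_le _ _ _
    _ ≤ (D * ω s) * (M * ‖x‖) * (M * ‖y‖) := by
      gcongr
      · exact hK.norm_le s
      · exact (S _).le_of_opNorm_le hst x
      · exact (S _).le_of_opNorm_le hst y
    _ = _ := by ring

theorem intervalIntegrable_inner (hK : IsLyapunovSource T ω D K)
    (hS : IsStronglyContinuousSemigroup S) (hω : Integrable ω) {t : ℝ} (ht : t ∈ Icc 0 T)
    (x y : H) : IntervalIntegrable (fun s => ⟪K s (S (s - t) x), S (s - t) y⟫) volume t T := by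
  obtain ⟨M, hM0, hM⟩ := hS.exists_norm_le T
  have hmeas : Measurable fun s => ⟪K s (S (max (s - t) 0) x), S (max (s - t) 0) y⟫ :=
    measurable_inner_apply hK.measurable
      ((hS.continuous_max x).comp (continuous_sub_right t)).stronglyMeasurable
      ((hS.continuous_max y).comp (continuous_sub_right t)).stronglyMeasurable
  refine (hω.const_mul (M ^ 2 * D * ‖x‖ * ‖y‖)).intervalIntegrable.mono_fun' ?_ ?_
  · refine hmeas.aestronglyMeasurable.congr ?_
    rw [uIoc_of_le ht.2]
    filter_upwards [ae_restrict_mem measurableSet_Ioc] with s hs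
    rw [max_eq_left (sub_nonneg.2 hs.1.le)]
  · rw [uIoc_of_le ht.2]
    filter_upwards [ae_restrict_mem measurableSet_Ioc] with s hs
    exact hK.abs_inner_le hM0 hM ht hs x y

theorem exists_isPropagated (hK : IsLyapunovSource T ω D K)
    (hS : IsStronglyContinuousSemigroup S) (hω : Integrable ω) {G : H →L[ℝ] H}
    (hG : IsSelfAdjoint G) :
    ∃ P, (∀ t ∈ Icc 0 T, IsSelfAdjoint (P t)) ∧ IsPropagated T S G K P := by
  obtain ⟨M, hM0, hM⟩ := hS.exists_norm_le T
  have hex : ∀ t, ∃ B : H →L[ℝ] H, t ∈ Icc 0 T → IsSelfAdjoint B ∧ ∀ x y, ⟪B x, y⟫ =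
      ⟪G (S (T - t) x), S (T - t) y⟫ + ∫ s in t..T, ⟪K s (S (s - t) x), S (s - t) y⟫ := by
    intro t
    by_cases ht : t ∈ Icc 0 T
    swap
    · exact ⟨0, fun h => absurd h ht⟩
    have hintg := hK.intervalIntegrable_inner hS hω ht
    obtain ⟨B, hB, hB', -⟩ := exists_eq_inner_of_symmetric_form
      (fun x y => ⟪G (S (T - t) x), S (T - t) y⟫ + ∫ s in t..T, ⟪K s (S (s - t) x), S (s - t) y⟫)
      (‖G‖ * M ^ 2 + |∫ s in t..T, M ^ 2 * D * ω s|) (by positivity)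
      (fun x y => by
        rw [hG.inner_apply_comm]
        simp only [fun s => (hK.isSelfAdjoint s).inner_apply_comm (S (s - t) x)])
      (fun x x' y => by
        simp only [map_add, inner_add_left]
        rw [intervalIntegral.integral_add (hintg x y) (hintg x' y)]
        ring)
      (fun a x y => by
        simp only [map_smul, real_inner_smul_left]
        rw [intervalIntegral.integral_const_mul]
        ring)
      (fun x => by
        refine (abs_add_le _ _).trans ?_
        rw [add_mul]
        refine add_le_add ?_ ?_
        · have hx : ‖S (T - t) x‖ ≤ M * ‖x‖ :=
            (S _).le_of_opNorm_le (hM _ ⟨by linarith [ht.2], by linarith [ht.1]⟩) x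
          calc _ ≤ ‖G‖ * ‖S (T - t) x‖ * ‖S (T - t) x‖ := abs_inner_apply_le _ _ _
            _ ≤ ‖G‖ * (M * ‖x‖) * (M * ‖x‖) := by gcongr
            _ = _ := by ring
        · have h := intervalIntegral.norm_integral_le_of_norm_le
            (f := fun s => ⟪K s (S (s - t) x), S (s - t) x⟫) ht.2
            (.of_forall fun s hs => hK.abs_inner_le hM0 hM ht hs x x)
            (hω.const_mul (M ^ 2 * D * ‖x‖ * ‖x‖)).intervalIntegrable
          refine h.trans ((le_abs_self _).trans (le_of_eq ?_))
          rw [intervalIntegral.integral_const_mul, intervalIntegral.integral_const_mul]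
          simp only [abs_mul, abs_norm]
          ring)
    exact ⟨B, fun _ => ⟨hB, hB'⟩⟩
  choose P hP using hex
  exact ⟨P, fun t ht => (hP t ht).1, fun t ht => (hP t ht).2⟩

end IsLyapunovSource

namespace IsPropagated

variable {G : H →L[ℝ] H} {P : ℝ → H →L[ℝ] H}

theorem norm_le (hP : IsPropagated T S G K P) (hK : IsLyapunovSource T ω D K) (hD : 0 ≤ D)
    (hω : Integrable ω) (hω0 : ∀ s, 0 ≤ ω s) (hM0 : 0 < M) (hM : ∀ t ∈ Icc 0 T, ‖S t‖ ≤ M)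
    {t : ℝ} (ht : t ∈ Icc 0 T) : ‖P t‖ ≤ M ^ 2 * (‖G‖ + D * ∫ s in t..T, ω s) := by
  have hI : 0 ≤ ∫ s in t..T, ω s := intervalIntegral.integral_nonneg ht.2 fun s _ => hω0 s
  refine norm_le_of_abs_inner_le _ (by positivity) fun x y => ?_
  rw [hP t ht x y]
  have hS : ‖S (T - t)‖ ≤ M := hM _ ⟨by linarith [ht.2], by linarith [ht.1]⟩
  have h1 : |⟪G (S (T - t) x), S (T - t) y⟫| ≤ ‖G‖ * (M * ‖x‖) * (M * ‖y‖) :=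
    (abs_inner_apply_le _ _ _).trans (by
      gcongr
      · exact (S _).le_of_opNorm_le hS x
      · exact (S _).le_of_opNorm_le hS y)
  have h2 := intervalIntegral.norm_integral_le_of_norm_le
    (f := fun s => ⟪K s (S (s - t) x), S (s - t) y⟫) ht.2
    (.of_forall fun s hs => hK.abs_inner_le hM0 hM ht hs x y)
    (hω.const_mul (M ^ 2 * D * ‖x‖ * ‖y‖)).intervalIntegrable
  rw [intervalIntegral.integral_const_mul, Real.norm_eq_abs] at h2
  refine (abs_add_le _ _).trans ((add_le_add h1 h2).trans (le_of_eq ?_))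
  ring

theorem sum_abs_inner_le (hP : IsPropagated T S G K P) (hK : IsLyapunovSource T ω D K)
    (hD : 0 ≤ D) (hS : IsStronglyContinuousSemigroup S) {p θ L c : ℝ}
    (hω : IsSingularWeight T p θ ω L) (hc : 0 < c) {t : ℝ} (ht : t ∈ Ico 0 T) {ι : Type*}
    (v : ι → H) {r : ℝ} (hr : 0 ≤ r) (F : Finset ι)
    (hv : ∀ u > 0, ∑ j ∈ F, ‖S u (v j)‖ ^ 2 ≤ c * (u ^ p + (T - t) ^ p) * r) :
    ∑ j ∈ F, |⟪P t (v j), v j⟫| ≤ (2 * c * ‖G‖ + c * D * θ) * ω t * r := by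
  have htI : t ∈ Icc 0 T := Ico_subset_Icc_self ht
  have hintg : ∀ j, IntervalIntegrable (fun s => |⟪K s (S (s - t) (v j)), S (s - t) (v j)⟫|)
      volume t T := fun j => (hK.intervalIntegrable_inner hS hω.integrable htI (v j) (v j)).abs
  have hone : ∀ j, |⟪P t (v j), v j⟫| ≤ ‖G‖ * ‖S (T - t) (v j)‖ ^ 2 +
      ∫ s in t..T, |⟪K s (S (s - t) (v j)), S (s - t) (v j)⟫| := by
    intro j
    rw [hP t htI]
    refine (abs_add_le _ _).trans (add_le_add ?_ ?_)
    · exact (abs_inner_apply_le _ _ _).trans (le_of_eq (by ring))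
    · exact intervalIntegral.abs_integral_le_integral_abs ht.2.le
  have hGterm : ‖G‖ * ∑ j ∈ F, ‖S (T - t) (v j)‖ ^ 2 ≤ 2 * c * ‖G‖ * ω t * r := by
    calc _ ≤ ‖G‖ * (c * ((T - t) ^ p + (T - t) ^ p) * r) := by
          gcongr; exact hv _ (sub_pos.2 ht.2)
      _ ≤ ‖G‖ * (c * (ω t + ω t) * r) := by
          have := hω.le_weight t ht
          gcongr
      _ = _ := by ring
  have hKterm : ∫ s in t..T, ∑ j ∈ F, |⟪K s (S (s - t) (v j)), S (s - t) (v j)⟫| ≤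
      c * D * θ * ω t * r := by
    calc _ ≤ ∫ s in t..T, c * D * r * (((s - t) ^ p + (T - t) ^ p) * ω s) := by
          refine intervalIntegral.integral_mono_on_of_le_Ioo ht.2.le ?_
            ((hω.intervalIntegrable t ht).const_mul _) fun s hs => ?_
          · simpa only [Finset.sum_fn] using IntervalIntegrable.sum F fun j _ => hintg j
          · have hnn : 0 ≤ D * ω s := mul_nonneg hD (hω.nonneg s)
            calc _ ≤ ∑ j ∈ F, D * ω s * ‖S (s - t) (v j)‖ ^ 2 := by
                  refine Finset.sum_le_sum fun j _ => (abs_inner_apply_le _ _ _).trans ?_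
                  rw [mul_assoc, ← sq]
                  gcongr
                  exact hK.norm_le s
              _ ≤ D * ω s * (c * ((s - t) ^ p + (T - t) ^ p) * r) := by
                  rw [← Finset.mul_sum]
                  gcongr
                  exact hv _ (sub_pos.2 hs.1)
              _ = _ := by ring
      _ = c * D * r * ∫ s in t..T, ((s - t) ^ p + (T - t) ^ p) * ω s :=
          intervalIntegral.integral_const_mul _ _
      _ ≤ c * D * r * (θ * ω t) := by gcongr; exact hω.integral_le t ht
      _ = _ := by ring
  calc _ ≤ ∑ j ∈ F, (‖G‖ * ‖S (T - t) (v j)‖ ^ 2 +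
      ∫ s in t..T, |⟪K s (S (s - t) (v j)), S (s - t) (v j)⟫|) :=
        Finset.sum_le_sum fun j _ => hone j
    _ = ‖G‖ * ∑ j ∈ F, ‖S (T - t) (v j)‖ ^ 2 +
        ∫ s in t..T, ∑ j ∈ F, |⟪K s (S (s - t) (v j)), S (s - t) (v j)⟫| := by
        rw [Finset.sum_add_distrib, Finset.mul_sum,
          intervalIntegral.integral_finsetSum fun j _ => hintg j]
    _ ≤ 2 * c * ‖G‖ * ω t * r + c * D * θ * ω t * r := add_le_add hGterm hKterm
    _ = _ := by ring

theorem sub {K' P' : ℝ → H →L[ℝ] H} {D' : ℝ} (hP : IsPropagated T S G K P)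
    (hP' : IsPropagated T S G K' P') (hK : IsLyapunovSource T ω D K)
    (hK' : IsLyapunovSource T ω D' K') (hS : IsStronglyContinuousSemigroup S)
    (hω : Integrable ω) :
    IsPropagated T S 0 (fun s => K s - K' s) (fun s => P s - P' s) := by
  intro t ht x y
  simp only [sub_apply, inner_sub_left, hP t ht, hP' t ht,
    zero_apply, inner_zero_left]
  rw [intervalIntegral.integral_sub (hK.intervalIntegrable_inner hS hω ht x y)
    (hK'.intervalIntegrable_inner hS hω ht x y)]
  ring

end IsPropagated

end Propagation

section StrongContinuity

open ContinuousLinearMap (adjoint)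

variable {H : Type*} [NormedAddCommGroup H] [InnerProductSpace ℝ H] [CompleteSpace H]
  {T D : ℝ} {ω : ℝ → ℝ} {S K P : ℝ → H →L[ℝ] H} {G : H →L[ℝ] H}

/-- The strong continuity in `t` of `∫ s in t..T, S(s - t)* w(s)` for weakly measurable `w`. -/
theorem IsStronglyContinuousSemigroup.exists_continuousWithinAt_weak_integral
    (hS : IsStronglyContinuousSemigroup S) {w : ℝ → H} {φ : ℝ → ℝ}
    (hw : ∀ y : H, Measurable fun s => ⟪w s, y⟫) (hφ : Integrable φ) (hwφ : ∀ s, ‖w s‖ ≤ φ s)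
    {t : ℝ} :
    ∃ Φ : ℝ → H, ContinuousWithinAt Φ (Icc 0 T) t ∧
      ∀ r ∈ Icc 0 T, ∀ y, ⟪Φ r, y⟫ = ∫ s in r..T, ⟪w s, S (s - r) y⟫ := by
  obtain ⟨M, hM0, hM⟩ := hS.exists_norm_le T
  obtain ⟨w', hw'meas, hw'le, hw'⟩ := exists_stronglyMeasurable_weakly_ae_eq hw hφ hwφ
  have hw'S : ∀ y, ∀ᵐ s, ∀ u, ⟪w s, S (max u 0) y⟫ = ⟪w' s, S (max u 0) y⟫ := by
    intro y
    have hrat : ∀ᵐ s, ∀ q : ℚ, ⟪w s, S (max (q : ℝ) 0) y⟫ = ⟪w' s, S (max (q : ℝ) 0) y⟫ :=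
      ae_all_iff.2 fun q => hw' _
    filter_upwards [hrat] with s hs u
    have h1 : Continuous fun u => ⟪w s, S (max u 0) y⟫ :=
      continuous_const.inner (hS.continuous_max y)
    have h2 : Continuous fun u => ⟪w' s, S (max u 0) y⟫ :=
      continuous_const.inner (hS.continuous_max y)
    exact congrFun (Rat.isDenseEmbedding_coe_real.dense.equalizer h1 h2 (funext hs)) u
  let F : ℝ → ℝ → H := fun r => (Ioi r).indicator fun s => adjoint (S (max (s - r) 0)) (w' s)
  have hFmeas : ∀ r, StronglyMeasurable (F r) := by
    intro r
    refine StronglyMeasurable.indicator ?_ measurableSet_Ioi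
    have h1 : StronglyMeasurable fun s : ℝ => (s - r, w' s) :=
      (continuous_sub_right r).stronglyMeasurable.prodMk hw'meas
    have h2 := hS.continuous_adjoint_max.comp_stronglyMeasurable h1
    exact h2
  have hFbd : ∀ r ∈ Icc 0 T, ∀ s ∈ Ioc 0 T, ‖F r s‖ ≤ M * φ s := by
    intro r hr s hs
    refine (norm_indicator_le_norm_self _ _).trans ?_
    refine (ContinuousLinearMap.le_of_opNorm_le _ (?_ : _ ≤ M) _).trans ?_
    · rw [LinearIsometryEquiv.norm_map]
      exact hM _ ⟨le_max_right _ _, max_le (by linarith [hs.2, hr.1]) (hs.1.le.trans hs.2)⟩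
    · gcongr
      exact (hw'le s).trans (hwφ s)
  refine ⟨fun r => ∫ s in 0..T, F r s, ?_, fun r hr y => ?_⟩
  · by_cases hT : 0 ≤ T
    swap
    · rw [Icc_eq_empty hT]
      simp [ContinuousWithinAt]
    refine intervalIntegral.continuousWithinAt_of_dominated_interval (bound := fun s => M * φ s)
      (.of_forall fun r => (hFmeas r).aestronglyMeasurable) ?_ (hφ.const_mul M).intervalIntegrable ?_
    · filter_upwards [self_mem_nhdsWithin] with r hr
      refine .of_forall fun s hs => hFbd r hr s ?_
      rwa [uIoc_of_le hT] at hs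
    · have hne : ∀ᵐ s : ℝ, s ≠ t := by simp [ae_iff]
      filter_upwards [hne] with s hs _
      refine ContinuousAt.continuousWithinAt ?_
      rcases lt_or_gt_of_ne hs with h | h
      · refine (continuousAt_const (y := (0 : H))).congr ?_
        filter_upwards [lt_mem_nhds h] with r hr
        exact (indicator_of_notMem (by simpa using hr.le) _).symm
      · have hpair : Continuous fun r : ℝ => (s - r, w' s) :=
          (continuous_const.sub continuous_id).prodMk continuous_const
        have hc := hS.continuous_adjoint_max.comp hpair
        refine hc.continuousAt.congr ?_
        filter_upwards [gt_mem_nhds h] with r hr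
        have hF : F r s = adjoint (S (max (s - r) 0)) (w' s) := indicator_of_mem (mem_Ioi.2 hr) _
        exact hF.symm
  · have hT : 0 ≤ T := hr.1.trans hr.2
    have hFint : ∀ a b, a ∈ Icc 0 T → b ∈ Icc 0 T → IntervalIntegrable (F r) volume a b := by
      have : IntervalIntegrable (F r) volume 0 T := by
        refine (hφ.const_mul M).intervalIntegrable.mono_fun' (hFmeas r).aestronglyMeasurable ?_
        rw [uIoc_of_le hT]
        filter_upwards [ae_restrict_mem measurableSet_Ioc] with s hs using hFbd r hr s hs
      intro a b ha hb
      refine this.mono_set ?_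
      rw [uIcc_of_le hT]
      exact uIcc_subset_Icc ha hb
    have h0T : (0 : ℝ) ∈ Icc 0 T := ⟨le_rfl, hT⟩
    have hTT : T ∈ Icc 0 T := ⟨hT, le_rfl⟩
    beta_reduce
    rw [← intervalIntegral.integral_add_adjacent_intervals (hFint 0 r h0T hr) (hFint r T hr hTT)]
    have hzero : ∫ s in 0..r, F r s = 0 := by
      refine intervalIntegral.integral_zero_ae (.of_forall fun s hs => ?_)
      rw [uIoc_of_le hr.1] at hs
      exact indicator_of_notMem (by simpa using hs.2) _
    rw [hzero, zero_add, real_inner_comm, intervalIntegral.integral_of_le hr.2,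
      ← integral_inner ((intervalIntegrable_iff_integrableOn_Ioc_of_le hr.2).1 (hFint r T hr hTT)),
      intervalIntegral.integral_of_le hr.2]
    refine setIntegral_congr_ae measurableSet_Ioc ?_
    filter_upwards [hw'S y] with s hs hsr
    have hFs : F r s = adjoint (S (max (s - r) 0)) (w' s) := indicator_of_mem (mem_Ioi.2 hsr.1) _
    rw [hFs, real_inner_comm, ContinuousLinearMap.adjoint_inner_left, ← hs,
      max_eq_left (sub_nonneg.2 hsr.1.le)]

theorem IsPropagated.continuousOn (hP : IsPropagated T S G K P) (hK : IsLyapunovSource T ω D K)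
    (hS : IsStronglyContinuousSemigroup S) (hω : Integrable ω) (hω0 : ∀ s, 0 ≤ ω s) (hD : 0 ≤ D)
    (x : H) : ContinuousOn (fun t => P t x) (Icc 0 T) := by
  intro t ht
  obtain ⟨M, hM0, hM⟩ := hS.exists_norm_le T
  have hZ : ∀ s ∈ Icc 0 T, ∀ r ∈ Icc 0 T, ∀ y, ‖S (max (s - r) 0) y‖ ≤ M * ‖y‖ :=
    fun s hs r hr y => (S _).le_of_opNorm_le
      (hM _ ⟨le_max_right _ _, max_le (by linarith [hs.2, hr.1]) (hs.1.trans hs.2)⟩) y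
  have hZcont : ∀ r, Continuous fun s => S (max (s - r) 0) x := fun r =>
    (hS.continuous_max x).comp (continuous_sub_right r)
  obtain ⟨Φ, hΦcont, hΦ⟩ := hS.exists_continuousWithinAt_weak_integral (T := T) (t := t)
    (w := fun s => K s (S (max (s - t) 0) x)) (φ := fun s => D * M * ‖x‖ * ω s)
    (fun y => measurable_inner_apply hK.measurable (hZcont t).stronglyMeasurable
      stronglyMeasurable_const) (hω.const_mul _) (fun s => by
      by_cases hs : s ∈ Ico 0 T
      · refine ((K s).le_of_opNorm_le (hK.norm_le s) _).trans ?_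
        have h1 := hZ s (Ico_subset_Icc_self hs) t ht x
        have h2 : 0 ≤ D * ω s := mul_nonneg hD (hω0 s)
        calc _ ≤ D * ω s * (M * ‖x‖) := by gcongr
          _ = _ := by ring
      · rw [hK.eq_zero s hs]
        simpa using mul_nonneg (by positivity : 0 ≤ D * M * ‖x‖) (hω0 s))
  let E : ℝ → ℝ := fun r => ∫ s in 0..T, ω s * ‖S (max (s - r) 0) x - S (max (s - t) 0) x‖
  have hEmeas : ∀ r, AEStronglyMeasurable
      (fun s => ω s * ‖S (max (s - r) 0) x - S (max (s - t) 0) x‖) volume := fun r =>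
    hω.aestronglyMeasurable.mul ((hZcont r).sub (hZcont t)).norm.aestronglyMeasurable
  have hEbd : ∀ r ∈ Icc 0 T, ∀ s ∈ Icc 0 T,
      ‖ω s * ‖S (max (s - r) 0) x - S (max (s - t) 0) x‖‖ ≤ 2 * M * ‖x‖ * ω s := by
    intro r hr s hs
    rw [Real.norm_of_nonneg (mul_nonneg (hω0 s) (norm_nonneg _)), mul_comm]
    refine mul_le_mul_of_nonneg_right ?_ (hω0 s)
    refine (norm_sub_le _ _).trans ?_
    linarith [hZ s hs r hr x, hZ s hs t ht x]
  have hT : 0 ≤ T := ht.1.trans ht.2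
  have hEcont : ContinuousWithinAt E (Icc 0 T) t := by
    refine intervalIntegral.continuousWithinAt_of_dominated_interval
      (bound := fun s => 2 * M * ‖x‖ * ω s) (.of_forall fun r => (hEmeas r).restrict) ?_
      (hω.const_mul _).intervalIntegrable (.of_forall fun s _ => ?_)
    · filter_upwards [self_mem_nhdsWithin] with r hr
      refine .of_forall fun s hs => hEbd r hr s (Ioc_subset_Icc_self ?_)
      rwa [uIoc_of_le hT] at hs
    · have : Continuous fun r => S (max (s - r) 0) x :=
        (hS.continuous_max x).comp (continuous_const.sub continuous_id)
      exact (continuous_const.mul (this.sub continuous_const).norm).continuousWithinAt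
  have hE0 : E t = 0 := by simp [E]
  have hEint : ∀ r ∈ Icc 0 T, IntervalIntegrable
      (fun s => ω s * ‖S (max (s - r) 0) x - S (max (s - t) 0) x‖) volume 0 T := by
    intro r hr
    refine (hω.const_mul (2 * M * ‖x‖)).intervalIntegrable.mono_fun' (hEmeas r).restrict ?_
    rw [uIoc_of_le hT]
    filter_upwards [ae_restrict_mem measurableSet_Ioc] with s hs
      using hEbd r hr s (Ioc_subset_Icc_self hs)
  let Γ : ℝ → H := fun r => adjoint (S (max (T - r) 0)) (G (S (max (T - r) 0) x))
  have hΓ : Continuous Γ := by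
    have h1 : Continuous fun r => G (S (max (T - r) 0) x) :=
      G.continuous.comp ((hS.continuous_max x).comp (continuous_const.sub continuous_id))
    have h2 : Continuous fun r : ℝ => (T - r, G (S (max (T - r) 0) x)) :=
      (continuous_const.sub continuous_id).prodMk h1
    have h3 := hS.continuous_adjoint_max.comp h2
    exact h3
  have hclose : ∀ r ∈ Icc 0 T, ‖P r x - (Γ r + Φ r)‖ ≤ M * D * E r := by
    intro r hr
    have hsub : IntervalIntegrable
        (fun s => ω s * ‖S (max (s - r) 0) x - S (max (s - t) 0) x‖) volume r T := by
      refine (hEint r hr).mono_set ?_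
      rw [uIcc_of_le hT, uIcc_of_le hr.2]
      exact Icc_subset_Icc_left hr.1
    have hE_le : ∫ s in r..T, ω s * ‖S (max (s - r) 0) x - S (max (s - t) 0) x‖ ≤ E r :=
      intervalIntegral.integral_mono_interval hr.1 hr.2 le_rfl
        (.of_forall fun s => mul_nonneg (hω0 s) (norm_nonneg _)) (hEint r hr)
    have hweak : ∀ y, |⟪P r x - (Γ r + Φ r), y⟫| ≤ M * D * E r * ‖y‖ := by
      intro y
      have hwint : IntervalIntegrable (fun s => ⟪K s (S (max (s - t) 0) x), S (s - r) y⟫)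
          volume r T := by
        have hmeas := measurable_inner_apply hK.measurable (hZcont t).stronglyMeasurable
          ((hS.continuous_max y).comp (continuous_sub_right r)).stronglyMeasurable
        refine (hω.const_mul (M ^ 2 * D * ‖x‖ * ‖y‖)).intervalIntegrable.mono_fun'
          (hmeas.aestronglyMeasurable.congr ?_) ?_ <;> rw [uIoc_of_le hr.2] <;>
          filter_upwards [ae_restrict_mem measurableSet_Ioc] with s hs
        · simp only [Function.comp_apply, max_eq_left (sub_nonneg.2 hs.1.le)]
        · have hs' : s ∈ Icc 0 T := ⟨hr.1.trans hs.1.le, hs.2⟩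
          have hy := hZ s hs' r hr y
          rw [max_eq_left (sub_nonneg.2 hs.1.le)] at hy
          have h2 : 0 ≤ D * ω s := mul_nonneg hD (hω0 s)
          calc _ ≤ ‖K s‖ * ‖S (max (s - t) 0) x‖ * ‖S (s - r) y‖ := abs_inner_apply_le _ _ _
            _ ≤ (D * ω s) * (M * ‖x‖) * (M * ‖y‖) := by
                gcongr
                · exact hK.norm_le s
                · exact hZ s hs' t ht x
            _ = _ := by ring
      have e : ⟪P r x - (Γ r + Φ r), y⟫ = ∫ s in r..T,
          (⟪K s (S (s - r) x), S (s - r) y⟫ - ⟪K s (S (max (s - t) 0) x), S (s - r) y⟫) := by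
        rw [intervalIntegral.integral_sub (hK.intervalIntegrable_inner hS hω hr x y) hwint,
          inner_sub_left, inner_add_left, hΦ r hr, hP r hr,
          ContinuousLinearMap.adjoint_inner_left, max_eq_left (sub_nonneg.2 hr.2)]
        ring
      rw [e]
      refine (intervalIntegral.norm_integral_le_of_norm_le
        (f := fun s => ⟪K s (S (s - r) x), S (s - r) y⟫ -
          ⟪K s (S (max (s - t) 0) x), S (s - r) y⟫) hr.2 (.of_forall fun s hs => ?_)
        (hsub.const_mul (M * D * ‖y‖))).trans ?_
      · have hs' : s ∈ Icc 0 T := ⟨hr.1.trans hs.1.le, hs.2⟩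
        rw [← inner_sub_left, ← map_sub, Real.norm_eq_abs]
        have hy := hZ s hs' r hr y
        rw [max_eq_left (sub_nonneg.2 hs.1.le)] at hy ⊢
        have h2 : 0 ≤ D * ω s := mul_nonneg hD (hω0 s)
        calc _ ≤ ‖K s‖ * ‖S (s - r) x - S (max (s - t) 0) x‖ * ‖S (s - r) y‖ :=
              abs_inner_apply_le _ _ _
          _ ≤ (D * ω s) * ‖S (s - r) x - S (max (s - t) 0) x‖ * (M * ‖y‖) := by
              gcongr
              exact hK.norm_le s
          _ = _ := by ring
      · rw [intervalIntegral.integral_const_mul]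
        calc _ ≤ M * D * ‖y‖ * E r := by gcongr
          _ = _ := by ring
    have hEr : 0 ≤ E r := intervalIntegral.integral_nonneg hT fun s _ =>
      mul_nonneg (hω0 s) (norm_nonneg _)
    set v := P r x - (Γ r + Φ r)
    have h1 := hweak v
    rw [real_inner_self_eq_norm_sq, abs_of_nonneg (by positivity), sq] at h1
    by_cases h0 : ‖v‖ = 0
    · rw [h0]; positivity
    · exact le_of_mul_le_mul_right h1 (lt_of_le_of_ne (norm_nonneg _) (Ne.symm h0))
  have hmain : ContinuousWithinAt (fun r => Γ r + Φ r) (Icc 0 T) t :=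
    hΓ.continuousWithinAt.add hΦcont
  have hdiff : Tendsto (fun r => P r x - (Γ r + Φ r)) (𝓝[Icc 0 T] t) (𝓝 0) := by
    refine squeeze_zero_norm' (a := fun r => M * D * E r) ?_ ?_
    · filter_upwards [self_mem_nhdsWithin] with r hr using hclose r hr
    · have := hEcont.tendsto.const_mul (M * D)
      rwa [hE0, mul_zero] at this
  have hPt : P t x = Γ t + Φ t := by
    have := hclose t ht
    rw [hE0, mul_zero] at this
    exact sub_eq_zero.1 (norm_le_zero_iff.1 this)
  have := hdiff.add hmain.tendsto
  rw [ContinuousWithinAt, hPt]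
  simpa using this

end StrongContinuity

section LyapunovForm

variable {H : Type*} [NormedAddCommGroup H] [InnerProductSpace ℝ H]

/-- The bilinear form of the operator `f + A*P + PA + ∑ C_j* P C_j`. -/
noncomputable def lyapunovForm (A : H →L[ℝ] H) (C : ℕ → H →L[ℝ] H) (f P : H →L[ℝ] H) (x y : H) :
    ℝ :=
  ⟪f x, y⟫ + ⟪P x, A y⟫ + ⟪P (A x), y⟫ + ∑' j, ⟪P (C j x), C j y⟫

variable {A f f' P P' : H →L[ℝ] H} {C : ℕ → H →L[ℝ] H}

theorem abs_lyapunovForm_self_le (hC : ∀ x, Summable fun j => |⟪P (C j x), C j x⟫|) {R : ℝ}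
    (hR : ∀ x, ∑' j, |⟪P (C j x), C j x⟫| ≤ R * ‖x‖ ^ 2) (x : H) :
    |lyapunovForm A C f P x x| ≤ (‖f‖ + 2 * ‖P‖ * ‖A‖ + R) * ‖x‖ ^ 2 := by
  have h1 := abs_inner_apply_le f x x
  have h2 : |⟪P x, A x⟫| ≤ ‖P‖ * ‖x‖ * (‖A‖ * ‖x‖) :=
    (abs_inner_apply_le P x (A x)).trans (by gcongr; exact A.le_opNorm x)
  have h3 : |⟪P (A x), x⟫| ≤ ‖P‖ * (‖A‖ * ‖x‖) * ‖x‖ :=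
    (abs_inner_apply_le P (A x) x).trans (by gcongr; exact A.le_opNorm x)
  have h4 : |∑' j, ⟪P (C j x), C j x⟫| ≤ R * ‖x‖ ^ 2 := by
    have hn : Summable fun j => ‖⟪P (C j x), C j x⟫‖ := hC x
    have h := norm_tsum_le_tsum_norm hn
    simp only [Real.norm_eq_abs] at h
    exact h.trans (hR x)
  unfold lyapunovForm
  refine (abs_add_le _ _).trans ?_
  refine (add_le_add_left (abs_add_three _ _ _) _).trans ?_
  calc _ ≤ ‖f‖ * ‖x‖ * ‖x‖ + ‖P‖ * ‖x‖ * (‖A‖ * ‖x‖) + ‖P‖ * (‖A‖ * ‖x‖) * ‖x‖ +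
        R * ‖x‖ ^ 2 := by gcongr
    _ = _ := by ring

variable [CompleteSpace H]

theorem IsSelfAdjoint.summable_inner_apply (hP : IsSelfAdjoint P)
    (hC : ∀ x, Summable fun j => |⟪P (C j x), C j x⟫|) (x y : H) :
    Summable fun j => ⟪P (C j x), C j y⟫ := by
  have h := ((hC (x + y)).of_abs.sub (hC (x - y)).of_abs).mul_left (1 / 4)
  refine h.congr fun j => ?_
  simp only [map_add, map_sub, inner_add_left, inner_add_right, inner_sub_left, inner_sub_right]
  rw [hP.inner_apply_comm (C j y) (C j x)]
  ring

theorem lyapunovForm_sub (hP : IsSelfAdjoint P) (hP' : IsSelfAdjoint P')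
    (hC : ∀ x, Summable fun j => |⟪P (C j x), C j x⟫|)
    (hC' : ∀ x, Summable fun j => |⟪P' (C j x), C j x⟫|) (x y : H) :
    lyapunovForm A C f P x y - lyapunovForm A C f' P' x y =
      lyapunovForm A C (f - f') (P - P') x y := by
  have h := (hP.summable_inner_apply hC x y).tsum_sub (hP'.summable_inner_apply hC' x y)
  simp only [lyapunovForm, sub_apply, inner_sub_left, h]
  ring

theorem exists_eq_lyapunovForm (hf : IsSelfAdjoint f) (hP : IsSelfAdjoint P)
    (hC : ∀ x, Summable fun j => |⟪P (C j x), C j x⟫|) {R : ℝ} (hR0 : 0 ≤ R)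
    (hR : ∀ x, ∑' j, |⟪P (C j x), C j x⟫| ≤ R * ‖x‖ ^ 2) :
    ∃ N : H →L[ℝ] H, IsSelfAdjoint N ∧ (∀ x y, ⟪N x, y⟫ = lyapunovForm A C f P x y) ∧
      ‖N‖ ≤ ‖f‖ + 2 * ‖P‖ * ‖A‖ + R := by
  refine exists_eq_inner_of_symmetric_form _ _ (by positivity) (fun x y => ?_) (fun x x' y => ?_)
    (fun a x y => ?_) (abs_lyapunovForm_self_le hC hR)
  · have h : ∀ j, ⟪P (C j x), C j y⟫ = ⟪P (C j y), C j x⟫ := fun j => hP.inner_apply_comm _ _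
    simp only [lyapunovForm, h]
    rw [hf.inner_apply_comm x y, hP.inner_apply_comm x (A y), hP.inner_apply_comm (A x) y]
    ring
  · have h := (hP.summable_inner_apply hC x y).tsum_add (hP.summable_inner_apply hC x' y)
    simp only [lyapunovForm, map_add, inner_add_left, h]
    ring
  · simp only [lyapunovForm, map_smul, real_inner_smul_left, tsum_mul_left]
    ring

end LyapunovForm

section Lyapunov

variable {H : Type*} [NormedAddCommGroup H] [InnerProductSpace ℝ H] [CompleteSpace H]

/-- The standing assumptions on the coefficients of the Lyapunov equation. -/
structure IsLyapunovData (T α c : ℝ) (S A0 : ℝ → H →L[ℝ] H) (Chat : ℕ → ℝ → H →L[ℝ] H)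
    (f : ℝ → H →L[ℝ] H) (G : H →L[ℝ] H) : Prop where
  pos_time : 0 < T
  pos_exponent : 0 < α
  exponent_lt : α < 1 / 2
  pos_const : 0 < c
  semigroup : IsStronglyContinuousSemigroup S
  isSelfAdjoint_terminal : IsSelfAdjoint G
  isSelfAdjoint : ∀ s ∈ Ico 0 T, IsSelfAdjoint (f s)
  measurable_drift : ∀ x : H, StronglyMeasurable fun s => A0 s x
  measurable_noise : ∀ j (x : H), StronglyMeasurable fun s => Chat j s x
  measurable_source : ∀ x : H, StronglyMeasurable fun s => f s x
  drift_le : ∀ s ∈ Ico 0 T, ‖A0 s‖ ≤ c * (T - s) ^ (-α)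
  noise_le : ∀ s ∈ Ico 0 T, ∀ t : ℝ, 0 < t → ∀ x : H,
    (Summable fun j => ‖S t (Chat j s x)‖ ^ 2) ∧
      (∑' j, ‖S t (Chat j s x)‖ ^ 2) ≤ c * (t ^ (-2 * α) + (T - s) ^ (-2 * α)) * ‖x‖ ^ 2
  source_le : ∀ s ∈ Ico 0 T, ‖f s‖ ≤ c * (T - s) ^ (-2 * α)

/-- `N s` is the operator `f s + A₀(s)* P s + P s A₀(s) + ∑ Ĉ_j(s)* P s Ĉ_j(s)` on `[0, T)`. -/
def IsLyapunovFeedback (T : ℝ) (A0 : ℝ → H →L[ℝ] H) (Chat : ℕ → ℝ → H →L[ℝ] H)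
    (f P N : ℝ → H →L[ℝ] H) : Prop :=
  ∀ s ∈ Ico 0 T, ∀ x y : H,
    ⟪N s x, y⟫ = lyapunovForm (A0 s) (fun j => Chat j s) (f s) (P s) x y

/-- `P` is propagated from the source `K`, and `N` is the source generated by `P`. -/
structure IsLyapunovStep (T α : ℝ) (S A0 : ℝ → H →L[ℝ] H) (Chat : ℕ → ℝ → H →L[ℝ] H)
    (f : ℝ → H →L[ℝ] H) (G : H →L[ℝ] H) (K P N : ℝ → H →L[ℝ] H) : Prop where
  isSelfAdjoint : ∀ t ∈ Icc 0 T, IsSelfAdjoint (P t)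
  continuousOn : ∀ x : H, ContinuousOn (fun t => P t x) (Icc 0 T)
  bound : LyapunovSingularBound T α Chat P
  propagated : IsPropagated T S G K P
  feedback : IsLyapunovFeedback T A0 Chat f P N

variable {T α c θ L D D' ε M : ℝ} {ω : ℝ → ℝ} {S A0 f K K' P P' N N' : ℝ → H →L[ℝ] H}
  {Chat : ℕ → ℝ → H →L[ℝ] H} {G : H →L[ℝ] H}

theorem rpow_neg_le_mul_rpow_neg_two_mul (hα : 0 < α) {s : ℝ} (hs : s ∈ Ico 0 T) :
    (T - s) ^ (-α) ≤ T ^ α * (T - s) ^ (-2 * α) := by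
  have hpos : 0 < T - s := sub_pos.2 hs.2
  have : (T - s) ^ (-α) = (T - s) ^ α * (T - s) ^ (-2 * α) := by
    rw [← Real.rpow_add hpos]; congr 1; ring
  rw [this]
  have h : (T - s) ^ α ≤ T ^ α := Real.rpow_le_rpow hpos.le (by linarith [hs.1]) hα.le
  gcongr

theorem exists_norm_le_of_continuousOn_apply
    (hP : ∀ x : H, ContinuousOn (fun t => P t x) (Icc 0 T)) :
    ∃ B, 0 ≤ B ∧ ∀ s ∈ Icc 0 T, ‖P s‖ ≤ B := by
  obtain ⟨B, hB⟩ := banach_steinhaus (g := fun i : Icc 0 T => P i) fun x => by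
    obtain ⟨C, hC⟩ := isCompact_Icc.exists_bound_of_continuousOn (hP x)
    exact ⟨C, fun i => hC i i.2⟩
  exact ⟨max B 0, le_max_right _ _, fun s hs => (hB ⟨s, hs⟩).trans (le_max_left _ _)⟩

namespace IsLyapunovData

theorem measurable_of_feedback (d : IsLyapunovData T α c S A0 Chat f G)
    (hPsa : ∀ t ∈ Icc 0 T, IsSelfAdjoint (P t))
    (hPcont : ∀ x : H, ContinuousOn (fun t => P t x) (Icc 0 T))
    (hP : LyapunovSingularBound T α Chat P) (hN : IsLyapunovFeedback T A0 Chat f P N)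
    (hN0 : ∀ s ∉ Ico 0 T, N s = 0) (x y : H) : Measurable fun s => ⟪N s x, y⟫ := by
  obtain ⟨C, hC0, hC⟩ := hP
  let Q : ℝ → H →L[ℝ] H := fun s => P (max 0 (min s T))
  have hQ : ∀ u v : H, Measurable fun s => ⟪Q s u, v⟫ := by
    intro u v
    have h : Continuous fun s => Q s u :=
      (hPcont u).comp_continuous (continuous_const.max (continuous_id.min continuous_const))
        fun s => ⟨le_max_left _ _, max_le d.pos_time.le (min_le_right _ _)⟩
    exact (h.inner continuous_const).measurable
  have hQP : ∀ s ∈ Ico 0 T, Q s = P s := fun s hs => by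
    simp only [Q, min_eq_left hs.2.le, max_eq_right hs.1]
  let g : ℕ → ℝ → ℝ := fun n => (Ico 0 T).indicator fun s =>
    ⟪f s x, y⟫ + ⟪Q s x, A0 s y⟫ + ⟪Q s (A0 s x), y⟫ +
      ∑ j ∈ Finset.range n, ⟪Q s (Chat j s x), Chat j s y⟫
  refine measurable_of_tendsto_metrizable (f := g) (fun n => ?_) (tendsto_pi_nhds.2 fun s => ?_)
  · refine Measurable.indicator ?_ measurableSet_Ico
    refine ((((d.measurable_source x).inner stronglyMeasurable_const).measurable.add
      (measurable_inner_apply hQ stronglyMeasurable_const (d.measurable_drift y))).add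
      (measurable_inner_apply hQ (d.measurable_drift x) stronglyMeasurable_const)).add ?_
    exact Finset.measurable_fun_sum _ fun j _ =>
      measurable_inner_apply hQ (d.measurable_noise j x) (d.measurable_noise j y)
  · by_cases hs : s ∈ Ico 0 T
    · simp only [g, indicator_of_mem hs, hQP s hs, hN s hs]
      exact tendsto_const_nhds.add ((hPsa s (Ico_subset_Icc_self hs)).summable_inner_apply
        (C := fun j => Chat j s) (fun z => (hC s hs z).1) x y).hasSum.tendsto_sum_nat
    · simp only [g, indicator_of_notMem hs, hN0 s hs, zero_apply, inner_zero_left]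
      exact tendsto_const_nhds

theorem exists_feedback (d : IsLyapunovData T α c S A0 Chat f G)
    (hω : IsSingularWeight T (-2 * α) θ ω L) (hPsa : ∀ t ∈ Icc 0 T, IsSelfAdjoint (P t))
    (hPcont : ∀ x : H, ContinuousOn (fun t => P t x) (Icc 0 T))
    (hP : LyapunovSingularBound T α Chat P) :
    ∃ N D, 0 ≤ D ∧ IsLyapunovSource T ω D N ∧ IsLyapunovFeedback T A0 Chat f P N := by
  obtain ⟨B, hB0, hB⟩ := exists_norm_le_of_continuousOn_apply hPcont
  have hPbd := hP
  obtain ⟨C, hC0, hC⟩ := hP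
  have hc := d.pos_const
  have hTα : 0 ≤ T ^ α := Real.rpow_nonneg d.pos_time.le _
  set D : ℝ := c + 2 * B * c * T ^ α + C with hDdef
  have hD : 0 ≤ D := by positivity
  have hex : ∀ s, ∃ N : H →L[ℝ] H, IsSelfAdjoint N ∧ ‖N‖ ≤ D * ω s ∧ (s ∉ Ico 0 T → N = 0) ∧
      (s ∈ Ico 0 T → ∀ x y : H,
        ⟪N x, y⟫ = lyapunovForm (A0 s) (fun j => Chat j s) (f s) (P s) x y) := by
    intro s
    by_cases hs : s ∈ Ico 0 T
    swap
    · exact ⟨0, .zero _, by simpa using mul_nonneg hD (hω.nonneg s), fun _ => rfl,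
        fun h => absurd h hs⟩
    have hsI := Ico_subset_Icc_self hs
    have hw : 0 ≤ (T - s) ^ (-2 * α) := Real.rpow_nonneg (sub_nonneg.2 hs.2.le) _
    obtain ⟨N, hNsa, hN, hNle⟩ := exists_eq_lyapunovForm (A := A0 s) (C := fun j => Chat j s)
      (d.isSelfAdjoint s hs) (hPsa s hsI) (fun x => (hC s hs x).1)
      (mul_nonneg hC0.le hw) (fun x => (hC s hs x).2)
    refine ⟨N, hNsa, hNle.trans ?_, fun h => absurd hs h, fun _ => hN⟩
    have hA : ‖A0 s‖ ≤ c * (T ^ α * (T - s) ^ (-2 * α)) :=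
      (d.drift_le s hs).trans (by gcongr; exact rpow_neg_le_mul_rpow_neg_two_mul d.pos_exponent hs)
    calc _ ≤ c * (T - s) ^ (-2 * α) + 2 * B * (c * (T ^ α * (T - s) ^ (-2 * α))) +
          C * (T - s) ^ (-2 * α) := by
          gcongr
          · exact d.source_le s hs
          · exact hB s hsI
      _ = D * (T - s) ^ (-2 * α) := by rw [hDdef]; ring
      _ ≤ D * ω s := by gcongr; exact hω.le_weight s hs
  choose N hNsa hNle hN0 hN using hex
  exact ⟨N, D, hD, ⟨hNsa, d.measurable_of_feedback hPsa hPcont hPbd hN hN0, hNle, hN0⟩, hN⟩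

theorem sum_abs_inner_noise_le (d : IsLyapunovData T α c S A0 Chat f G)
    (hω : IsSingularWeight T (-2 * α) θ ω L) (hK : IsLyapunovSource T ω D K) (hD : 0 ≤ D)
    {G' : H →L[ℝ] H} (hP : IsPropagated T S G' K P) {s : ℝ} (hs : s ∈ Ico 0 T) (x : H)
    (F : Finset ℕ) : ∑ j ∈ F, |⟪P s (Chat j s x), Chat j s x⟫| ≤
      (2 * c * ‖G'‖ + c * D * θ) * ω s * ‖x‖ ^ 2 :=
  hP.sum_abs_inner_le hK hD d.semigroup hω d.pos_const hs (fun j => Chat j s x) (sq_nonneg _) F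
    fun u hu => ((d.noise_le s hs u hu x).1.sum_le_tsum F fun _ _ => sq_nonneg _).trans
      (d.noise_le s hs u hu x).2

theorem exists_step (d : IsLyapunovData T α c S A0 Chat f G)
    (hω : IsSingularWeight T (-2 * α) θ ω L) (hL : 0 < L) (hθ : 0 < θ)
    (hK : IsLyapunovSource T ω D K) (hD : 0 ≤ D) :
    ∃ P N, IsLyapunovStep T α S A0 Chat f G K P N ∧ ∃ D', 0 ≤ D' ∧ IsLyapunovSource T ω D' N := by
  have hc := d.pos_const
  obtain ⟨P, hPsa, hP⟩ := hK.exists_isPropagated d.semigroup hω.integrable d.isSelfAdjoint_terminal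
  have hPcont := hP.continuousOn hK d.semigroup hω.integrable hω.nonneg hD
  have hPbd : LyapunovSingularBound T α Chat P := by
    refine ⟨(2 * c * ‖G‖ + c * D * θ) * L + 1, by positivity, fun s hs x => ?_⟩
    have hsum : ∀ F : Finset ℕ, ∑ j ∈ F, |⟪P s (Chat j s x), Chat j s x⟫| ≤
        ((2 * c * ‖G‖ + c * D * θ) * L + 1) * (T - s) ^ (-2 * α) * ‖x‖ ^ 2 := by
      intro F
      have hw : 0 ≤ (T - s) ^ (-2 * α) := Real.rpow_nonneg (sub_nonneg.2 hs.2.le) _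
      refine (d.sum_abs_inner_noise_le hω hK hD hP hs x F).trans ?_
      refine mul_le_mul_of_nonneg_right ?_ (sq_nonneg _)
      calc _ ≤ (2 * c * ‖G‖ + c * D * θ) * (L * (T - s) ^ (-2 * α)) := by
            gcongr; exact hω.weight_le s hs
        _ ≤ _ := by linarith
    exact ⟨summable_of_sum_le (fun _ => abs_nonneg _) hsum,
      Real.tsum_le_of_sum_le (fun _ => abs_nonneg _) hsum⟩
  obtain ⟨N, D', hD', hN, hPN⟩ := d.exists_feedback hω hPsa hPcont hPbd
  exact ⟨P, N, ⟨hPsa, hPcont, hPbd, hP, hPN⟩, D', hD', hN⟩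

theorem norm_step_sub_step_le (d : IsLyapunovData T α c S A0 Chat f G)
    (hω : IsSingularWeight T (-2 * α) θ ω L)
    (hM0 : 0 < M) (hM : ∀ t ∈ Icc 0 T, ‖S t‖ ≤ M)
    (hθM : (2 * c * T ^ α * M ^ 2 + c) * θ ≤ 1 / 2)
    (hK : IsLyapunovSource T ω D K) (hK' : IsLyapunovSource T ω D' K') (hε : 0 ≤ ε)
    (hKK' : ∀ s, ‖K s - K' s‖ ≤ ε * ω s) (h : IsLyapunovStep T α S A0 Chat f G K P N)
    (h' : IsLyapunovStep T α S A0 Chat f G K' P' N') {E E' : ℝ}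
    (hN : IsLyapunovSource T ω E N) (hN' : IsLyapunovSource T ω E' N') (s : ℝ) :
    ‖N s - N' s‖ ≤ ε / 2 * ω s := by
  have hωs := hω.nonneg s
  by_cases hs : s ∈ Ico 0 T
  swap
  · rw [hN.eq_zero s hs, hN'.eq_zero s hs, sub_zero, norm_zero]
    positivity
  have hc := d.pos_const
  have hTα : 0 ≤ T ^ α := Real.rpow_nonneg d.pos_time.le _
  have hsI := Ico_subset_Icc_self hs
  have hKd : IsLyapunovSource T ω ε (fun s => K s - K' s) :=
    ⟨fun s => (hK.isSelfAdjoint s).sub (hK'.isSelfAdjoint s), fun x y => by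
      simp only [sub_apply, inner_sub_left]
      exact (hK.measurable x y).sub (hK'.measurable x y),
      hKK', fun s hs => by rw [hK.eq_zero s hs, hK'.eq_zero s hs, sub_zero]⟩
  have hPd := h.propagated.sub h'.propagated hK hK' d.semigroup hω.integrable
  have hsum := d.sum_abs_inner_noise_le hω hKd hε hPd hs
  simp only [norm_zero, mul_zero, zero_add] at hsum
  have hw : 0 ≤ (T - s) ^ (-2 * α) := Real.rpow_nonneg (sub_nonneg.2 hs.2.le) _
  have hPnorm := hPd.norm_le hKd hε hω.integrable hω.nonneg hM0 hM hsI
  rw [norm_zero, zero_add] at hPnorm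
  have hintg : (T - s) ^ (-2 * α) * ∫ r in s..T, ω r ≤ θ * ω s := by
    rw [← intervalIntegral.integral_const_mul]
    refine le_trans ?_ (hω.integral_le s hs)
    refine intervalIntegral.integral_mono_on_of_le_Ioo hs.2.le
      (hω.integrable.const_mul _).intervalIntegrable (hω.intervalIntegrable s hs) fun r hr => ?_
    have h1 : 0 ≤ (r - s) ^ (-2 * α) := Real.rpow_nonneg (sub_nonneg.2 hr.1.le) _
    exact mul_le_mul_of_nonneg_right (by linarith) (hω.nonneg r)
  have hA : ‖A0 s‖ ≤ c * (T ^ α * (T - s) ^ (-2 * α)) :=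
    (d.drift_le s hs).trans (by gcongr; exact rpow_neg_le_mul_rpow_neg_two_mul d.pos_exponent hs)
  have hPA : 2 * ‖P s - P' s‖ * ‖A0 s‖ ≤ 2 * c * T ^ α * M ^ 2 * ε * (θ * ω s) := by
    have hI : 0 ≤ ∫ r in s..T, ω r :=
      intervalIntegral.integral_nonneg hs.2.le fun r _ => hω.nonneg r
    calc _ ≤ 2 * (M ^ 2 * (ε * ∫ r in s..T, ω r)) * (c * (T ^ α * (T - s) ^ (-2 * α))) := by
          gcongr
      _ = 2 * c * T ^ α * M ^ 2 * ε * ((T - s) ^ (-2 * α) * ∫ r in s..T, ω r) := by ring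
      _ ≤ _ := by gcongr
  obtain ⟨C, -, hC⟩ := h.bound
  obtain ⟨C', -, hC'⟩ := h'.bound
  refine norm_le_of_abs_inner_self_le ((hN.isSelfAdjoint s).sub (hN'.isSelfAdjoint s))
    (by positivity) fun x => ?_
  have hx := abs_lyapunovForm_self_le (A := A0 s) (f := f s - f s) (P := P s - P' s)
    (C := fun j => Chat j s)
    (fun x => summable_of_sum_le (fun _ => abs_nonneg _) (hsum x))
    (fun x => Real.tsum_le_of_sum_le (fun _ => abs_nonneg _) (hsum x)) x
  rw [← lyapunovForm_sub (h.isSelfAdjoint s hsI) (h'.isSelfAdjoint s hsI)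
    (fun x => (hC s hs x).1) (fun x => (hC' s hs x).1), ← h.feedback s hs, ← h'.feedback s hs,
    ← inner_sub_left, ← sub_apply, sub_self, norm_zero, zero_add] at hx
  refine hx.trans ?_
  gcongr
  calc _ ≤ 2 * c * T ^ α * M ^ 2 * ε * (θ * ω s) + c * ε * θ * ω s := by gcongr
    _ = ((2 * c * T ^ α * M ^ 2 + c) * θ) * (ε * ω s) := by ring
    _ ≤ 1 / 2 * (ε * ω s) := by gcongr
    _ = _ := by ring

end IsLyapunovData

end Lyapunov

section FixedPoint

variable {H : Type*} [NormedAddCommGroup H] [InnerProductSpace ℝ H]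
  {T α c θ L D D' M : ℝ} {ω : ℝ → ℝ} {S A0 f K K' P P' N : ℝ → H →L[ℝ] H}
  {Chat : ℕ → ℝ → H →L[ℝ] H} {G : H →L[ℝ] H}

theorem IsLyapunovFeedback.integral_eq (hN : IsLyapunovFeedback T A0 Chat f P N) {t : ℝ}
    (ht : t ∈ Icc 0 T) (u v : ℝ → H) :
    ∫ s in t..T, ⟪N s (u s), v s⟫ =
      ∫ s in t..T, lyapunovForm (A0 s) (fun j => Chat j s) (f s) (P s) (u s) (v s) := by
  have hne : ∀ᵐ s : ℝ, s ≠ T := by simp [ae_iff]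
  refine intervalIntegral.integral_congr_ae ?_
  filter_upwards [hne] with s hsT hs
  rw [uIoc_of_le ht.2] at hs
  exact hN s ⟨ht.1.trans hs.1.le, lt_of_le_of_ne hs.2 hsT⟩ _ _

variable [CompleteSpace H]

theorem IsLyapunovStep.isLyapunovMildSolution (h : IsLyapunovStep T α S A0 Chat f G K P K) :
    IsLyapunovMildSolution T S A0 Chat f G P :=
  ⟨h.isSelfAdjoint, h.continuousOn, fun t ht x y => by
    rw [h.propagated t ht, h.feedback.integral_eq ht (fun s => S (s - t) x) fun s => S (s - t) y]
    rfl⟩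

namespace IsLyapunovData

theorem exists_step_of_isLyapunovMildSolution (d : IsLyapunovData T α c S A0 Chat f G)
    (hω : IsSingularWeight T (-2 * α) θ ω L) (hP : IsLyapunovMildSolution T S A0 Chat f G P)
    (hPbd : LyapunovSingularBound T α Chat P) :
    ∃ K D, 0 ≤ D ∧ IsLyapunovSource T ω D K ∧ IsLyapunovStep T α S A0 Chat f G K P K := by
  obtain ⟨hPsa, hPcont, hPeq⟩ := hP
  obtain ⟨K, D, hD, hK, hPK⟩ := d.exists_feedback hω hPsa hPcont hPbd
  refine ⟨K, D, hD, hK, hPsa, hPcont, hPbd, fun t ht x y => ?_, hPK⟩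
  rw [hPeq t ht, hPK.integral_eq ht (fun s => S (s - t) x) fun s => S (s - t) y]
  rfl

theorem eq_of_step_self (d : IsLyapunovData T α c S A0 Chat f G)
    (hω : IsSingularWeight T (-2 * α) θ ω L) (hM0 : 0 < M) (hM : ∀ t ∈ Icc 0 T, ‖S t‖ ≤ M)
    (hθM : (2 * c * T ^ α * M ^ 2 + c) * θ ≤ 1 / 2)
    (hK : IsLyapunovSource T ω D K) (hK' : IsLyapunovSource T ω D' K') (hD : 0 ≤ D) (hD' : 0 ≤ D')
    (h : IsLyapunovStep T α S A0 Chat f G K P K) (h' : IsLyapunovStep T α S A0 Chat f G K' P' K') :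
    K = K' := by
  have hn : ∀ n : ℕ, ∀ s, ‖K s - K' s‖ ≤ (D + D') * (1 / 2) ^ n * ω s := by
    intro n
    induction n with
    | zero =>
      intro s
      calc _ ≤ ‖K s‖ + ‖K' s‖ := norm_sub_le _ _
        _ ≤ D * ω s + D' * ω s := add_le_add (hK.norm_le s) (hK'.norm_le s)
        _ = _ := by ring
    | succ n ih =>
      intro s
      have := d.norm_step_sub_step_le hω hM0 hM hθM hK hK' (by positivity) ih h h' hK hK' s
      exact this.trans (le_of_eq (by ring))
  funext s
  have hlim : Tendsto (fun n : ℕ => (D + D') * (1 / 2) ^ n * ω s) atTop (𝓝 0) := by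
    have := ((tendsto_pow_atTop_nhds_zero_of_lt_one (r := (1 / 2 : ℝ)) (by norm_num)
      (by norm_num)).const_mul (D + D')).mul_const (ω s)
    simpa using this
  exact sub_eq_zero.1 (norm_le_zero_iff.1 (ge_of_tendsto' hlim fun n => hn n s))

theorem exists_step_self (d : IsLyapunovData T α c S A0 Chat f G)
    (hω : IsSingularWeight T (-2 * α) θ ω L) (hL : 0 < L) (hθ : 0 < θ) (hM0 : 0 < M)
    (hM : ∀ t ∈ Icc 0 T, ‖S t‖ ≤ M) (hθM : (2 * c * T ^ α * M ^ 2 + c) * θ ≤ 1 / 2) :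
    ∃ K P, IsLyapunovStep T α S A0 Chat f G K P K := by
  have hstep : ∀ K : {K : ℝ → H →L[ℝ] H // ∃ D, 0 ≤ D ∧ IsLyapunovSource T ω D K},
      ∃ N : {K : ℝ → H →L[ℝ] H // ∃ D, 0 ≤ D ∧ IsLyapunovSource T ω D K},
        ∃ P, IsLyapunovStep T α S A0 Chat f G K P N := by
    rintro ⟨K, D, hD, hK⟩
    obtain ⟨P, N, h, hN⟩ := d.exists_step hω hL hθ hK hD
    exact ⟨⟨N, hN⟩, P, h⟩
  choose Ψ Q hΨ using hstep
  have hcontr : ∀ K K' ε, 0 ≤ ε → (∀ s, ‖K.1 s - K'.1 s‖ ≤ ε * ω s) →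
      ∀ s, ‖(Ψ K).1 s - (Ψ K').1 s‖ ≤ ε / 2 * ω s := by
    intro K K' ε hε hKK'
    obtain ⟨_, _, hK⟩ := K.2
    obtain ⟨_, _, hK'⟩ := K'.2
    obtain ⟨_, _, hN⟩ := (Ψ K).2
    obtain ⟨_, _, hN'⟩ := (Ψ K').2
    exact d.norm_step_sub_step_le hω hM0 hM hθM hK hK' hε hKK' (hΨ K) (hΨ K') hN hN'
  let K₀ : {K : ℝ → H →L[ℝ] H // ∃ D, 0 ≤ D ∧ IsLyapunovSource T ω D K} :=
    ⟨fun _ => 0, 0, le_rfl, fun _ => .zero _, fun x y => by simp, fun s => by simp,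
      fun _ _ => rfl⟩
  let Kn : ℕ → {K : ℝ → H →L[ℝ] H // ∃ D, 0 ≤ D ∧ IsLyapunovSource T ω D K} :=
    fun n => Ψ^[n] K₀
  have hKsucc : ∀ n, Kn (n + 1) = Ψ (Kn n) := fun n => Function.iterate_succ_apply' Ψ n K₀
  obtain ⟨D, hD, hK1⟩ := (Kn 1).2
  have hgeom : ∀ n s, ‖(Kn n).1 s - (Kn (n + 1)).1 s‖ ≤ D * (1 / 2) ^ n * ω s := by
    intro n
    induction n with
    | zero =>
      intro s
      have h0 : (Kn 0).1 s = 0 := rfl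
      rw [h0, zero_sub, norm_neg, pow_zero, mul_one]
      exact hK1.norm_le s
    | succ n ih =>
      intro s
      have := hcontr (Kn n) (Kn (n + 1)) _ (by positivity) ih s
      rw [← hKsucc, ← hKsucc] at this
      exact this.trans (le_of_eq (by ring))
  have hdist : ∀ s n, dist ((Kn n).1 s) ((Kn (n + 1)).1 s) ≤ D * ω s * (1 / 2) ^ n := by
    intro s n
    rw [dist_eq_norm]
    exact (hgeom n s).trans (le_of_eq (by ring))
  have hlim : ∀ s, ∃ B, Tendsto (fun n => (Kn n).1 s) atTop (𝓝 B) := fun s =>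
    cauchySeq_tendsto_of_complete (cauchySeq_of_le_geometric _ _ (by norm_num) (hdist s))
  choose K hK using hlim
  have hKn : ∀ n s, ‖(Kn n).1 s - K s‖ ≤ 2 * D * (1 / 2) ^ n * ω s := by
    intro n s
    have := dist_le_of_le_geometric_of_tendsto _ _ (by norm_num) (hdist s) (hK s) n
    rw [dist_eq_norm] at this
    refine this.trans (le_of_eq ?_)
    norm_num
    ring
  have hsource : IsLyapunovSource T ω (2 * D) K := by
    refine ⟨fun s => ?_, fun x y => ?_, fun s => ?_, fun s hs => ?_⟩
    · have hclosed : IsClosed {B : H →L[ℝ] H | IsSelfAdjoint B} :=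
        isClosed_eq continuous_star continuous_id
      refine hclosed.mem_of_tendsto (hK s) (.of_forall fun n => ?_)
      obtain ⟨_, _, h⟩ := (Kn n).2
      exact h.isSelfAdjoint s
    · refine measurable_of_tendsto_metrizable (f := fun n s => ⟪(Kn n).1 s x, y⟫) (fun n => ?_)
        (tendsto_pi_nhds.2 fun s => ?_)
      · obtain ⟨_, _, h⟩ := (Kn n).2
        exact h.measurable x y
      · have h1 : Tendsto (fun n => (Kn n).1 s x) atTop (𝓝 (K s x)) :=
          ((ContinuousLinearMap.apply ℝ H x).continuous.tendsto _).comp (hK s)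
        exact h1.inner tendsto_const_nhds
    · have h := hKn 0 s
      have h0 : (Kn 0).1 s = 0 := rfl
      rwa [h0, zero_sub, norm_neg, pow_zero, mul_one] at h
    · refine tendsto_nhds_unique (hK s) (tendsto_const_nhds.congr fun n => ?_)
      obtain ⟨_, _, h⟩ := (Kn n).2
      exact (h.eq_zero s hs).symm
  have hfix : (Ψ ⟨K, 2 * D, by positivity, hsource⟩).1 = K := by
    funext s
    refine tendsto_nhds_unique ?_ ((tendsto_add_atTop_iff_nat 1).2 (hK s))
    rw [tendsto_iff_norm_sub_tendsto_zero]
    have hb : Tendsto (fun n : ℕ => 2 * D * (1 / 2) ^ n / 2 * ω s) atTop (𝓝 0) := by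
      have := (((tendsto_pow_atTop_nhds_zero_of_lt_one (r := (1 / 2 : ℝ)) (by norm_num)
        (by norm_num)).const_mul (2 * D)).div_const 2).mul_const (ω s)
      simpa using this
    refine squeeze_zero (fun _ => norm_nonneg _) (fun n => ?_) hb
    rw [hKsucc]
    exact hcontr (Kn n) ⟨K, _⟩ _ (by positivity) (hKn n) s
  have h := hΨ ⟨K, 2 * D, by positivity, hsource⟩
  rw [hfix] at h
  exact ⟨K, _, h⟩

end IsLyapunovData

end FixedPoint

/-- existence of a mild solution of the Lyapunov equation satisfying the
singular bound, and uniqueness among mild solutions satisfying a bound of this form. -/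
theorem stmt7
    {H : Type*} [NormedAddCommGroup H] [InnerProductSpace ℝ H] [CompleteSpace H]
    (T α c : ℝ) (hT : 0 < T) (hα0 : 0 < α) (hα : α < 1 / 2) (hc : 0 < c)
    (S : ℝ → H →L[ℝ] H)
    (hS0 : S 0 = ContinuousLinearMap.id ℝ H)
    (hSadd : ∀ s t : ℝ, 0 ≤ s → 0 ≤ t → S (s + t) = (S s).comp (S t))
    (hScont : ∀ x : H, ContinuousOn (fun t => S t x) (Set.Ici (0 : ℝ)))
    (A0 : ℝ → H →L[ℝ] H) (Chat : ℕ → ℝ → H →L[ℝ] H) (f : ℝ → H →L[ℝ] H)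
    (G : H →L[ℝ] H) (hGsa : IsSelfAdjoint G)
    (hfsa : ∀ s ∈ Set.Ico (0 : ℝ) T, IsSelfAdjoint (f s))
    (hA0meas : ∀ x : H, StronglyMeasurable fun s => A0 s x)
    (hCmeas : ∀ j (x : H), StronglyMeasurable fun s => Chat j s x)
    (hfmeas : ∀ x : H, StronglyMeasurable fun s => f s x)
    (hA0 : ∀ s ∈ Set.Ico (0 : ℝ) T, ‖A0 s‖ ≤ c * (T - s) ^ (-α))
    (hChat : ∀ s ∈ Set.Ico (0 : ℝ) T, ∀ t : ℝ, 0 < t → ∀ x : H,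
      (Summable fun j => ‖S t (Chat j s x)‖ ^ 2) ∧
      (∑' j, ‖S t (Chat j s x)‖ ^ 2)
        ≤ c * (t ^ (-2 * α) + (T - s) ^ (-2 * α)) * ‖x‖ ^ 2)
    (hf : ∀ s ∈ Set.Ico (0 : ℝ) T, ‖f s‖ ≤ c * (T - s) ^ (-2 * α)) :
    (∃ P : ℝ → H →L[ℝ] H,
        IsLyapunovMildSolution T S A0 Chat f G P ∧ LyapunovSingularBound T α Chat P) ∧
    (∀ P1 P2 : ℝ → H →L[ℝ] H,
      IsLyapunovMildSolution T S A0 Chat f G P1 → LyapunovSingularBound T α Chat P1 →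
      IsLyapunovMildSolution T S A0 Chat f G P2 → LyapunovSingularBound T α Chat P2 →
      ∀ t ∈ Set.Icc (0 : ℝ) T, P1 t = P2 t) := by

  have d : IsLyapunovData T α c S A0 Chat f G :=
    ⟨hT, hα0, hα, hc, ⟨hS0, hSadd, hScont⟩, hGsa, hfsa, hA0meas, hCmeas, hfmeas, hA0, hChat, hf⟩
  obtain ⟨M, hM0, hM⟩ := d.semigroup.exists_norm_le T
  have hb : 0 < 2 * c * T ^ α * M ^ 2 + c := by positivity
  obtain ⟨ω, L, hL, hω⟩ := exists_isSingularWeight hT (p := -2 * α)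
    (θ := 1 / (2 * (2 * c * T ^ α * M ^ 2 + c))) (by linarith) (by linarith) (by positivity)
  have hθM : (2 * c * T ^ α * M ^ 2 + c) * (1 / (2 * (2 * c * T ^ α * M ^ 2 + c))) ≤ 1 / 2 := by
    field_simp
    exact le_rfl
  refine ⟨?_, fun P1 P2 hP1 hB1 hP2 hB2 t ht => ?_⟩
  · obtain ⟨K, P, h⟩ := d.exists_step_self hω hL (by positivity) hM0 hM hθM
    exact ⟨P, h.isLyapunovMildSolution, h.bound⟩
  · obtain ⟨K1, D1, hD1, hK1, h1⟩ := d.exists_step_of_isLyapunovMildSolution hω hP1 hB1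
    obtain ⟨K2, D2, hD2, hK2, h2⟩ := d.exists_step_of_isLyapunovMildSolution hω hP2 hB2
    obtain rfl := d.eq_of_step_self hω hM0 hM hθM hK1 hK2 hD1 hD2 h1 h2
    ext x
    refine ext_inner_right ℝ fun y => ?_
    rw [h1.propagated t ht, h2.propagated t ht]
end

section
/- Assume in addition that G ∈ 𝒮⁺(H) and f(s) ∈ 𝒮⁺(H) for every s ∈ [0,T). Then the unique mild solution P of the Lyapunov equation satisfying ∑_{j=1}^∞ |⟨P_s Ĉ_j(s) x, Ĉ_j(s) x⟩| ≤ C (T−s)^{−2α} |x|² on [0,T) takes values in 𝒮⁺(H): ⟨P_t x, x⟩ ≥ 0 for every t ∈ [0,T] and x ∈ H. -/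
open scoped RealInnerProductSpace
open Filter MeasureTheory

/-- Applying a strongly measurable family of operators to a measurable family of vectors gives a
measurable family of vectors; no separability is needed. -/
theorem aestronglyMeasurable_clm_apply {X E F : Type*} [MeasurableSpace X] {μ : Measure X}
    [NormedAddCommGroup E] [NormedSpace ℝ E] [NormedAddCommGroup F] [NormedSpace ℝ F]
    {L : X → E →L[ℝ] F} {g : X → E} (hL : ∀ x, AEStronglyMeasurable (fun s => L s x) μ)
    (hg : AEStronglyMeasurable g μ) : AEStronglyMeasurable (fun s => L s (g s)) μ := by
  have hsimple : ∀ φ : SimpleFunc X E, AEStronglyMeasurable (fun s => L s (φ s)) μ := by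
    intro φ
    have heq : (fun s => L s (φ s))
        = fun s => ∑ v ∈ φ.range, (φ ⁻¹' {v}).indicator (fun s => L s v) s := by
      funext s
      rw [Finset.sum_eq_single (φ s)]
      · simp
      · intro v _ hv
        exact Set.indicator_of_notMem (fun h => hv h.symm) _
      · intro h
        exact absurd (φ.mem_range_self s) h
    rw [heq]
    exact Finset.aestronglyMeasurable_fun_sum _ fun v _ =>
      (hL v).indicator (φ.measurableSet_fiber v)
  have hlim : AEStronglyMeasurable (fun s => L s (hg.mk g s)) μ :=
    aestronglyMeasurable_of_tendsto_ae atTop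
      (fun n => hsimple (hg.stronglyMeasurable_mk.approx n))
      (ae_of_all _ fun s =>
        ((L s).continuous.tendsto _).comp (hg.stronglyMeasurable_mk.tendsto_approx s))
  refine hlim.congr ?_
  filter_upwards [hg.ae_eq_mk] with s hs
  rw [hs]

/-- A function whose increments are quadratically small with respect to a continuous monotone
function is constant. -/
theorem eq_of_abs_sub_le_sq {D ω : ℝ → ℝ} {K a b : ℝ} (hab : a ≤ b)
    (hωc : ContinuousOn ω (Set.Icc a b)) (hωm : MonotoneOn ω (Set.Icc a b))
    (hD : ∀ r ∈ Set.Icc a b, ∀ r' ∈ Set.Icc a b, r ≤ r' →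
      |D r' - D r| ≤ K * (ω r' - ω r) ^ 2) : D b = D a := by
  have hsurj : ∀ v ∈ Set.Icc (ω a) (ω b), ∃ r ∈ Set.Icc a b, ω r = v :=
    fun v hv => intermediate_value_Icc hab hωc hv
  have hD' : ∀ r ∈ Set.Icc a b, ∀ r' ∈ Set.Icc a b,
      |D r' - D r| ≤ K * (ω r' - ω r) ^ 2 := by
    intro r hr r' hr'
    rcases le_total r r' with h | h
    · exact hD r hr r' hr' h
    · rw [abs_sub_comm, show (ω r' - ω r) ^ 2 = (ω r - ω r') ^ 2 by ring]
      exact hD r' hr' r hr h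
  choose! ρ hρ hωρ using hsurj
  set h := ω b - ω a with hh
  have hh0 : 0 ≤ h := sub_nonneg.2 (hωm (Set.left_mem_Icc.2 hab) (Set.right_mem_Icc.2 hab) hab)
  have key : ∀ n : ℕ, 0 < n → |D b - D a| ≤ K * h ^ 2 / n := by
    intro n hn
    have hn' : (0 : ℝ) < n := by exact_mod_cast hn
    let v : ℕ → ℝ := fun k => ω a + k / n * h
    have hv : ∀ k ≤ n, v k ∈ Set.Icc (ω a) (ω b) := by
      intro k hk
      have hk1 : (k : ℝ) / n ≤ 1 := by
        rw [div_le_one hn']; exact_mod_cast hk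
      have hk0 : (0 : ℝ) ≤ k / n := by positivity
      constructor
      · have := mul_nonneg hk0 hh0
        simp only [v]; linarith
      · have := mul_le_mul_of_nonneg_right hk1 hh0
        simp only [v]; linarith
    have hstep : ∀ k < n, |D (ρ (v (k + 1))) - D (ρ (v k))| ≤ K * (h / n) ^ 2 := by
      intro k hk
      have := hD' _ (hρ _ (hv k hk.le)) _ (hρ _ (hv (k + 1) hk))
      rw [hωρ _ (hv k hk.le), hωρ _ (hv (k + 1) hk)] at this
      refine this.trans_eq ?_
      simp only [v]; push_cast; ring
    have hsum : ∀ k ≤ n, |D (ρ (v k)) - D (ρ (v 0))| ≤ k * (K * (h / n) ^ 2) := by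
      intro k
      induction k with
      | zero => simp
      | succ k ih =>
        intro hk
        have h1 := ih (Nat.le_of_succ_le hk)
        have h2 := hstep k hk
        have h3 := abs_sub_le (D (ρ (v (k + 1)))) (D (ρ (v k))) (D (ρ (v 0)))
        push_cast
        linarith
    have hend : ∀ r ∈ Set.Icc a b, ∀ u ∈ Set.Icc (ω a) (ω b), ω r = u → D (ρ u) = D r := by
      intro r hr u hu hru
      have := hD' r hr _ (hρ u hu)
      rw [hωρ u hu, hru] at this
      simp only [sub_self, ne_eq, OfNat.ofNat_ne_zero, not_false_eq_true, zero_pow,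
        mul_zero] at this
      exact sub_eq_zero.1 (abs_eq_zero.1 (le_antisymm this (abs_nonneg _)))
    have := hsum n le_rfl
    rw [hend b (Set.right_mem_Icc.2 hab) (v n) (hv n le_rfl)
        (by simp only [v]; field_simp; rw [hh]; ring),
      hend a (Set.left_mem_Icc.2 hab) (v 0) (hv 0 (Nat.zero_le _)) (by simp [v])] at this
    refine this.trans_eq ?_
    field_simp
  have hlim : Tendsto (fun n : ℕ => K * h ^ 2 / n) atTop (nhds 0) :=
    tendsto_const_div_atTop_nhds_zero_nat _
  have : |D b - D a| ≤ 0 :=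
    ge_of_tendsto hlim ((eventually_gt_atTop 0).mono fun n hn => key n hn)
  exact sub_eq_zero.1 (abs_eq_zero.1 (le_antisymm this (abs_nonneg _)))

/-- A symmetric bilinear form bounded on the diagonal is bounded with the same constant. -/
theorem abs_symm_bilin_le {H : Type*} [NormedAddCommGroup H] [InnerProductSpace ℝ H]
    (b : H →ₗ[ℝ] H →ₗ[ℝ] ℝ) (hb : ∀ x y, b x y = b y x) {K : ℝ}
    (hK : ∀ x, |b x x| ≤ K * ‖x‖ ^ 2) (x y : H) : |b x y| ≤ K * ‖x‖ * ‖y‖ := by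
  have hsq : ∀ u v : H, 2 * |b u v| ≤ K * (‖u‖ ^ 2 + ‖v‖ ^ 2) := by
    intro u v
    have h1 : 4 * b u v = b (u + v) (u + v) - b (u - v) (u - v) := by
      simp only [map_add, map_sub, LinearMap.add_apply, LinearMap.sub_apply, hb v u]; ring
    have h2 := parallelogram_law_with_norm ℝ u v
    have h3 := hK (u + v)
    have h4 := hK (u - v)
    have h5 : |4 * b u v| ≤ K * ‖u + v‖ ^ 2 + K * ‖u - v‖ ^ 2 := by
      rw [h1]; exact (abs_sub _ _).trans (add_le_add h3 h4)
    rw [abs_mul, abs_of_pos (by norm_num : (0 : ℝ) < 4)] at h5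
    have h6 : ‖u + v‖ ^ 2 + ‖u - v‖ ^ 2 = 2 * (‖u‖ ^ 2 + ‖v‖ ^ 2) := by nlinarith
    nlinarith [congrArg (K * ·) h6]
  rcases eq_or_ne x 0 with rfl | hx
  · simp
  rcases eq_or_ne y 0 with rfl | hy
  · simp
  have hx' : 0 < ‖x‖ := norm_pos_iff.2 hx
  have hy' : 0 < ‖y‖ := norm_pos_iff.2 hy
  have := hsq (‖x‖⁻¹ • x) (‖y‖⁻¹ • y)
  simp only [map_smul, LinearMap.smul_apply, smul_eq_mul, norm_smul, norm_inv, norm_norm,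
    abs_mul, abs_inv, abs_norm] at this
  rw [inv_mul_cancel₀ hx'.ne', inv_mul_cancel₀ hy'.ne'] at this
  have h7 : ‖x‖⁻¹ * (‖y‖⁻¹ * |b x y|) ≤ K := by
    rw [mul_left_comm]; linarith
  calc |b x y| = (‖x‖⁻¹ * (‖y‖⁻¹ * |b x y|)) * (‖x‖ * ‖y‖) := by field_simp
    _ ≤ K * (‖x‖ * ‖y‖) := by gcongr
    _ = K * ‖x‖ * ‖y‖ := by ring

/-- A strongly continuous family of operators is bounded on compact intervals. -/
theorem exists_norm_le_of_strongly_continuousOn {H : Type*} [NormedAddCommGroup H]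
    [InnerProductSpace ℝ H] [CompleteSpace H] {L : ℝ → H →L[ℝ] H} {a b : ℝ}
    (hL : ∀ x, ContinuousOn (fun t => L t x) (Set.Icc a b)) :
    ∃ M, 1 ≤ M ∧ ∀ t ∈ Set.Icc a b, ‖L t‖ ≤ M := by
  obtain ⟨M, hM⟩ := banach_steinhaus (g := fun t : Set.Icc a b => L t) (fun x => by
    obtain ⟨C, hC⟩ := isCompact_Icc.exists_bound_of_continuousOn (hL x)
    exact ⟨C, fun t => hC t t.2⟩)
  exact ⟨max 1 M, le_max_left _ _, fun t ht => (hM ⟨t, ht⟩).trans (le_max_right _ _)⟩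

section Volterra

variable {H : Type*} [NormedAddCommGroup H] [InnerProductSpace ℝ H]
  {S K : ℝ → H →L[ℝ] H} {M L : ℝ} {w : ℝ → ℝ}

theorem volterra_kernel_aestronglyMeasurable (hS : ∀ x, Continuous fun t => S t x)
    (hK : ∀ x, AEStronglyMeasurable (fun t => K t x) volume) {y : ℝ → H} (hy : Continuous y)
    (r : ℝ) : AEStronglyMeasurable (fun σ => S (r - σ) (K σ (y σ))) volume :=
  aestronglyMeasurable_clm_apply
    (fun x => ((hS x).comp (continuous_const.sub continuous_id)).aestronglyMeasurable)
    (aestronglyMeasurable_clm_apply hK hy.aestronglyMeasurable)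

theorem volterra_kernel_norm_le (hM : ∀ t, ‖S t‖ ≤ M) (hKw : ∀ t, ‖K t‖ ≤ L * w t) {y : ℝ → H}
    (r σ : ℝ) : ‖S (r - σ) (K σ (y σ))‖ ≤ M * L * (w σ * ‖y σ‖) := by
  have hM0 : 0 ≤ M := (norm_nonneg _).trans (hM 0)
  calc ‖S (r - σ) (K σ (y σ))‖ ≤ ‖S (r - σ)‖ * (‖K σ‖ * ‖y σ‖) :=
        (S (r - σ)).le_opNorm_of_le ((K σ).le_opNorm _)
    _ ≤ M * (L * w σ * ‖y σ‖) := by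
        gcongr
        · exact hM _
        · exact hKw _
    _ = _ := by ring

theorem volterra_kernel_integrable (hS : ∀ x, Continuous fun t => S t x) (hM : ∀ t, ‖S t‖ ≤ M)
    (hK : ∀ x, AEStronglyMeasurable (fun t => K t x) volume) (hw : Integrable w)
    (hKw : ∀ t, ‖K t‖ ≤ L * w t) {y : ℝ → H} (hy : Continuous y)
    {Y : ℝ} (hY : ∀ σ, ‖y σ‖ ≤ Y) (r : ℝ) :
    Integrable (fun σ => S (r - σ) (K σ (y σ))) := by
  refine (hw.const_mul (M * L * Y)).mono'
    (volterra_kernel_aestronglyMeasurable hS hK hy r) (ae_of_all _ fun σ => ?_)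
  have hM0 : 0 ≤ M := (norm_nonneg _).trans (hM 0)
  have hLw : 0 ≤ L * w σ := (norm_nonneg _).trans (hKw σ)
  calc _ ≤ M * L * (w σ * ‖y σ‖) := volterra_kernel_norm_le hM hKw r σ
    _ = M * (L * w σ) * ‖y σ‖ := by ring
    _ ≤ M * (L * w σ) * Y := by gcongr; exact hY σ
    _ = _ := by ring

theorem volterra_continuous (hS : ∀ x, Continuous fun t => S t x) (hM : ∀ t, ‖S t‖ ≤ M)
    (hK : ∀ x, AEStronglyMeasurable (fun t => K t x) volume) (hw : Integrable w)
    (hKw : ∀ t, ‖K t‖ ≤ L * w t) {y : ℝ → H} (hy : Continuous y)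
    {Y : ℝ} (hY : ∀ σ, ‖y σ‖ ≤ Y) (s : ℝ) :
    Continuous fun r => ∫ σ in s..r, S (r - σ) (K σ (y σ)) := by
  rw [continuous_iff_continuousAt]
  intro r₀
  have hM0 : 0 ≤ M := (norm_nonneg _).trans (hM 0)
  have h := intervalIntegral.continuousAt_parametric_primitive_of_dominated (μ := volume)
    (F := fun r σ => S (r - σ) (K σ (y σ))) (fun σ => M * L * Y * w σ)
    (min s r₀ - 1) (max s r₀ + 1) (a₀ := s) (b₀ := r₀) (x₀ := r₀)
    (fun r => (volterra_kernel_aestronglyMeasurable hS hK hy r).restrict)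
    (Eventually.of_forall fun r => ae_of_all _ fun σ => by
      have hLw : 0 ≤ L * w σ := (norm_nonneg _).trans (hKw σ)
      calc _ ≤ M * L * (w σ * ‖y σ‖) := volterra_kernel_norm_le hM hKw r σ
        _ = M * (L * w σ) * ‖y σ‖ := by ring
        _ ≤ M * (L * w σ) * Y := by gcongr; exact hY σ
        _ = _ := by ring)
    (hw.const_mul _).intervalIntegrable
    (ae_of_all _ fun σ =>
      ((hS (K σ (y σ))).comp (continuous_id.sub continuous_const)).continuousAt)
    ⟨by linarith [min_le_left s r₀], by linarith [le_max_left s r₀]⟩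
    ⟨by linarith [min_le_right s r₀], by linarith [le_max_right s r₀]⟩ (by simp)
  exact h.comp (f := fun r : ℝ => (r, r)) (continuous_id.prodMk continuous_id).continuousAt

/-- The linear Volterra equation `y(r) = S(r-s)x + ∫_s^r S(r-σ)K(σ)y(σ)dσ` has a bounded continuous
solution on intervals where the kernel is small. -/
theorem exists_volterra_solution [CompleteSpace H] (hS : ∀ x, Continuous fun t => S t x)
    (hM : ∀ t, ‖S t‖ ≤ M)
    (hK : ∀ x, AEStronglyMeasurable (fun t => K t x) volume) (hw : Integrable w)
    (hKw : ∀ t, ‖K t‖ ≤ L * w t) {s τ : ℝ} (hsτ : s ≤ τ)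
    (hsmall : M * L * (∫ σ in s..τ, w σ) ≤ 1 / 2) (x : H) :
    ∃ y : ℝ → H, Continuous y ∧ (∃ Y, ∀ σ, ‖y σ‖ ≤ Y) ∧ ∀ r ∈ Set.Icc s τ,
      y r = S (r - s) x + ∫ σ in s..r, S (r - σ) (K σ (y σ)) := by
  have hM0 : 0 ≤ M := (norm_nonneg _).trans (hM 0)
  let ext : C(Set.Icc s τ, H) → ℝ → H := fun u => Set.IccExtend hsτ u
  have hext : ∀ u, Continuous (ext u) := fun u => u.continuous.Icc_extend'
  have hextn : ∀ u σ, ‖ext u σ‖ ≤ ‖u‖ := fun u σ => u.norm_coe_le_norm _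
  let Γ : C(Set.Icc s τ, H) → C(Set.Icc s τ, H) := fun u =>
    ⟨fun r => S (r - s) x + ∫ σ in s..(r : ℝ), S (r - σ) (K σ (ext u σ)),
      (((hS x).comp (continuous_id.sub continuous_const)).comp continuous_subtype_val).add
        ((volterra_continuous hS hM hK hw hKw (hext u) (hextn u) s).comp
          continuous_subtype_val)⟩
  have hΓ : ContractingWith (1 / 2) Γ := by
    refine ⟨by norm_num, LipschitzWith.of_dist_le_mul fun u v => ?_⟩
    rw [ContinuousMap.dist_le (by positivity)]
    intro r
    have hr := r.2
    have hsub : ∀ σ, ext u σ - ext v σ = ext (u - v) σ := fun σ => rfl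
    have hI := fun u : C(Set.Icc s τ, H) =>
      (volterra_kernel_integrable hS hM hK hw hKw (hext u) (hextn u) r).intervalIntegrable
        (a := s) (b := r)
    have hdiff : (Γ u) r - (Γ v) r = ∫ σ in s..(r : ℝ), S (r - σ) (K σ (ext (u - v) σ)) := by
      simp only [Γ, ContinuousMap.coe_mk, add_sub_add_left_eq_sub]
      rw [← intervalIntegral.integral_sub (hI u) (hI v)]
      simp only [← hsub, map_sub]
    rw [dist_eq_norm, hdiff, dist_eq_norm]
    have hb : ∀ σ, ‖S (r - σ) (K σ (ext (u - v) σ))‖ ≤ M * ‖u - v‖ * (L * w σ) := by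
      intro σ
      have hLw : 0 ≤ L * w σ := (norm_nonneg _).trans (hKw σ)
      calc _ ≤ M * L * (w σ * ‖ext (u - v) σ‖) := volterra_kernel_norm_le hM hKw r σ
        _ = M * (L * w σ) * ‖ext (u - v) σ‖ := by ring
        _ ≤ M * (L * w σ) * ‖u - v‖ := by gcongr; exact hextn _ σ
        _ = _ := by ring
    calc _ ≤ ∫ σ in s..(r : ℝ), M * ‖u - v‖ * (L * w σ) :=
          intervalIntegral.norm_integral_le_of_norm_le hr.1 (ae_of_all _ fun σ _ => hb σ)
            ((hw.const_mul L).const_mul _).intervalIntegrable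
      _ ≤ ∫ σ in s..τ, M * ‖u - v‖ * (L * w σ) := by
          refine intervalIntegral.integral_mono_interval le_rfl hr.1 hr.2
            (ae_of_all _ fun σ => ?_) ((hw.const_mul L).const_mul _).intervalIntegrable
          exact mul_nonneg (by positivity) ((norm_nonneg _).trans (hKw σ))
      _ = (M * L * ∫ σ in s..τ, w σ) * ‖u - v‖ := by
          rw [intervalIntegral.integral_const_mul, intervalIntegral.integral_const_mul]; ring
      _ ≤ _ := by
          push_cast
          exact mul_le_mul_of_nonneg_right hsmall (norm_nonneg _)
  set u := ContractingWith.fixedPoint Γ hΓ with hu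
  have hfix : Γ u = u := hΓ.fixedPoint_isFixedPt
  refine ⟨ext u, hext u, ⟨‖u‖, hextn u⟩, fun r hr => ?_⟩
  have h1 : ext u r = u ⟨r, hr⟩ := Set.IccExtend_of_mem hsτ u hr
  rw [h1]
  conv_lhs => rw [← hfix]
  rfl

end Volterra

section Flow

variable {H : Type*} [NormedAddCommGroup H] [InnerProductSpace ℝ H]

/-- A family of symmetric operators `P` propagated backwards along a semigroup `S` on `[0,T]` with
source `Q = R + ⟪P·, A·⟫ + ⟪PA·, ·⟫`, all coefficients being dominated by an integrable weight. -/
structure LyapunovFlow (T M L : ℝ) (w : ℝ → ℝ) (S P A : ℝ → H →L[ℝ] H)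
    (R Q : ℝ → H →L[ℝ] H →L[ℝ] ℝ) : Prop where
  L_nonneg : 0 ≤ L
  S_zero : S 0 = ContinuousLinearMap.id ℝ H
  S_add : ∀ s t, 0 ≤ s → 0 ≤ t → s + t ≤ T → S (s + t) = (S s).comp (S t)
  S_cont : ∀ x, Continuous fun t => S t x
  S_le : ∀ t, ‖S t‖ ≤ M
  P_symm : ∀ t ∈ Set.Icc 0 T, ∀ x y, ⟪P t x, y⟫ = ⟪P t y, x⟫
  P_le : ∀ t ∈ Set.Icc 0 T, ‖P t‖ ≤ M
  w_nonneg : ∀ t, 0 ≤ w t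
  w_int : Integrable w
  A_meas : ∀ x, AEStronglyMeasurable (fun t => A t x) volume
  A_le : ∀ t, ‖A t‖ ≤ L * w t
  R_symm : ∀ t x y, R t x y = R t y x
  R_meas : ∀ x y, AEStronglyMeasurable (fun t => R t x y) volume
  R_le : ∀ t, ‖R t‖ ≤ L * w t
  Q_meas : ∀ x y, AEStronglyMeasurable (fun t => Q t x y) volume
  Q_le : ∀ t, ‖Q t‖ ≤ L * w t
  Q_diag : ∀ t ∈ Set.Icc 0 T, ∀ x, Q t x x = R t x x + 2 * ⟪P t x, A t x⟫
  mild : ∀ t τ, 0 ≤ t → t ≤ τ → τ ≤ T → ∀ x y, ⟪P t x, y⟫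
    = ⟪P τ (S (τ - t) x), S (τ - t) y⟫ + ∫ s in t..τ, Q s (S (s - t) x) (S (s - t) y)

theorem aestronglyMeasurable_bilin_apply {B : ℝ → H →L[ℝ] H →L[ℝ] ℝ}
    (hB : ∀ x y, AEStronglyMeasurable (fun t => B t x y) volume) {u v : ℝ → H}
    (hu : Continuous u) (hv : Continuous v) :
    AEStronglyMeasurable (fun t => B t (u t) (v t)) volume :=
  aestronglyMeasurable_clm_apply (L := fun t => B t (u t))
    (fun y => aestronglyMeasurable_clm_apply (L := fun t => (B t).flip y)
      (fun x => hB x y) hu.aestronglyMeasurable) hv.aestronglyMeasurable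

theorem abs_bilin_apply_le {B : H →L[ℝ] H →L[ℝ] ℝ} {b p q : ℝ} (hB : ‖B‖ ≤ b) {u v : H}
    (hu : ‖u‖ ≤ p) (hv : ‖v‖ ≤ q) : |B u v| ≤ b * p * q := by
  have hb : 0 ≤ b := (norm_nonneg B).trans hB
  have hp : 0 ≤ p := (norm_nonneg _).trans hu
  calc |B u v| ≤ ‖B‖ * ‖u‖ * ‖v‖ := B.le_opNorm₂ u v
    _ ≤ b * p * q := by gcongr

theorem integrable_bilin_apply {B : ℝ → H →L[ℝ] H →L[ℝ] ℝ} {L : ℝ} {w : ℝ → ℝ}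
    (hB : ∀ x y, AEStronglyMeasurable (fun t => B t x y) volume) (hw : Integrable w)
    (hBw : ∀ t, ‖B t‖ ≤ L * w t) {u v : ℝ → H} {p q : ℝ}
    (hu : Continuous u) (hv : Continuous v) (hup : ∀ t, ‖u t‖ ≤ p) (hvq : ∀ t, ‖v t‖ ≤ q) :
    Integrable (fun t => B t (u t) (v t)) :=
  (((hw.const_mul L).mul_const p).mul_const q).mono' (aestronglyMeasurable_bilin_apply hB hu hv)
    (ae_of_all _ fun t => abs_bilin_apply_le (hBw t) (hup t) (hvq t))

theorem abs_inner_apply_le_s9 {P : H →L[ℝ] H} {M p q : ℝ} (hP : ‖P‖ ≤ M) {u v : H}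
    (hu : ‖u‖ ≤ p) (hv : ‖v‖ ≤ q) : |⟪P u, v⟫| ≤ M * p * q := by
  have hb : 0 ≤ M := (norm_nonneg _).trans hP
  have hp : 0 ≤ p := (norm_nonneg _).trans hu
  calc |⟪P u, v⟫| ≤ ‖P u‖ * ‖v‖ := abs_real_inner_le_norm _ _
    _ ≤ M * p * q := by
      gcongr
      exact P.le_of_opNorm_le_of_le hP hu

namespace LyapunovFlow

variable {T M L : ℝ} {w : ℝ → ℝ} {S P A : ℝ → H →L[ℝ] H} {R Q : ℝ → H →L[ℝ] H →L[ℝ] ℝ}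

theorem M_nonneg (h : LyapunovFlow T M L w S P A R Q) : 0 ≤ M :=
  (norm_nonneg _).trans (h.S_le 0)

theorem norm_S_apply_le (h : LyapunovFlow T M L w S P A R Q) (t : ℝ) {x : H} {p : ℝ}
    (hx : ‖x‖ ≤ p) : ‖S t x‖ ≤ M * p :=
  (S t).le_of_opNorm_le_of_le (h.S_le t) hx

theorem S_apply_S_apply (h : LyapunovFlow T M L w S P A R Q) {a b c : ℝ} (hab : a ≤ b)
    (hbc : b ≤ c) (hc : c - a ≤ T) (x : H) : S (c - b) (S (b - a) x) = S (c - a) x := by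
  have := h.S_add (c - b) (b - a) (by linarith) (by linarith) (by linarith)
  rw [show c - b + (b - a) = c - a by ring] at this
  rw [this]; rfl

theorem integral_w_mono (h : LyapunovFlow T M L w S P A R Q) {a b c d : ℝ} (hca : c ≤ a)
    (hab : a ≤ b) (hbd : b ≤ d) : ∫ σ in a..b, w σ ≤ ∫ σ in c..d, w σ :=
  intervalIntegral.integral_mono_interval hca hab hbd (ae_of_all _ h.w_nonneg)
    h.w_int.intervalIntegrable

theorem volterra_restart [CompleteSpace H] (h : LyapunovFlow T M L w S P A R Q) {s τ : ℝ}
    (hs : 0 ≤ s) (hτ : τ ≤ T) {y : ℝ → H} (hy : Continuous y) {Y : ℝ} (hY : ∀ σ, ‖y σ‖ ≤ Y) {x : H}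
    (hyV : ∀ r ∈ Set.Icc s τ, y r = S (r - s) x + ∫ σ in s..r, S (r - σ) (A σ (y σ)))
    {r r' : ℝ} (hr : r ∈ Set.Icc s τ) (hr' : r' ∈ Set.Icc s τ) (hrr' : r ≤ r') :
    y r' = S (r' - r) (y r) + ∫ σ in r..r', S (r' - σ) (A σ (y σ)) := by
  have hI := fun q => volterra_kernel_integrable h.S_cont h.S_le h.A_meas h.w_int h.A_le hy hY q
  have h1 : S (r' - r) (∫ σ in s..r, S (r - σ) (A σ (y σ)))
      = ∫ σ in s..r, S (r' - σ) (A σ (y σ)) := by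
    rw [← ContinuousLinearMap.intervalIntegral_comp_comm _ (hI r).intervalIntegrable]
    refine intervalIntegral.integral_congr fun σ hσ => ?_
    rw [Set.uIcc_of_le hr.1] at hσ
    exact h.S_apply_S_apply hσ.2 hrr' (by linarith [hσ.1, hr'.2]) _
  rw [hyV r hr, map_add, h1, h.S_apply_S_apply hr.1 hrr' (by linarith [hr'.2]), hyV r' hr',
    add_assoc,
    intervalIntegral.integral_add_adjacent_intervals (hI r').intervalIntegrable
      (hI r').intervalIntegrable]

/-- The increments of the energy along a Volterra trajectory are quadratically small. -/
theorem energy_increment_le [CompleteSpace H] (h : LyapunovFlow T M L w S P A R Q) {s τ : ℝ}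
    (hs : 0 ≤ s) (hτ : τ ≤ T) {y : ℝ → H} (hy : Continuous y) {Y : ℝ} (hY : ∀ σ, ‖y σ‖ ≤ Y) {x : H}
    (hyV : ∀ r ∈ Set.Icc s τ, y r = S (r - s) x + ∫ σ in s..r, S (r - σ) (A σ (y σ)))
    {r r' : ℝ} (hr : r ∈ Set.Icc s τ) (hr' : r' ∈ Set.Icc s τ) (hrr' : r ≤ r') :
    |⟪P r' (y r'), y r'⟫ - ⟪P r (y r), y r⟫ + ∫ σ in r..r', R σ (y σ) (y σ)|
      ≤ (M * (M * L * Y) ^ 2 + L ^ 2 * Y ^ 2 * M * (2 * M ^ 2 + 2 * M ^ 2 + (1 + M)))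
        * (∫ σ in r..r', w σ) ^ 2 := by
  have hM := h.M_nonneg
  have hL := h.L_nonneg
  have hY0 : 0 ≤ Y := (norm_nonneg _).trans (hY 0)
  set Ω := ∫ σ in r..r', w σ with hΩ
  have hΩ0 : 0 ≤ Ω := intervalIntegral.integral_nonneg hrr' fun σ _ => h.w_nonneg σ
  have hI := fun q => volterra_kernel_integrable h.S_cont h.S_le h.A_meas h.w_int h.A_le hy hY q
  have hrT : r ∈ Set.Icc 0 T := ⟨hs.trans hr.1, hr.2.trans hτ⟩
  have hr'T : r' ∈ Set.Icc 0 T := ⟨hs.trans hr'.1, hr'.2.trans hτ⟩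
  have hdev : ∀ σ ∈ Set.Icc r r', ‖y σ - S (σ - r) (y r)‖ ≤ M * L * Y * Ω := by
    intro σ hσ
    rw [h.volterra_restart hs hτ hy hY hyV hr ⟨hr.1.trans hσ.1, hσ.2.trans hr'.2⟩ hσ.1,
      add_sub_cancel_left]
    calc _ ≤ ∫ q in r..σ, M * L * Y * w q := by
          refine intervalIntegral.norm_integral_le_of_norm_le hσ.1 (ae_of_all _ fun q _ => ?_)
            (h.w_int.const_mul _).intervalIntegrable
          have hw := h.w_nonneg q
          calc _ ≤ M * L * (w q * ‖y q‖) := volterra_kernel_norm_le h.S_le h.A_le σ q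
            _ ≤ M * L * (w q * Y) := by gcongr; exact hY q
            _ = _ := by ring
      _ = M * L * Y * ∫ q in r..σ, w q := intervalIntegral.integral_const_mul _ _
      _ ≤ _ := mul_le_mul_of_nonneg_left (h.integral_w_mono le_rfl hσ.1 hσ.2) (by positivity)
  set z := ∫ σ in r..r', S (r' - σ) (A σ (y σ)) with hz
  set Sy := S (r' - r) (y r) with hSy
  have hyr' : y r' = Sy + z := h.volterra_restart hs hτ hy hY hyV hr hr' hrr'
  have hzn : ‖z‖ ≤ M * L * Y * Ω := by
    have := hdev r' ⟨hrr', le_rfl⟩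
    rwa [hyr', add_sub_cancel_left] at this
  have huc : Continuous fun σ => S (σ - r) (y r) :=
    (h.S_cont _).comp (continuous_id.sub continuous_const)
  have hun : ∀ σ, ‖S (σ - r) (y r)‖ ≤ M * Y := fun σ => h.norm_S_apply_le _ (hY r)
  have hQI := integrable_bilin_apply h.Q_meas h.w_int h.Q_le huc huc hun hun
  have hRI := integrable_bilin_apply h.R_meas h.w_int h.R_le hy hy hY hY
  have hzI : Integrable fun σ => ⟪P r' Sy, S (r' - σ) (A σ (y σ))⟫ := (hI r').const_inner _
  have hzint : ⟪P r' Sy, z⟫ = ∫ σ in r..r', ⟪P r' Sy, S (r' - σ) (A σ (y σ))⟫ := by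
    have := (innerSL ℝ (P r' Sy)).intervalIntegral_comp_comm (hI r').intervalIntegrable
      (a := r) (b := r')
    simpa using this.symm
  have hmain : ⟪P r' (y r'), y r'⟫ - ⟪P r (y r), y r⟫ + ∫ σ in r..r', R σ (y σ) (y σ)
      = ⟪P r' z, z⟫ + ∫ σ in r..r', (2 * ⟪P r' Sy, S (r' - σ) (A σ (y σ))⟫
        - Q σ (S (σ - r) (y r)) (S (σ - r) (y r)) + R σ (y σ) (y σ)) := by
    have hsub : Integrable fun σ => 2 * ⟪P r' Sy, S (r' - σ) (A σ (y σ))⟫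
        - Q σ (S (σ - r) (y r)) (S (σ - r) (y r)) := (hzI.const_mul 2).sub hQI
    rw [intervalIntegral.integral_add hsub.intervalIntegrable hRI.intervalIntegrable,
      intervalIntegral.integral_sub (hzI.const_mul 2).intervalIntegrable hQI.intervalIntegrable,
      intervalIntegral.integral_const_mul, ← hzint, h.mild r r' hrT.1 hrr' hr'T.2, hyr']
    simp only [map_add, inner_add_left, inner_add_right, h.P_symm r' hr'T z Sy]
    ring
  have hintegrand : ∀ σ ∈ Set.Icc r r', |2 * ⟪P r' Sy, S (r' - σ) (A σ (y σ))⟫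
        - Q σ (S (σ - r) (y r)) (S (σ - r) (y r)) + R σ (y σ) (y σ)|
      ≤ L ^ 2 * Y ^ 2 * M * (2 * M ^ 2 + 2 * M ^ 2 + (1 + M)) * Ω * w σ := by
    intro σ hσ
    have hσT : σ ∈ Set.Icc 0 T := ⟨hrT.1.trans hσ.1, hσ.2.trans hr'T.2⟩
    have hw := h.w_nonneg σ
    set u := S (σ - r) (y r) with hu
    set v := y σ with hv
    have hd : ‖v - u‖ ≤ M * L * Y * Ω := hdev σ hσ
    have hA : ∀ {e : H} {p : ℝ}, ‖e‖ ≤ p → ‖A σ e‖ ≤ L * w σ * p := fun he =>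
      (A σ).le_of_opNorm_le_of_le (h.A_le σ) he
    have hSu : S (r' - σ) u = Sy := h.S_apply_S_apply hσ.1 hσ.2 (by linarith [hrT.1, hr'T.2]) _
    have hmild := h.mild σ r' hσT.1 hσ.2 hr'T.2 u (A σ v)
    rw [hSu] at hmild
    have hJ : |∫ q in σ..r', Q q (S (q - σ) u) (S (q - σ) (A σ v))|
        ≤ L * (M * (M * Y)) * (M * (L * w σ * Y)) * Ω := by
      rw [← Real.norm_eq_abs]
      calc _ ≤ ∫ q in σ..r', L * (M * (M * Y)) * (M * (L * w σ * Y)) * w q := by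
            refine intervalIntegral.norm_integral_le_of_norm_le hσ.2 (ae_of_all _ fun q _ => ?_)
              (h.w_int.const_mul _).intervalIntegrable
            refine (abs_bilin_apply_le (h.Q_le q) (h.norm_S_apply_le _ (hun σ))
              (h.norm_S_apply_le _ (hA (hY σ)))).trans_eq ?_
            ring
        _ = L * (M * (M * Y)) * (M * (L * w σ * Y)) * ∫ q in σ..r', w q :=
            intervalIntegral.integral_const_mul _ _
        _ ≤ _ := mul_le_mul_of_nonneg_left (h.integral_w_mono hσ.1 hσ.2 le_rfl) (by positivity)
    have hPA : |⟪P σ u, A σ (v - u)⟫| ≤ M * (M * Y) * (L * w σ * (M * L * Y * Ω)) :=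
      abs_inner_apply_le_s9 (h.P_le σ hσT) (hun σ) (hA hd)
    have hRR : |R σ (v - u) (v + u)| ≤ L * w σ * (M * L * Y * Ω) * (Y + M * Y) :=
      abs_bilin_apply_le (h.R_le σ) hd ((norm_add_le _ _).trans (add_le_add (hY σ) (hun σ)))
    have hsplit : 2 * ⟪P r' Sy, S (r' - σ) (A σ v)⟫ - Q σ u u + R σ v v
        = -2 * (∫ q in σ..r', Q q (S (q - σ) u) (S (q - σ) (A σ v)))
          + 2 * ⟪P σ u, A σ (v - u)⟫ + R σ (v - u) (v + u) := by
      rw [h.Q_diag σ hσT]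
      simp only [map_add, map_sub, inner_sub_right, sub_apply,
        h.R_symm σ u v]
      linarith
    rw [hsplit]
    rw [abs_le] at hJ hPA hRR ⊢
    constructor <;> nlinarith [hJ.1, hJ.2, hPA.1, hPA.2, hRR.1, hRR.2]
  rw [hmain]
  have hzz : |⟪P r' z, z⟫| ≤ M * (M * L * Y * Ω) * (M * L * Y * Ω) :=
    abs_inner_apply_le_s9 (h.P_le r' hr'T) hzn hzn
  have hIntg := intervalIntegral.norm_integral_le_of_norm_le hrr'
    (ae_of_all _ fun σ hσ => (Real.norm_eq_abs _).trans_le (hintegrand σ ⟨hσ.1.le, hσ.2⟩))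
    (h.w_int.const_mul _).intervalIntegrable
  rw [intervalIntegral.integral_const_mul, Real.norm_eq_abs, ← hΩ] at hIntg
  refine (abs_add_le _ _).trans ((add_le_add hzz hIntg).trans_eq ?_)
  ring

/-- The energy identity along a Volterra trajectory. -/
theorem energy_identity [CompleteSpace H] (h : LyapunovFlow T M L w S P A R Q) {s τ : ℝ}
    (hs : 0 ≤ s) (hsτ : s ≤ τ) (hτ : τ ≤ T) {y : ℝ → H} (hy : Continuous y) {Y : ℝ}
    (hY : ∀ σ, ‖y σ‖ ≤ Y) {x : H}
    (hyV : ∀ r ∈ Set.Icc s τ, y r = S (r - s) x + ∫ σ in s..r, S (r - σ) (A σ (y σ))) :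
    ⟪P s x, x⟫ = ⟪P τ (y τ), y τ⟫ + ∫ σ in s..τ, R σ (y σ) (y σ) := by
  have hRI := integrable_bilin_apply h.R_meas h.w_int h.R_le hy hy hY hY
  have hadd : ∀ r r' : ℝ, ∀ g : ℝ → ℝ, Integrable g →
      (∫ σ in s..r', g σ) - (∫ σ in s..r, g σ) = ∫ σ in r..r', g σ := fun r r' g hg =>
    intervalIntegral.integral_interval_sub_left hg.intervalIntegrable hg.intervalIntegrable
  have := eq_of_abs_sub_le_sq (ω := fun r => ∫ σ in s..r, w σ)
    (D := fun r => ⟪P r (y r), y r⟫ + ∫ σ in s..r, R σ (y σ) (y σ)) hsτ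
    (intervalIntegral.continuous_primitive (fun _ _ => h.w_int.intervalIntegrable) s).continuousOn
    (fun r hr r' hr' hrr' => h.integral_w_mono le_rfl hr.1 hrr')
    (fun r hr r' hr' hrr' => by
      have := h.energy_increment_le hs hτ hy hY hyV hr hr' hrr'
      rw [← hadd r r' _ h.w_int, ← hadd r r' _ hRI] at this
      convert this using 2
      ring)
  have hys : y s = x := by
    rw [hyV s ⟨le_rfl, hsτ⟩]; simp [h.S_zero]
  simp only [intervalIntegral.integral_same, add_zero, hys] at this
  exact this.symm

/-- A weighted square-integral estimate for Volterra trajectories by the free evolution. -/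
theorem integral_weight_sq_volterra_le (h : LyapunovFlow T M L w S P A R Q) {s τ : ℝ}
    (hsτ : s ≤ τ) {y : ℝ → H} (hy : Continuous y) {Y : ℝ} (hY : ∀ σ, ‖y σ‖ ≤ Y) {x : H}
    (hyV : ∀ r ∈ Set.Icc s τ, y r = S (r - s) x + ∫ σ in s..r, S (r - σ) (A σ (y σ)))
    (hsmall : M * L * (∫ σ in s..τ, w σ) ≤ 1 / 2) :
    ∫ σ in s..τ, w σ * ‖y σ‖ ^ 2 ≤ 4 * ∫ σ in s..τ, w σ * ‖S (σ - s) x‖ ^ 2 := by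
  have hM := h.M_nonneg
  have hL := h.L_nonneg
  have hwI : ∀ {g : ℝ → ℝ} {p : ℝ}, Continuous g → (∀ σ, |g σ| ≤ p) →
      Integrable fun σ => w σ * g σ := fun hg hp =>
    h.w_int.mul_bdd hg.aestronglyMeasurable (ae_of_all _ hp)
  have hwc : Continuous fun σ => S (σ - s) x :=
    (h.S_cont _).comp (continuous_id.sub continuous_const)
  have hyI : Integrable fun σ => w σ * ‖y σ‖ :=
    hwI hy.norm (fun σ => (abs_norm _).trans_le (hY σ))
  have hsqI : ∀ {u : ℝ → H} {p : ℝ}, Continuous u → (∀ σ, ‖u σ‖ ≤ p) →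
      Integrable fun σ => w σ * ‖u σ‖ ^ 2 := fun {u p} hu hp =>
    hwI (p := p ^ 2) (hu.norm.pow 2) (fun σ => by
      rw [abs_of_nonneg (by positivity)]
      exact pow_le_pow_left₀ (norm_nonneg _) (hp σ) 2)
  have hy2I := hsqI hy hY
  have hS2I := hsqI hwc (fun σ => h.norm_S_apply_le (σ - s) le_rfl)
  set Ω := ∫ σ in s..τ, w σ with hΩ
  set X := ∫ σ in s..τ, w σ * ‖y σ‖ with hX
  set Z := ∫ σ in s..τ, w σ * ‖y σ‖ ^ 2 with hZ
  set W := ∫ σ in s..τ, w σ * ‖S (σ - s) x‖ ^ 2 with hW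
  have hΩ0 : 0 ≤ Ω := intervalIntegral.integral_nonneg hsτ fun σ _ => h.w_nonneg σ
  have hZ0 : 0 ≤ Z := intervalIntegral.integral_nonneg hsτ fun σ _ =>
    mul_nonneg (h.w_nonneg σ) (by positivity)
  have hpoint : ∀ r ∈ Set.Icc s τ, ‖y r‖ ≤ ‖S (r - s) x‖ + M * L * X := by
    intro r hr
    have h1 : ‖∫ σ in s..r, S (r - σ) (A σ (y σ))‖ ≤ ∫ σ in s..r, M * L * (w σ * ‖y σ‖) :=
      intervalIntegral.norm_integral_le_of_norm_le hr.1
        (ae_of_all _ fun σ _ => volterra_kernel_norm_le h.S_le h.A_le r σ)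
        (hyI.const_mul _).intervalIntegrable
    have h2 : ∫ σ in s..r, w σ * ‖y σ‖ ≤ X :=
      intervalIntegral.integral_mono_interval le_rfl hr.1 hr.2
        (ae_of_all _ fun σ => mul_nonneg (h.w_nonneg σ) (norm_nonneg _)) hyI.intervalIntegrable
    rw [intervalIntegral.integral_const_mul] at h1
    conv_lhs => rw [hyV r hr]
    exact (norm_add_le _ _).trans (by gcongr; exact h1.trans (by gcongr))
  have hCS : X ^ 2 ≤ Ω * Z := by
    have hpos : ∀ θ : ℝ, 0 ≤ Z * (θ * θ) + (-2 * X) * θ + Ω := by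
      intro θ
      have h0 : 0 ≤ ∫ σ in s..τ, (θ * θ * (w σ * ‖y σ‖ ^ 2) + (-2 * θ) * (w σ * ‖y σ‖) + w σ) :=
        intervalIntegral.integral_nonneg hsτ fun σ _ => by
          have := mul_nonneg (h.w_nonneg σ) (sq_nonneg (θ * ‖y σ‖ - 1))
          nlinarith
      have hsum : Integrable fun σ => θ * θ * (w σ * ‖y σ‖ ^ 2) + (-2 * θ) * (w σ * ‖y σ‖) :=
        (hy2I.const_mul _).add (hyI.const_mul _)
      rw [intervalIntegral.integral_add hsum.intervalIntegrable h.w_int.intervalIntegrable,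
        intervalIntegral.integral_add (hy2I.const_mul _).intervalIntegrable
          (hyI.const_mul _).intervalIntegrable,
        intervalIntegral.integral_const_mul, intervalIntegral.integral_const_mul] at h0
      linarith
    have := discrim_le_zero hpos
    unfold discrim at this
    linarith
  have hbound : Z ≤ ∫ σ in s..τ, (2 * (w σ * ‖S (σ - s) x‖ ^ 2) + 2 * (M * L * X) ^ 2 * w σ) := by
    refine intervalIntegral.integral_mono_on hsτ hy2I.intervalIntegrable
      ((hS2I.const_mul 2).add (h.w_int.const_mul _)).intervalIntegrable fun σ hσ => ?_
    have h1 : ‖y σ‖ ^ 2 ≤ 2 * ‖S (σ - s) x‖ ^ 2 + 2 * (M * L * X) ^ 2 := by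
      have := pow_le_pow_left₀ (norm_nonneg _) (hpoint σ hσ) 2
      nlinarith [sq_nonneg (‖S (σ - s) x‖ - M * L * X)]
    nlinarith [mul_le_mul_of_nonneg_left h1 (h.w_nonneg σ)]
  rw [intervalIntegral.integral_add (hS2I.const_mul 2).intervalIntegrable
    (h.w_int.const_mul _).intervalIntegrable, intervalIntegral.integral_const_mul,
    intervalIntegral.integral_const_mul] at hbound
  have hq : (M * L * Ω) ^ 2 ≤ 1 / 4 := by
    have := pow_le_pow_left₀ (by positivity) hsmall 2
    linarith
  have h3 : 2 * (M * L * X) ^ 2 * Ω ≤ 1 / 2 * Z := by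
    calc 2 * (M * L * X) ^ 2 * Ω = 2 * (M * L) ^ 2 * Ω * X ^ 2 := by ring
      _ ≤ 2 * (M * L) ^ 2 * Ω * (Ω * Z) := by gcongr
      _ = 2 * (M * L * Ω) ^ 2 * Z := by ring
      _ ≤ 2 * (1 / 4) * Z := by gcongr
      _ = _ := by ring
  linarith

/-- If `P τ ≥ 0` and `R` is bounded below by `-k w`, then `P s` is bounded below on a short interval
before `τ` by the weighted square-integral of the free evolution. -/
theorem neg_le_inner_of_short [CompleteSpace H] (h : LyapunovFlow T M L w S P A R Q) {s τ k : ℝ}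
    (hs : 0 ≤ s) (hsτ : s ≤ τ) (hτ : τ ≤ T) (hsmall : M * L * (∫ σ in s..τ, w σ) ≤ 1 / 2)
    (hPτ : ∀ x, 0 ≤ ⟪P τ x, x⟫) (hk : 0 ≤ k)
    (hR : ∀ σ ∈ Set.Ico s τ, ∀ u, -(k * w σ * ‖u‖ ^ 2) ≤ R σ u u) (x : H) :
    -(4 * k * ∫ σ in s..τ, w σ * ‖S (σ - s) x‖ ^ 2) ≤ ⟪P s x, x⟫ := by
  obtain ⟨y, hy, ⟨Y, hY⟩, hyV⟩ :=
    exists_volterra_solution h.S_cont h.S_le h.A_meas h.w_int h.A_le hsτ hsmall x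
  have hZ := h.integral_weight_sq_volterra_le hsτ hy hY hyV hsmall
  have hRI := integrable_bilin_apply h.R_meas h.w_int h.R_le hy hy hY hY
  have hy2I : Integrable fun σ => w σ * ‖y σ‖ ^ 2 :=
    h.w_int.mul_bdd (c := Y ^ 2) (hy.norm.pow 2).aestronglyMeasurable (ae_of_all _ fun σ => by
      rw [Real.norm_eq_abs, abs_of_nonneg (by positivity)]
      exact pow_le_pow_left₀ (norm_nonneg _) (hY σ) 2)
  have hlow : ∫ σ in s..τ, -k * (w σ * ‖y σ‖ ^ 2) ≤ ∫ σ in s..τ, R σ (y σ) (y σ) := by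
    refine intervalIntegral.integral_mono_on_of_le_Ioo hsτ
      (hy2I.const_mul _).intervalIntegrable hRI.intervalIntegrable fun σ hσ => ?_
    have := hR σ ⟨hσ.1.le, hσ.2⟩ (y σ)
    linarith
  rw [intervalIntegral.integral_const_mul] at hlow
  rw [h.energy_identity hs hsτ hτ hy hY hyV]
  nlinarith [hPτ (y τ), mul_le_mul_of_nonneg_left hZ hk]

end LyapunovFlow

end Flow

section Weight

variable {T α : ℝ}

theorem intervalIntegrable_sub_rpow (hα : α < 1 / 2) (s a b : ℝ) :
    IntervalIntegrable (fun r => (r - s) ^ (-2 * α)) volume a b := by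
  have := (intervalIntegral.intervalIntegrable_rpow' (a := a - s) (b := b - s)
    (by linarith : -1 < -2 * α)).comp_sub_right s
  simpa using this

theorem intervalIntegrable_const_sub_rpow (hα : α < 1 / 2) (a b : ℝ) :
    IntervalIntegrable (fun r => (T - r) ^ (-2 * α)) volume a b := by
  have := (intervalIntegral.intervalIntegrable_rpow' (a := T - a) (b := T - b)
    (by linarith : -1 < -2 * α)).comp_sub_left T
  simpa using this

theorem integral_sub_rpow (hα : α < 1 / 2) (s τ : ℝ) :
    ∫ r in s..τ, (r - s) ^ (-2 * α) = (τ - s) ^ (1 - 2 * α) / (1 - 2 * α) := by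
  rw [intervalIntegral.integral_comp_sub_right (fun r => r ^ (-2 * α)) s,
    integral_rpow (Or.inl (by linarith)), sub_self, show -2 * α + 1 = 1 - 2 * α by ring,
    Real.zero_rpow (by linarith), sub_zero]

theorem integral_const_sub_rpow_le (hα0 : 0 < α) (hα : α < 1 / 2) {s τ : ℝ} (hsτ : s ≤ τ)
    (hτ : τ ≤ T) :
    ∫ r in s..τ, (T - r) ^ (-2 * α) ≤ (τ - s) ^ (1 - 2 * α) / (1 - 2 * α) := by
  calc ∫ r in s..τ, (T - r) ^ (-2 * α) ≤ ∫ r in s..τ, (τ - r) ^ (-2 * α) := by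
        refine intervalIntegral.integral_mono_on_of_le_Ioo hsτ
          (intervalIntegrable_const_sub_rpow hα _ _) (intervalIntegrable_const_sub_rpow hα _ _)
          fun r hr => ?_
        exact Real.rpow_le_rpow_of_nonpos (by linarith [hr.2]) (by linarith) (by linarith)
    _ = _ := by
        rw [intervalIntegral.integral_comp_sub_left (fun r => r ^ (-2 * α)) τ,
          integral_rpow (Or.inl (by linarith)), sub_self, show -2 * α + 1 = 1 - 2 * α by ring,
          Real.zero_rpow (by linarith), sub_zero]

/-- The product of two singular kernels is controlled by their sum. -/
theorem rpow_mul_rpow_le (hα0 : 0 < α) (hα : α < 1 / 2) {p q : ℝ} (hp : 0 < p) (hq : 0 < q) :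
    p ^ (-2 * α) * q ^ (-2 * α) ≤ 2 * (p + q) ^ (-2 * α) * (p ^ (-2 * α) + q ^ (-2 * α)) := by
  have hhalf : ((p + q) / 2) ^ (-2 * α) ≤ 2 * (p + q) ^ (-2 * α) := by
    rw [Real.div_rpow (by positivity) (by norm_num), div_eq_mul_inv, ← Real.rpow_neg (by norm_num),
      mul_comm]
    gcongr
    calc (2 : ℝ) ^ (-(-2 * α)) ≤ 2 ^ (1 : ℝ) :=
          Real.rpow_le_rpow_of_exponent_le (by norm_num) (by linarith)
      _ = 2 := Real.rpow_one 2
  have hp' : 0 < p ^ (-2 * α) := Real.rpow_pos_of_pos hp _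
  have hq' : 0 < q ^ (-2 * α) := Real.rpow_pos_of_pos hq _
  have hs' : 0 < (p + q) ^ (-2 * α) := Real.rpow_pos_of_pos (by positivity) _
  have hmono : ∀ {a : ℝ}, (p + q) / 2 ≤ a → a ^ (-2 * α) ≤ 2 * (p + q) ^ (-2 * α) := fun ha =>
    (Real.rpow_le_rpow_of_nonpos (by positivity) ha (by linarith)).trans hhalf
  rcases le_total p q with hpq | hpq
  · have := hmono (a := q) (by linarith)
    nlinarith
  · have := hmono (a := p) (by linarith)
    nlinarith

/-- The weight `(T - σ) ^ (-2α)` on `[0,T)`. -/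
noncomputable def singularWeight (T α : ℝ) : ℝ → ℝ :=
  (Set.Ico 0 T).indicator fun σ => (T - σ) ^ (-2 * α)

theorem singularWeight_of_mem {σ : ℝ} (hσ : σ ∈ Set.Ico 0 T) :
    singularWeight T α σ = (T - σ) ^ (-2 * α) := Set.indicator_of_mem hσ _

theorem singularWeight_nonneg (σ : ℝ) : 0 ≤ singularWeight T α σ :=
  Set.indicator_nonneg (fun _ hσ => Real.rpow_nonneg (sub_nonneg.2 hσ.2.le) _) σ

theorem integrable_singularWeight (hT : 0 < T) (hα : α < 1 / 2) :
    Integrable (singularWeight T α) := by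
  rw [singularWeight, integrable_indicator_iff measurableSet_Ico,
    integrableOn_Ico_iff_integrableOn_Ioo, ← integrableOn_Ioc_iff_integrableOn_Ioo,
    ← intervalIntegrable_iff_integrableOn_Ioc_of_le hT.le]
  exact intervalIntegrable_const_sub_rpow hα _ _

theorem integral_singularWeight_le (hT : 0 < T) (hα0 : 0 < α) (hα : α < 1 / 2) {s τ : ℝ}
    (hs : 0 ≤ s) (hsτ : s ≤ τ) (hτ : τ ≤ T) :
    ∫ σ in s..τ, singularWeight T α σ ≤ (τ - s) ^ (1 - 2 * α) / (1 - 2 * α) := by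
  refine le_trans ?_ (integral_const_sub_rpow_le hα0 hα hsτ hτ)
  exact intervalIntegral.integral_mono_on_of_le_Ioo hsτ
    (integrable_singularWeight hT hα).intervalIntegrable
    (intervalIntegrable_const_sub_rpow hα _ _) fun σ hσ =>
      (singularWeight_of_mem ⟨hs.trans hσ.1.le, hσ.2.trans_le hτ⟩).le

/-- A function with the doubly singular bound is integrable against the weight over short intervals,
with the singularity at the left end point recovered and a small constant. -/
theorem integral_singularWeight_mul_le (hT : 0 < T) (hα0 : 0 < α) (hα : α < 1 / 2) {s τ κ : ℝ}
    (hs : 0 ≤ s) (hsτ : s < τ) (hτ : τ ≤ T) (hκ : 0 ≤ κ) {g : ℝ → ℝ}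
    (hgI : IntervalIntegrable (fun σ => singularWeight T α σ * g σ) volume s τ)
    (hg : ∀ σ ∈ Set.Ioo s τ, g σ ≤ κ * ((σ - s) ^ (-2 * α) + (T - s) ^ (-2 * α))) :
    ∫ σ in s..τ, singularWeight T α σ * g σ
      ≤ 5 * κ * ((τ - s) ^ (1 - 2 * α) / (1 - 2 * α)) * (T - s) ^ (-2 * α) := by
  set W := (T - s) ^ (-2 * α) with hW
  have hW0 : 0 ≤ W := Real.rpow_nonneg (by linarith) _
  have hwI : IntervalIntegrable (singularWeight T α) volume s τ :=
    (integrable_singularWeight hT hα).intervalIntegrable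
  have hsI := intervalIntegrable_sub_rpow hα s s τ
  have hmono : ∫ σ in s..τ, singularWeight T α σ * g σ
      ≤ ∫ σ in s..τ, κ * W * (3 * singularWeight T α σ + 2 * (σ - s) ^ (-2 * α)) := by
    refine intervalIntegral.integral_mono_on_of_le_Ioo hsτ.le hgI
      (((hwI.const_mul 3).add (hsI.const_mul 2)).const_mul _) fun σ hσ => ?_
    have hσT : σ ∈ Set.Ico 0 T := ⟨hs.trans hσ.1.le, hσ.2.trans_le hτ⟩
    have hprod := rpow_mul_rpow_le hα0 hα (sub_pos.2 hσT.2) (sub_pos.2 hσ.1)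
    rw [show T - σ + (σ - s) = T - s by ring, ← hW, ← singularWeight_of_mem hσT] at hprod
    have h1 := mul_le_mul_of_nonneg_left (hg σ hσ) (singularWeight_nonneg (T := T) (α := α) σ)
    have h2 := mul_le_mul_of_nonneg_left hprod hκ
    nlinarith
  rw [intervalIntegral.integral_const_mul,
    intervalIntegral.integral_add (hwI.const_mul 3) (hsI.const_mul 2),
    intervalIntegral.integral_const_mul, intervalIntegral.integral_const_mul,
    integral_sub_rpow hα] at hmono
  have h3 := integral_singularWeight_le hT hα0 hα hs hsτ.le hτ
  nlinarith [mul_le_mul_of_nonneg_left h3 (mul_nonneg hκ hW0)]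

end Weight

/-- The sum of an absolutely summable family of symmetric quadratic forms as a bounded bilinear
form. -/
theorem exists_bilin_hasSum {H : Type*} [NormedAddCommGroup H] [InnerProductSpace ℝ H]
    {P : H →L[ℝ] H} (hP : ∀ x y, ⟪P x, y⟫ = ⟪P y, x⟫) (C : ℕ → H →L[ℝ] H) {K : ℝ}
    (hK : 0 ≤ K) (hC : ∀ x, (Summable fun j => |⟪P (C j x), C j x⟫|) ∧
      ∑' j, |⟪P (C j x), C j x⟫| ≤ K * ‖x‖ ^ 2) :
    ∃ B : H →L[ℝ] H →L[ℝ] ℝ, (∀ x y, HasSum (fun j => ⟪P (C j x), C j y⟫) (B x y)) ∧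
      (∀ x y, B x y = B y x) ∧ ‖B‖ ≤ K := by
  have hsum : ∀ x y, Summable fun j => ⟪P (C j x), C j y⟫ := by
    intro x y
    have h1 := ((hC (x + y)).1.of_abs.sub (hC (x - y)).1.of_abs).mul_left (1 / 4)
    refine h1.congr fun j => ?_
    simp only [map_add, map_sub, inner_add_left, inner_add_right, inner_sub_left,
      inner_sub_right, hP (C j y) (C j x)]
    ring
  let b : H →ₗ[ℝ] H →ₗ[ℝ] ℝ := LinearMap.mk₂ ℝ (fun x y => ∑' j, ⟪P (C j x), C j y⟫)
    (fun x x' y => by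
      rw [← (hsum x y).tsum_add (hsum x' y)]
      simp only [map_add, inner_add_left])
    (fun a x y => by
      rw [smul_eq_mul, ← tsum_mul_left]
      simp only [map_smul, real_inner_smul_left])
    (fun x y y' => by
      rw [← (hsum x y).tsum_add (hsum x y')]
      simp only [map_add, inner_add_right])
    (fun a x y => by
      rw [smul_eq_mul, ← tsum_mul_left]
      simp only [map_smul, real_inner_smul_right])
  have hbs : ∀ x y, b x y = b y x := fun x y => tsum_congr fun j => hP _ _
  have hb : ∀ x y, ‖b x y‖ ≤ K * ‖x‖ * ‖y‖ := abs_symm_bilin_le b hbs fun x =>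
    (norm_tsum_le_tsum_norm (f := fun j => ⟪P (C j x), C j x⟫) (hC x).1).trans (hC x).2
  exact ⟨b.mkContinuous₂ K hb, fun x y => (hsum x y).hasSum, hbs,
    LinearMap.mkContinuous₂_norm_le b hK hb⟩

section Construction

variable {H : Type*} [NormedAddCommGroup H] [InnerProductSpace ℝ H] [CompleteSpace H]

/-- A mild solution of the Lyapunov equation satisfying the singular bound is a Lyapunov flow with
singular weight. -/
theorem exists_lyapunovFlow {T α c : ℝ} (hT : 0 < T) (hα0 : 0 < α) (hα : α < 1 / 2) (hc : 0 < c)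
    {S : ℝ → H →L[ℝ] H} (hS0 : S 0 = ContinuousLinearMap.id ℝ H)
    (hSadd : ∀ s t : ℝ, 0 ≤ s → 0 ≤ t → S (s + t) = (S s).comp (S t))
    (hScont : ∀ x : H, ContinuousOn (fun t => S t x) (Set.Ici (0 : ℝ)))
    {A0 : ℝ → H →L[ℝ] H} {Chat : ℕ → ℝ → H →L[ℝ] H} {f : ℝ → H →L[ℝ] H} {G : H →L[ℝ] H}
    (hfsa : ∀ s ∈ Set.Ico (0 : ℝ) T, IsSelfAdjoint (f s))
    (hA0meas : ∀ x : H, StronglyMeasurable fun s => A0 s x)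
    (hCmeas : ∀ j (x : H), StronglyMeasurable fun s => Chat j s x)
    (hfmeas : ∀ x : H, StronglyMeasurable fun s => f s x)
    (hA0 : ∀ s ∈ Set.Ico (0 : ℝ) T, ‖A0 s‖ ≤ c * (T - s) ^ (-α))
    (hf : ∀ s ∈ Set.Ico (0 : ℝ) T, ‖f s‖ ≤ c * (T - s) ^ (-2 * α))
    {P : ℝ → H →L[ℝ] H} (hP : IsLyapunovMildSolution T S A0 Chat f G P)
    (hPC : LyapunovSingularBound T α Chat P) :
    ∃ (M L : ℝ) (S' A : ℝ → H →L[ℝ] H) (R Q : ℝ → H →L[ℝ] H →L[ℝ] ℝ),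
      LyapunovFlow T M L (singularWeight T α) S' P A R Q ∧ (∀ t ∈ Set.Icc 0 T, S' t = S t) ∧
      ∀ σ ∈ Set.Ico 0 T, ∀ u, R σ u u
        = ⟪f σ u, u⟫ + ∑' j, ⟪P σ (Chat j σ u), Chat j σ u⟫ := by
  obtain ⟨hPsa, hPcont, hPmild⟩ := hP
  obtain ⟨C, hC0, hC⟩ := hPC
  set w := singularWeight T α with hw
  have hw0 : ∀ σ, 0 ≤ w σ := singularWeight_nonneg
  have hPsymm : ∀ t ∈ Set.Icc 0 T, ∀ x y, ⟪P t x, y⟫ = ⟪P t y, x⟫ := fun t ht x y => by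
    rw [real_inner_comm]
    exact ((ContinuousLinearMap.isSelfAdjoint_iff_isSymmetric.1 (hPsa t ht)) y x).symm
  have hfsymm : ∀ t ∈ Set.Ico 0 T, ∀ x y, ⟪f t x, y⟫ = ⟪f t y, x⟫ := fun t ht x y => by
    rw [real_inner_comm]
    exact ((ContinuousLinearMap.isSelfAdjoint_iff_isSymmetric.1 (hfsa t ht)) y x).symm
  obtain ⟨M₁, hM₁, hSM⟩ := exists_norm_le_of_strongly_continuousOn (L := S) (a := 0) (b := T)
    fun x => (hScont x).mono Set.Icc_subset_Ici_self
  obtain ⟨M₂, hM₂, hPM⟩ := exists_norm_le_of_strongly_continuousOn hPcont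
  set M := max M₁ M₂ with hM
  have hM1 : 0 ≤ M := le_trans (by linarith) (le_max_left M₁ M₂)
  let S' : ℝ → H →L[ℝ] H := fun t => S (max 0 (min t T))
  have hS' : ∀ t ∈ Set.Icc 0 T, S' t = S t := fun t ht => by
    simp only [S', min_eq_left ht.2, max_eq_right ht.1]
  have hS'cont : ∀ x, Continuous fun t => S' t x := fun x =>
    (hScont x).comp_continuous (continuous_const.max (continuous_id.min continuous_const))
      fun t => Set.mem_Ici.2 (le_max_left _ _)
  have hS'M : ∀ t, ‖S' t‖ ≤ M := fun t =>
    (hSM _ ⟨le_max_left _ _, max_le hT.le (min_le_right _ _)⟩).trans (le_max_left _ _)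
  let A : ℝ → H →L[ℝ] H := (Set.Ico 0 T).indicator A0
  have hAmem : ∀ {σ}, σ ∈ Set.Ico 0 T → A σ = A0 σ := fun hσ => Set.indicator_of_mem hσ _
  have hA : ∀ σ, ‖A σ‖ ≤ c * T ^ α * w σ := by
    intro σ
    by_cases hσ : σ ∈ Set.Ico 0 T
    · rw [hAmem hσ, hw, singularWeight_of_mem hσ]
      refine (hA0 σ hσ).trans ?_
      have hpos : 0 < T - σ := sub_pos.2 hσ.2
      rw [mul_assoc, show -α = α + -2 * α by ring, Real.rpow_add hpos]
      gcongr
      linarith [hσ.1]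
    · simp only [A, Set.indicator_of_notMem hσ, norm_zero]
      exact mul_nonneg (by positivity) (hw0 σ)
  have hB : ∀ σ, ∃ B : H →L[ℝ] H →L[ℝ] ℝ, (σ ∈ Set.Ico 0 T → ∀ x y,
      HasSum (fun j => ⟪P σ (Chat j σ x), Chat j σ y⟫) (B x y)) ∧
      (σ ∉ Set.Ico 0 T → B = 0) ∧ (∀ x y, B x y = B y x) ∧ ‖B‖ ≤ C * w σ := by
    intro σ
    by_cases hσ : σ ∈ Set.Ico 0 T
    · obtain ⟨B, h1, h2, h3⟩ := exists_bilin_hasSum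
        (hPsymm σ (Set.Ico_subset_Icc_self hσ)) (fun j => Chat j σ)
        (mul_nonneg hC0.le (hw0 σ))
        (fun x => by rw [hw, singularWeight_of_mem hσ]; exact hC σ hσ x)
      exact ⟨B, fun _ => h1, fun h => absurd hσ h, h2, h3⟩
    · exact ⟨0, fun h => absurd h hσ, fun _ => rfl, fun _ _ => rfl,
        ContinuousLinearMap.opNorm_zero.trans_le (mul_nonneg hC0.le (hw0 σ))⟩
  choose B hBsum hBzero hBsymm hBle using hB
  let f' : ℝ → H →L[ℝ] H := (Set.Ico 0 T).indicator f
  have hf'mem : ∀ {σ}, σ ∈ Set.Ico 0 T → f' σ = f σ := fun hσ => Set.indicator_of_mem hσ _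
  have hf'le : ∀ σ, ‖f' σ‖ ≤ c * w σ := by
    intro σ
    by_cases hσ : σ ∈ Set.Ico 0 T
    · rw [hf'mem hσ, hw, singularWeight_of_mem hσ]
      exact hf σ hσ
    · simp only [f', Set.indicator_of_notMem hσ, norm_zero]
      exact mul_nonneg hc.le (hw0 σ)
  have hindMeas : ∀ {K : ℝ → H →L[ℝ] H}, (∀ x, StronglyMeasurable fun s => K s x) →
      ∀ x, AEStronglyMeasurable (fun s => (Set.Ico 0 T).indicator K s x) volume := by
    intro K hK x
    have : (fun s => (Set.Ico 0 T).indicator K s x)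
        = (Set.Ico 0 T).indicator fun s => K s x := by
      funext s
      by_cases hs : s ∈ Set.Ico 0 T <;> simp [hs]
    rw [this]
    exact ((hK x).indicator measurableSet_Ico).aestronglyMeasurable
  let ip : H →L[ℝ] H →L[ℝ] ℝ := (innerₗ H).mkContinuous₂ 1 fun x y => by
    simpa using abs_real_inner_le_norm x y
  let R : ℝ → H →L[ℝ] H →L[ℝ] ℝ := fun σ => ip.comp (f' σ) + B σ
  have hR : ∀ σ x y, R σ x y = ⟪f' σ x, y⟫ + B σ x y := fun σ x y => rfl
  let Q : ℝ → H →L[ℝ] H →L[ℝ] ℝ := fun σ => R σ + ip.bilinearComp (P σ) (A σ)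
    + ip.comp ((P σ).comp (A σ))
  have hQ : ∀ σ x y, Q σ x y = R σ x y + ⟪P σ x, A σ y⟫ + ⟪P σ (A σ x), y⟫ := fun σ x y => rfl
  have hPmeas : ∀ x, AEStronglyMeasurable (fun σ => P σ x) (volume.restrict (Set.Ico 0 T)) :=
    fun x => ((hPcont x).mono Set.Ico_subset_Icc_self).aestronglyMeasurable measurableSet_Ico
  have hlift : ∀ {g : ℝ → ℝ}, (∀ σ, σ ∉ Set.Ico 0 T → g σ = 0) →
      AEStronglyMeasurable g (volume.restrict (Set.Ico 0 T)) →
      AEStronglyMeasurable g volume := by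
    intro g hg hgm
    rw [← aestronglyMeasurable_indicator_iff measurableSet_Ico] at hgm
    rwa [Set.indicator_eq_self.2 fun σ hσ => by
      by_contra h
      exact hσ (hg σ h)] at hgm
  have hBmeas : ∀ x y, AEStronglyMeasurable (fun σ => B σ x y) volume := by
    intro x y
    refine hlift (fun σ hσ => by simp [hBzero σ hσ]) ?_
    refine aestronglyMeasurable_of_tendsto_ae atTop
      (f := fun n σ => ∑ j ∈ Finset.range n, ⟪P σ (Chat j σ x), Chat j σ y⟫) (fun n => ?_) ?_
    · exact Finset.aestronglyMeasurable_fun_sum _ fun j _ =>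
        (aestronglyMeasurable_clm_apply hPmeas (hCmeas j x).aestronglyMeasurable).inner
          (hCmeas j y).aestronglyMeasurable
    · filter_upwards [ae_restrict_mem measurableSet_Ico] with σ hσ
      exact (hBsum σ hσ x y).tendsto_sum_nat
  have hRmeas : ∀ x y, AEStronglyMeasurable (fun σ => R σ x y) volume := fun x y =>
    ((hindMeas hfmeas x).inner aestronglyMeasurable_const).add (hBmeas x y)
  have hQmeas : ∀ x y, AEStronglyMeasurable (fun σ => Q σ x y) volume := by
    intro x y
    have hAz : ∀ {σ}, σ ∉ Set.Ico 0 T → A σ = 0 := fun hσ => Set.indicator_of_notMem hσ _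
    refine ((hRmeas x y).add (hlift (fun σ hσ => ?_) ?_)).add (hlift (fun σ hσ => ?_) ?_)
    · simp [hAz hσ]
    · exact (hPmeas x).inner (hindMeas hA0meas y).restrict
    · simp [hAz hσ]
    · exact (aestronglyMeasurable_clm_apply hPmeas (hindMeas hA0meas x).restrict).inner
        aestronglyMeasurable_const
  have hf'n : ∀ σ x y, |⟪f' σ x, y⟫| ≤ c * w σ * ‖x‖ * ‖y‖ := fun σ x y =>
    abs_inner_apply_le_s9 (hf'le σ) le_rfl le_rfl
  have hRle : ∀ σ, ‖R σ‖ ≤ (c + C) * w σ := fun σ =>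
    ContinuousLinearMap.opNorm_le_bound₂ _ (mul_nonneg (by positivity) (hw0 σ)) fun x y => by
      have h1 := abs_bilin_apply_le (hBle σ) (le_refl ‖x‖) (le_refl ‖y‖)
      rw [hR, Real.norm_eq_abs]
      refine (abs_add_le _ _).trans ((add_le_add (hf'n σ x y) h1).trans_eq ?_)
      ring
  have hPA : ∀ σ x y, ‖P σ x‖ * ‖A σ y‖ ≤ M * (c * T ^ α) * w σ * ‖x‖ * ‖y‖ ∧
      ‖P σ (A σ x)‖ * ‖y‖ ≤ M * (c * T ^ α) * w σ * ‖x‖ * ‖y‖ := by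
    intro σ x y
    have hcw : 0 ≤ c * T ^ α * w σ := mul_nonneg (by positivity) (hw0 σ)
    by_cases hσ : σ ∈ Set.Ico 0 T
    · have hPσ : ‖P σ‖ ≤ M := (hPM σ (Set.Ico_subset_Icc_self hσ)).trans (le_max_right _ _)
      have h1 := (P σ).le_of_opNorm_le hPσ x
      have h2 := (A σ).le_of_opNorm_le (hA σ) y
      have h3 := (P σ).le_of_opNorm_le_of_le hPσ ((A σ).le_of_opNorm_le (hA σ) x)
      constructor
      · calc _ ≤ (M * ‖x‖) * (c * T ^ α * w σ * ‖y‖) := by gcongr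
          _ = _ := by ring
      · calc _ ≤ (M * (c * T ^ α * w σ * ‖x‖)) * ‖y‖ := by gcongr
          _ = _ := by ring
    · have hz : A σ = 0 := Set.indicator_of_notMem hσ _
      have h0 : 0 ≤ M * (c * T ^ α) * w σ * ‖x‖ * ‖y‖ := by
        have := hw0 σ
        positivity
      simp only [hz, zero_apply, norm_zero, mul_zero, map_zero, zero_mul]
      exact ⟨h0, h0⟩
  have hQle : ∀ σ, ‖Q σ‖ ≤ (c + C + 2 * (M * (c * T ^ α))) * w σ := fun σ =>
    ContinuousLinearMap.opNorm_le_bound₂ _ (mul_nonneg (by positivity) (hw0 σ)) fun x y => by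
      have h1 := abs_bilin_apply_le (hRle σ) (le_refl ‖x‖) (le_refl ‖y‖)
      have h2 := (abs_real_inner_le_norm (P σ x) (A σ y)).trans (hPA σ x y).1
      have h3 := (abs_real_inner_le_norm (P σ (A σ x)) y).trans (hPA σ x y).2
      rw [hQ, Real.norm_eq_abs]
      refine (abs_add_le _ _).trans
        ((add_le_add ((abs_add_le _ _).trans (add_le_add h1 h2)) h3).trans_eq ?_)
      ring
  set L := c + C + 2 * (M * (c * T ^ α)) + c * T ^ α with hL
  have hcT : 0 ≤ c * T ^ α := by positivity
  have hMcT : 0 ≤ M * (c * T ^ α) := mul_nonneg hM1 hcT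
  have hwInt : Integrable w := integrable_singularWeight hT hα
  have hfull : ∀ t ∈ Set.Icc 0 T, ∀ x y, ⟪P t x, y⟫ = ⟪G (S' (T - t) x), S' (T - t) y⟫
      + ∫ s in t..T, Q s (S' (s - t) x) (S' (s - t) y) := by
    intro t ht x y
    rw [hPmild t ht x y, hS' (T - t) ⟨by linarith [ht.2], by linarith [ht.1]⟩]
    congr 1
    refine intervalIntegral.integral_congr_Ioo_of_le ht.2 fun s hs => ?_
    have hsT : s ∈ Set.Ico 0 T := ⟨ht.1.trans hs.1.le, hs.2⟩
    simp only [hQ, hR, hf'mem hsT, hAmem hsT,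
      hS' (s - t) ⟨by linarith [hs.1], by linarith [ht.1, hs.2]⟩,
      (hBsum s hsT (S (s - t) x) (S (s - t) y)).tsum_eq]
    ring
  have hS'add : ∀ s t, 0 ≤ s → 0 ≤ t → s + t ≤ T → S' (s + t) = (S' s).comp (S' t) := by
    intro s t hs ht hst
    rw [hS' _ ⟨by linarith, hst⟩, hS' s ⟨hs, by linarith⟩, hS' t ⟨ht, by linarith⟩,
      hSadd s t hs ht]
  refine ⟨M, L, S', A, R, Q, ?_, hS', fun σ hσ u => ?_⟩
  · refine
      { L_nonneg := by positivity
        S_zero := by rw [hS' 0 ⟨le_rfl, hT.le⟩, hS0]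
        S_add := hS'add
        S_cont := hS'cont
        S_le := hS'M
        P_symm := hPsymm
        P_le := fun t ht => (hPM t ht).trans (le_max_right _ _)
        w_nonneg := hw0
        w_int := hwInt
        A_meas := hindMeas hA0meas
        A_le := fun t => (hA t).trans (mul_le_mul_of_nonneg_right (by rw [hL]; linarith) (hw0 t))
        R_symm := fun σ x y => ?_
        R_meas := hRmeas
        R_le := fun t =>
          (hRle t).trans (mul_le_mul_of_nonneg_right (by rw [hL]; linarith) (hw0 t))
        Q_meas := hQmeas
        Q_le := fun t =>
          (hQle t).trans (mul_le_mul_of_nonneg_right (by rw [hL]; linarith) (hw0 t))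
        Q_diag := fun t ht x => ?_
        mild := fun t τ ht htτ hτ x y => ?_ }
    · rw [hR, hR, hBsymm σ x y]
      by_cases hσ : σ ∈ Set.Ico 0 T
      · rw [hf'mem hσ, hfsymm σ hσ]
      · simp [f', Set.indicator_of_notMem hσ]
    · rw [hQ, hPsymm t ht (A t x) x]
      ring
    · have hcomp : ∀ s, τ ≤ s → s ≤ T → ∀ z, S' (s - τ) (S' (τ - t) z) = S' (s - t) z := by
        intro s hs hsT z
        have := hS'add (s - τ) (τ - t) (by linarith) (by linarith) (by linarith)
        rw [show s - τ + (τ - t) = s - t by ring] at this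
        rw [this]; rfl
      have hu : ∀ z, Continuous fun s => S' (s - t) z := fun z =>
        (hS'cont z).comp (continuous_id.sub continuous_const)
      have hQI : Integrable fun s => Q s (S' (s - t) x) (S' (s - t) y) :=
        integrable_bilin_apply hQmeas hwInt hQle (hu x) (hu y)
          (fun s => (S' (s - t)).le_of_opNorm_le (hS'M _) x)
          (fun s => (S' (s - t)).le_of_opNorm_le (hS'M _) y)
      rw [hfull t ⟨ht, htτ.trans hτ⟩, hfull τ ⟨ht.trans htτ, hτ⟩, hcomp T hτ le_rfl,
        hcomp T hτ le_rfl, ← intervalIntegral.integral_add_adjacent_intervals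
          (hQI.intervalIntegrable (a := t) (b := τ)) (hQI.intervalIntegrable (a := τ) (b := T))]
      have : ∫ s in τ..T, Q s (S' (s - τ) (S' (τ - t) x)) (S' (s - τ) (S' (τ - t) y))
          = ∫ s in τ..T, Q s (S' (s - t) x) (S' (s - t) y) :=
        intervalIntegral.integral_congr_Ioo_of_le hτ fun s hs => by
          simp only [hcomp s hs.1.le hs.2.le]
      rw [this]
      ring
  · rw [hR, hf'mem hσ, (hBsum σ hσ u u).tsum_eq]

end Construction

section Positivity

variable {H : Type*} [NormedAddCommGroup H] [InnerProductSpace ℝ H] [CompleteSpace H]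

/-- On a short interval to the left of a time at which `P` is nonnegative, a lower bound on the
source form improves to a lower bound with half the constant on the noise form. -/
theorem LyapunovFlow.neg_half_le_tsum_of_short {T M L α c : ℝ} {S P A : ℝ → H →L[ℝ] H}
    {R Q : ℝ → H →L[ℝ] H →L[ℝ] ℝ} (h : LyapunovFlow T M L (singularWeight T α) S P A R Q)
    (hT : 0 < T) (hα0 : 0 < α) (hα : α < 1 / 2) (hc : 0 < c) {s τ η k : ℝ} (hs : 0 ≤ s)
    (hsτ : s < τ) (hτ : τ ≤ T) (hη : (τ - s) ^ (1 - 2 * α) / (1 - 2 * α) ≤ η)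
    (hMη : M * L * η ≤ 1 / 2) (hcη : 40 * c * η ≤ 1) (hPτ : ∀ x, 0 ≤ ⟪P τ x, x⟫) (hk : 0 ≤ k)
    (hR : ∀ σ ∈ Set.Ico s τ, ∀ u, -(k * singularWeight T α σ * ‖u‖ ^ 2) ≤ R σ u u)
    {z : ℕ → H} {X : ℝ}
    (hz : ∀ t ∈ Set.Ioo 0 (T - s), (Summable fun j => ‖S t (z j)‖ ^ 2) ∧
      ∑' j, ‖S t (z j)‖ ^ 2 ≤ c * (t ^ (-2 * α) + (T - s) ^ (-2 * α)) * X ^ 2)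
    (hPz : Summable fun j => ⟪P s (z j), z j⟫) :
    -(k / 2 * (T - s) ^ (-2 * α) * X ^ 2) ≤ ∑' j, ⟪P s (z j), z j⟫ := by
  have hM : 0 ≤ M := (norm_nonneg (S 0)).trans (h.S_le 0)
  have hsmall : M * L * (∫ σ in s..τ, singularWeight T α σ) ≤ 1 / 2 :=
    (mul_le_mul_of_nonneg_left ((integral_singularWeight_le hT hα0 hα hs hsτ.le hτ).trans hη)
      (mul_nonneg hM h.L_nonneg)).trans hMη
  have hW : 0 ≤ (T - s) ^ (-2 * α) := Real.rpow_nonneg (by linarith) _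
  refine ge_of_tendsto' hPz.hasSum fun F => ?_
  have hIntg : ∀ j, Integrable fun σ => singularWeight T α σ * ‖S (σ - s) (z j)‖ ^ 2 := fun j =>
    h.w_int.mul_bdd (c := (M * ‖z j‖) ^ 2)
      ((((h.S_cont (z j)).comp (continuous_sub_right s)).norm.pow 2).aestronglyMeasurable)
      (ae_of_all _ fun σ => by
        rw [Real.norm_eq_abs, abs_of_nonneg (by positivity)]
        exact pow_le_pow_left₀ (norm_nonneg _) ((S _).le_of_opNorm_le (h.S_le _) _) 2)
  have hbound : ∫ σ in s..τ, singularWeight T α σ * ∑ j ∈ F, ‖S (σ - s) (z j)‖ ^ 2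
      ≤ 5 * (c * X ^ 2) * ((τ - s) ^ (1 - 2 * α) / (1 - 2 * α)) * (T - s) ^ (-2 * α) := by
    refine integral_singularWeight_mul_le hT hα0 hα hs hsτ hτ (by positivity) ?_ fun σ hσ => ?_
    · simp only [Finset.mul_sum]
      exact (integrable_finsetSum F fun j _ => hIntg j).intervalIntegrable
    · obtain ⟨h1, h2⟩ := hz (σ - s) ⟨by linarith [hσ.1], by linarith [hσ.2]⟩
      calc ∑ j ∈ F, ‖S (σ - s) (z j)‖ ^ 2 ≤ ∑' j, ‖S (σ - s) (z j)‖ ^ 2 :=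
            h1.sum_le_tsum F fun j _ => by positivity
        _ ≤ _ := h2
        _ = _ := by ring
  have hsum : -(4 * k * ∫ σ in s..τ, singularWeight T α σ * ∑ j ∈ F, ‖S (σ - s) (z j)‖ ^ 2)
      ≤ ∑ j ∈ F, ⟪P s (z j), z j⟫ := by
    simp only [Finset.mul_sum]
    rw [intervalIntegral.integral_finsetSum fun j _ => (hIntg j).intervalIntegrable,
      Finset.mul_sum, ← Finset.sum_neg_distrib]
    exact Finset.sum_le_sum fun j _ =>
      h.neg_le_inner_of_short hs hsτ.le hτ hsmall hPτ hk hR (z j)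
  refine le_trans (neg_le_neg ?_) hsum
  have hkXW : 0 ≤ k * X ^ 2 * (T - s) ^ (-2 * α) := by positivity
  calc _ ≤ 4 * k * (5 * (c * X ^ 2) * η * (T - s) ^ (-2 * α)) := by
        refine mul_le_mul_of_nonneg_left (hbound.trans ?_) (by positivity)
        gcongr
    _ = k * X ^ 2 * (T - s) ^ (-2 * α) * (20 * c * η) := by ring
    _ ≤ k * X ^ 2 * (T - s) ^ (-2 * α) * (1 / 2) :=
        mul_le_mul_of_nonneg_left (by linarith) hkXW
    _ = _ := by ring

end Positivity

/-- if moreover `G ∈ 𝒮⁺(H)` and `f(s) ∈ 𝒮⁺(H)` for every `s ∈ [0,T)`, then any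
mild solution of the Lyapunov equation satisfying the singular bound takes values in `𝒮⁺(H)`:
`⟨P_t x, x⟩ ≥ 0` for every `t ∈ [0,T]` and `x ∈ H`. -/
theorem stmt9
    {H : Type*} [NormedAddCommGroup H] [InnerProductSpace ℝ H] [CompleteSpace H]
    (T α c : ℝ) (hT : 0 < T) (hα0 : 0 < α) (hα : α < 1 / 2) (hc : 0 < c)
    (S : ℝ → H →L[ℝ] H)
    (hS0 : S 0 = ContinuousLinearMap.id ℝ H)
    (hSadd : ∀ s t : ℝ, 0 ≤ s → 0 ≤ t → S (s + t) = (S s).comp (S t))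
    (hScont : ∀ x : H, ContinuousOn (fun t => S t x) (Set.Ici (0 : ℝ)))
    (A0 : ℝ → H →L[ℝ] H) (Chat : ℕ → ℝ → H →L[ℝ] H) (f : ℝ → H →L[ℝ] H)
    (G : H →L[ℝ] H) (hGsa : IsSelfAdjoint G)
    (hfsa : ∀ s ∈ Set.Ico (0 : ℝ) T, IsSelfAdjoint (f s))
    (hA0meas : ∀ x : H, StronglyMeasurable fun s => A0 s x)
    (hCmeas : ∀ j (x : H), StronglyMeasurable fun s => Chat j s x)
    (hfmeas : ∀ x : H, StronglyMeasurable fun s => f s x)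
    (hA0 : ∀ s ∈ Set.Ico (0 : ℝ) T, ‖A0 s‖ ≤ c * (T - s) ^ (-α))
    (hChat : ∀ s ∈ Set.Ico (0 : ℝ) T, ∀ t : ℝ, 0 < t → ∀ x : H,
      (Summable fun j => ‖S t (Chat j s x)‖ ^ 2) ∧
      (∑' j, ‖S t (Chat j s x)‖ ^ 2)
        ≤ c * (t ^ (-2 * α) + (T - s) ^ (-2 * α)) * ‖x‖ ^ 2)
    (hf : ∀ s ∈ Set.Ico (0 : ℝ) T, ‖f s‖ ≤ c * (T - s) ^ (-2 * α))
    (hGpos : ∀ x : H, 0 ≤ ⟪G x, x⟫)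
    (hfpos : ∀ s ∈ Set.Ico (0 : ℝ) T, ∀ x : H, 0 ≤ ⟪f s x, x⟫) :
    ∀ P : ℝ → H →L[ℝ] H,
      IsLyapunovMildSolution T S A0 Chat f G P →
      LyapunovSingularBound T α Chat P →
      ∀ t ∈ Set.Icc (0 : ℝ) T, ∀ x : H, 0 ≤ ⟪P t x, x⟫ := by
  intro P hP hPC
  obtain ⟨M, L, S', A, R, Q, h, hS', hRdiag⟩ := exists_lyapunovFlow hT hα0 hα hc hS0 hSadd hScont
    hfsa hA0meas hCmeas hfmeas hA0 hf hP hPC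
  obtain ⟨C, hC0, hC⟩ := hPC
  have hPT : ∀ x, 0 ≤ ⟪P T x, x⟫ := fun x => by
    rw [hP.2.2 T ⟨hT.le, le_rfl⟩ x x, intervalIntegral.integral_same, sub_self, hS0, add_zero]
    exact hGpos x
  have hML : 0 ≤ M * L := mul_nonneg ((norm_nonneg (S' 0)).trans (h.S_le 0)) h.L_nonneg
  set η := 1 / (2 * (M * L) + 40 * c) with hη
  have hη0 : 0 < η := by positivity
  have hηeq : (2 * (M * L) + 40 * c) * η = 1 := mul_one_div_cancel (by positivity)
  have hMη : M * L * η ≤ 1 / 2 := by nlinarith [mul_pos hc hη0]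
  have hcη : 40 * c * η ≤ 1 := by nlinarith [mul_nonneg hML hη0.le]
  have he : 0 < 1 - 2 * α := by linarith
  set δ := ((1 - 2 * α) * η) ^ (1 / (1 - 2 * α)) with hδ
  have hδ0 : 0 < δ := Real.rpow_pos_of_pos (mul_pos he hη0) _
  have hδη : ∀ {r : ℝ}, 0 ≤ r → r ≤ δ → r ^ (1 - 2 * α) / (1 - 2 * α) ≤ η := by
    intro r hr hrδ
    rw [div_le_iff₀ he, mul_comm η]
    refine (Real.rpow_le_rpow hr hrδ he.le).trans_eq ?_
    rw [hδ, ← Real.rpow_mul (mul_pos he hη0).le, one_div_mul_cancel he.ne', Real.rpow_one]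
  have hshort : ∀ τ ≤ T, (∀ x, 0 ≤ ⟪P τ x, x⟫) → ∀ s, 0 ≤ s → s ≤ τ → τ - s ≤ δ →
      ∀ x, 0 ≤ ⟪P s x, x⟫ := by
    intro τ hτ hPτ s hs hsτ hsδ x
    have hRn : ∀ n : ℕ, ∀ σ ∈ Set.Ico s τ, ∀ u,
        -(C / 2 ^ n * singularWeight T α σ * ‖u‖ ^ 2) ≤ R σ u u := by
      intro n
      induction n with
      | zero =>
        intro σ hσ u
        have hσT : σ ∈ Set.Ico 0 T := ⟨hs.trans hσ.1, hσ.2.trans_le hτ⟩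
        obtain ⟨h1, h2⟩ := hC σ hσT u
        have h3 := norm_tsum_le_tsum_norm (f := fun j => ⟪P σ (Chat j σ u), Chat j σ u⟫) h1
        rw [hRdiag σ hσT, singularWeight_of_mem hσT, pow_zero, div_one]
        linarith [(abs_le.1 (h3.trans h2)).1, hfpos σ hσT u]
      | succ n ih =>
        intro σ hσ u
        have hσT : σ ∈ Set.Ico 0 T := ⟨hs.trans hσ.1, hσ.2.trans_le hτ⟩
        have hhalf := h.neg_half_le_tsum_of_short hT hα0 hα hc hσT.1 hσ.2 hτ
          (hδη (by linarith [hσ.2]) (by linarith [hσ.1])) hMη hcη hPτ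
          (by positivity : 0 ≤ C / 2 ^ n) (fun r hr => ih r ⟨hσ.1.trans hr.1, hr.2⟩)
          (z := fun j => Chat j σ u) (X := ‖u‖) (fun t ht => by
            rw [hS' t ⟨ht.1.le, by linarith [ht.2, hσT.1]⟩]
            exact hChat σ hσT t ht.1 u) (hC σ hσT u).1.of_abs
        rw [hRdiag σ hσT, singularWeight_of_mem hσT, pow_succ, ← div_div]
        linarith [hfpos σ hσT u]
    have hR0 : ∀ σ ∈ Set.Ico s τ, ∀ u, -(0 * singularWeight T α σ * ‖u‖ ^ 2) ≤ R σ u u := by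
      intro σ hσ u
      have hlim : Tendsto (fun n : ℕ => -(C / 2 ^ n * singularWeight T α σ * ‖u‖ ^ 2)) atTop
          (nhds (-(0 * singularWeight T α σ * ‖u‖ ^ 2))) :=
        (((tendsto_const_nhds.div_atTop (tendsto_pow_atTop_atTop_of_one_lt
          one_lt_two)).mul_const _).mul_const _).neg
      exact le_of_tendsto' hlim fun n => hRn n σ hσ u
    have := h.neg_le_inner_of_short hs hsτ hτ
      ((mul_le_mul_of_nonneg_left ((integral_singularWeight_le hT hα0 hα hs hsτ hτ).trans
        (hδη (sub_nonneg.2 hsτ) hsδ)) hML).trans hMη) hPτ le_rfl hR0 x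
    simpa using this
  have hsteps : ∀ n : ℕ, ∀ t ∈ Set.Icc 0 T, T - n * δ ≤ t → ∀ x, 0 ≤ ⟪P t x, x⟫ := by
    intro n
    induction n with
    | zero =>
      intro t ht htn
      rw [show t = T by norm_num at htn; exact le_antisymm ht.2 htn]
      exact hPT
    | succ n ih =>
      intro t ht htn
      push_cast at htn
      exact hshort (min T (t + δ)) (min_le_left _ _)
        (ih _ ⟨le_min hT.le (by linarith [ht.1]), min_le_left _ _⟩
          (le_min (by nlinarith [(n : ℝ) * δ, mul_nonneg n.cast_nonneg hδ0.le]) (by linarith)))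
        t ht.1 (le_min ht.2 (by linarith)) (by linarith [min_le_right T (t + δ)])
  intro t ht
  obtain ⟨n, hn⟩ := exists_nat_ge (T / δ)
  exact hsteps n t ht (by rw [div_le_iff₀ hδ0] at hn; linarith [ht.1])
end
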